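/- arXiv:1611.06218 — 2 statements merged into one kernel-verified Lean document; each statement's English description precedes it below -/
import Mathlib

section
/- Let Φ be a Young function satisfying the Δ2-condition. Every sequence (ξ_n) in L_{Φ*} with sup_n ‖ξ_n‖_{Φ*} < ∞ has a subsequence (ξ_{n_k}) and a ξ ∈ L_{Φ*} such that for every further subsequence (ξ_{n_{k(i)}}), the Cesàro means (1/N) Σ_{i≤N} ξ_{n_{k(i)}} converge to ξ in the Mackey topology τ(L_{Φ*},L_Φ). -/
open MeasureTheory Filter Topology Set
open scoped ENNReal

noncomputable section

namespace OrliczPaper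

variable {Ω : Type*} [MeasurableSpace Ω]

/-- A (finite, coercive) Young function: an even convex function with `Φ 0 = 0`
and `Φ x / x → ∞` as `x → ∞`. -/
structure IsYoung (Φ : ℝ → ℝ) : Prop where
  even : ∀ x, Φ (-x) = Φ x
  convexOn : ConvexOn ℝ Set.univ Φ
  map_zero : Φ 0 = 0
  coercive : Tendsto (fun x => Φ x / x) atTop atTop

/-- The Δ₂-condition: `limsup_{x→∞} Φ(2x)/Φ(x) < ∞`, i.e. `Φ(2x) ≤ C Φ(x)`
for all large `x`. -/
def Delta2 (Φ : ℝ → ℝ) : Prop :=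
  ∃ C x₀ : ℝ, ∀ x ≥ x₀, Φ (2 * x) ≤ C * Φ x

/-- The conjugate Young function `Φ*(y) = sup_x (x y − Φ x)`. -/
def conj (Φ : ℝ → ℝ) (y : ℝ) : ℝ := ⨆ x : ℝ, x * y - Φ x

variable (P : Measure Ω)

/-- Membership in the Orlicz space `L_Φ`: a measurable function with
`E[Φ(l ξ)] < ∞` for some `l > 0`. -/
def MemOrlicz (Φ : ℝ → ℝ) (f : Ω → ℝ) : Prop :=
  Measurable f ∧ ∃ l : ℝ, 0 < l ∧ ∫⁻ ω, ENNReal.ofReal (Φ (l * f ω)) ∂P < ⊤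

/-- The Orlicz space `L_Φ`, as a set of (everywhere defined) measurable functions. -/
def Orlicz (Φ : ℝ → ℝ) : Set (Ω → ℝ) := {f | MemOrlicz P Φ f}

/-- The Luxemburg norm `‖f‖_Φ = inf {l > 0 : E[Φ(f/l)] ≤ 1}`. -/
def luxNorm (Φ : ℝ → ℝ) (f : Ω → ℝ) : ℝ :=
  sInf {l : ℝ | 0 < l ∧ ∫⁻ ω, ENNReal.ofReal (Φ (f ω / l)) ∂P ≤ 1}

/-- The Orlicz (dual) norm `‖f‖_{(Φ*)} = sup {E[g f] : E[Φ(g)] ≤ 1}`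
(the Young function `Φ` here is the one of the *predual*). -/
def orliczNorm (Φ : ℝ → ℝ) (f : Ω → ℝ) : ℝ :=
  sSup {r : ℝ | ∃ g : Ω → ℝ, Measurable g ∧
    (∫⁻ ω, ENNReal.ofReal (Φ (g ω)) ∂P) ≤ 1 ∧ r = ∫ ω, g ω * f ω ∂P}

/-- The bilinear pairing `⟨f, g⟩ = E[f g]`. -/
def pairing (f g : Ω → ℝ) : ℝ := ∫ ω, f ω * g ω ∂P

/-- The weak topology `σ(E, F)` on `E` induced by the pairing with `F`. -/
def weakT (E F : Set (Ω → ℝ)) : TopologicalSpace E :=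
  TopologicalSpace.induced
    (fun ξ : E => fun η : F => pairing P (ξ : Ω → ℝ) (η : Ω → ℝ)) inferInstance

/-- The absolutely convex (convex and balanced) `σ(F,E)`-compact subsets of `F`. -/
def dualSets (E F : Set (Ω → ℝ)) : Set (Set F) :=
  {A | Convex ℝ (Subtype.val '' A) ∧ Balanced ℝ (Subtype.val '' A) ∧
    @IsCompact _ (weakT P F E) A}

/-- The Mackey topology `τ(E, F)`: the topology on `E` of uniform convergence on
absolutely convex `σ(F,E)`-compact subsets of `F`. -/
def mackeyT (E F : Set (Ω → ℝ)) : TopologicalSpace E :=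
  TopologicalSpace.induced
    (fun ξ : E => UniformOnFun.ofFun (dualSets P E F)
      (fun η : F => pairing P (ξ : Ω → ℝ) (η : Ω → ℝ)))
    inferInstance

/-- A distance generating the topology of convergence in `P`-probability. -/
def probDist (f g : Ω → ℝ) : ℝ := ∫ ω, min |f ω - g ω| 1 ∂P

/-- The topology of convergence in probability, restricted to `E ⊆ L₀`. -/
def probT (E : Set (Ω → ℝ)) : TopologicalSpace E :=
  TopologicalSpace.generateFrom
    {U | ∃ f : E, ∃ ε : ℝ, 0 < ε ∧ U = {g : E | probDist P (f : Ω → ℝ) (g : Ω → ℝ) < ε}}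

/-- `L_∞`: essentially bounded measurable functions. -/
def Linf : Set (Ω → ℝ) := {f | Measurable f ∧ ∃ C : ℝ, ∀ᵐ ω ∂P, |f ω| ≤ C}

/-- `L_1`: integrable measurable functions. -/
def L1 : Set (Ω → ℝ) := {f | Measurable f ∧ Integrable f P}

/-- The essential supremum norm. -/
def linfNorm (f : Ω → ℝ) : ℝ := sInf {C : ℝ | 0 ≤ C ∧ ∀ᵐ ω ∂P, |f ω| ≤ C}

/-- Uniform integrability of a set of functions:
`sup_{f ∈ A} E[|f| 1_{|f| > N}] → 0`. -/
def UnifInt (A : Set (Ω → ℝ)) : Prop :=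
  Tendsto (fun N : ℕ => ⨆ f ∈ A, ∫⁻ ω in {ω | (N : ℝ) < |f ω|}, ENNReal.ofReal |f ω| ∂P)
    atTop (𝓝 0)

/-- Uniform integrability of a sequence of functions. -/
def UnifIntSeq (g : ℕ → Ω → ℝ) : Prop :=
  Tendsto (fun N : ℕ => ⨆ n, ∫⁻ ω in {ω | (N : ℝ) < |g n ω|}, ENNReal.ofReal |g n ω| ∂P)
    atTop (𝓝 0)

/-- The Cesàro means of a sequence of functions: `cesaro ξ N` is the average of
`ξ 0, …, ξ N`. -/
def cesaro (ξ : ℕ → Ω → ℝ) (N : ℕ) : Ω → ℝ :=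
  fun ω => (∑ i ∈ Finset.range (N + 1), ξ i ω) / (N + 1)

/-- `sup_n |ξ n| ∈ L_Φ` (order boundedness of the sequence `ξ` in `L_Φ`). -/
def supMem (Φ : ℝ → ℝ) (ξ : ℕ → Ω → ℝ) : Prop :=
  (∀ᵐ ω ∂P, BddAbove (Set.range fun n => |ξ n ω|)) ∧
    MemOrlicz P Φ (fun ω => ⨆ n, |ξ n ω|)

/-- `ξb` is a sequence of forward convex combinations of `ξ`:
`ξb n ∈ conv (ξ k ; k ≥ n)`. -/
def FwdConvComb (ξ ξb : ℕ → Ω → ℝ) : Prop :=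
  ∀ n, ξb n ∈ convexHull ℝ {g : Ω → ℝ | ∃ k ≥ n, g = ξ k}

/-- The left derivative of a convex function. -/
def leftDeriv (Φ : ℝ → ℝ) (y : ℝ) : ℝ :=
  ⨆ h : {h : ℝ // 0 < h}, (Φ y - Φ (y - (h : ℝ))) / (h : ℝ)

/-- `p_Φ(x) = sup_{y > x} y Φ'(y) / Φ(y)`. -/
def pPhiAt (Φ : ℝ → ℝ) (x : ℝ) : ℝ≥0∞ :=
  ⨆ y : {y : ℝ // x < y}, ENNReal.ofReal ((y : ℝ) * leftDeriv Φ (y : ℝ) / Φ (y : ℝ))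

/-- `p_Φ = inf_{x ≥ 0} p_Φ(x)`. -/
def pPhi (Φ : ℝ → ℝ) : ℝ≥0∞ := ⨅ x : {x : ℝ // 0 ≤ x}, pPhiAt Φ x

/-- `q_Φ = p_Φ / (p_Φ − 1)` (with `1/0 = ∞`). -/
def qPhi (Φ : ℝ → ℝ) : ℝ≥0∞ := pPhi Φ / (pPhi Φ - 1)

end OrliczPaper

namespace OrliczPaper

/-! ### Young functions and their conjugates -/

theorem IsYoung.nonneg {Φ : ℝ → ℝ} (hΦ : IsYoung Φ) (x : ℝ) : 0 ≤ Φ x := by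
  have h := hΦ.convexOn.2 (mem_univ x) (mem_univ (-x)) (show (0 : ℝ) ≤ 1 / 2 by norm_num)
    (show (0 : ℝ) ≤ 1 / 2 by norm_num) (by norm_num)
  simp only [smul_eq_mul, hΦ.even] at h
  rw [show 1 / 2 * x + 1 / 2 * -x = 0 by ring, hΦ.map_zero] at h
  linarith

theorem IsYoung.map_mul_le {Φ : ℝ → ℝ} (hΦ : IsYoung Φ) {t : ℝ} (h0 : 0 ≤ t) (h1 : t ≤ 1)
    (x : ℝ) : Φ (t * x) ≤ t * Φ x := by
  have h := hΦ.convexOn.2 (mem_univ x) (mem_univ 0) h0 (sub_nonneg.2 h1) (by ring)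
  simpa [hΦ.map_zero] using h

theorem IsYoung.map_abs {Φ : ℝ → ℝ} (hΦ : IsYoung Φ) (x : ℝ) : Φ |x| = Φ x := by
  rcases abs_choice x with h | h <;> rw [h]
  exact hΦ.even x

theorem IsYoung.mono {Φ : ℝ → ℝ} (hΦ : IsYoung Φ) {x y : ℝ} (h : |x| ≤ |y|) : Φ x ≤ Φ y := by
  rw [← hΦ.map_abs x, ← hΦ.map_abs y]
  rcases (abs_nonneg y).eq_or_lt with hy | hy
  · have : |x| = 0 := le_antisymm (hy ▸ h) (abs_nonneg x)
    rw [this, ← hy]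
  · have h1 : |x| / |y| ≤ 1 := (div_le_one hy).2 h
    have := hΦ.map_mul_le (by positivity) h1 |y|
    rw [div_mul_cancel₀ _ hy.ne'] at this
    exact this.trans (mul_le_of_le_one_left (hΦ.nonneg _) h1)

theorem IsYoung.continuous {Φ : ℝ → ℝ} (hΦ : IsYoung Φ) : Continuous Φ := by
  rw [← continuousOn_univ]
  exact hΦ.convexOn.continuousOn isOpen_univ

theorem IsYoung.measurable {Φ : ℝ → ℝ} (hΦ : IsYoung Φ) : Measurable Φ :=
  hΦ.continuous.measurable

theorem IsYoung.exists_mul_le {Φ : ℝ → ℝ} (hΦ : IsYoung Φ) (a : ℝ) :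
    ∃ R : ℝ, 0 < R ∧ ∀ x, R ≤ |x| → a * |x| ≤ Φ x := by
  obtain ⟨R, hR⟩ := eventually_atTop.1 (hΦ.coercive.eventually_ge_atTop a)
  refine ⟨max R 1, by positivity, fun x hx => ?_⟩
  have hx0 : 0 < |x| := lt_of_lt_of_le (by positivity) hx
  have := hR |x| ((le_max_left _ _).trans hx)
  rwa [le_div_iff₀ hx0, hΦ.map_abs] at this

theorem IsYoung.bddAbove_conj {Φ : ℝ → ℝ} (hΦ : IsYoung Φ) (y : ℝ) :
    BddAbove (range fun x : ℝ => x * y - Φ x) := by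
  obtain ⟨R, hR0, hR⟩ := hΦ.exists_mul_le |y|
  refine ⟨R * |y|, ?_⟩
  rintro _ ⟨x, rfl⟩
  have h1 : x * y ≤ |x| * |y| := by rw [← abs_mul]; exact le_abs_self _
  have h2 := hΦ.nonneg x
  rcases le_total R |x| with h | h
  · have := hR x h
    have : 0 ≤ R * |y| := by positivity
    change x * y - Φ x ≤ _
    linarith
  · have : |x| * |y| ≤ R * |y| := by gcongr
    change x * y - Φ x ≤ _
    linarith

/-- Young's inequality. -/
theorem IsYoung.mul_sub_le_conj {Φ : ℝ → ℝ} (hΦ : IsYoung Φ) (x y : ℝ) :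
    x * y - Φ x ≤ conj Φ y :=
  le_ciSup (hΦ.bddAbove_conj y) x

theorem IsYoung.abs_mul_le {Φ : ℝ → ℝ} (hΦ : IsYoung Φ) (x y : ℝ) :
    |x * y| ≤ Φ x + conj Φ y := by
  rw [abs_le']
  have h1 := hΦ.mul_sub_le_conj x y
  have h2 := hΦ.mul_sub_le_conj (-x) y
  rw [hΦ.even] at h2
  constructor <;> linarith

theorem IsYoung.conj_isYoung {Φ : ℝ → ℝ} (hΦ : IsYoung Φ) : IsYoung (conj Φ) where
  even y := by
    unfold conj
    rw [← (Equiv.neg ℝ).iSup_comp]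
    simp [hΦ.even]
  convexOn := by
    refine ⟨convex_univ, fun x _ y _ a b ha hb hab => ciSup_le fun z => ?_⟩
    have h1 := mul_le_mul_of_nonneg_left (hΦ.mul_sub_le_conj z x) ha
    have h2 := mul_le_mul_of_nonneg_left (hΦ.mul_sub_le_conj z y) hb
    have h3 : Φ z = a * Φ z + b * Φ z := by rw [← add_mul, hab, one_mul]
    simp only [smul_eq_mul]
    linarith
  map_zero := by
    refine le_antisymm (ciSup_le fun x => ?_) ?_
    · simpa using hΦ.nonneg x
    · simpa [hΦ.map_zero] using hΦ.mul_sub_le_conj 0 0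
  coercive := by
    refine tendsto_atTop.2 fun a => ?_
    filter_upwards [eventually_ge_atTop (max 1 (Φ (a + 1)))] with y hy
    have h1 : 1 ≤ y := (le_max_left _ _).trans hy
    have h2 : Φ (a + 1) ≤ y := (le_max_right _ _).trans hy
    rw [le_div_iff₀ (by linarith)]
    have := hΦ.mul_sub_le_conj (a + 1) y
    linarith

/-- The `Δ₂`-condition on `Φ` makes its conjugate grow: `2 l Φ*(y) ≤ Φ*(l y)` for large `y`. -/
theorem Delta2.exists_conj_growth {Φ : ℝ → ℝ} (hΔ : Delta2 Φ) (hΦ : IsYoung Φ) :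
    ∃ l y₀ : ℝ, 2 ≤ l ∧ 0 < y₀ ∧ ∀ y, y₀ ≤ y → 2 * l * conj Φ y ≤ conj Φ (l * y) := by
  obtain ⟨C, x₀, hC⟩ := hΔ
  set D := max C 4 with hD
  set x₁ := max x₀ 0 with hx₁
  have hD4 : 4 ≤ D := le_max_right _ _
  have hx₁0 : 0 ≤ x₁ := le_max_right _ _
  have hDx : ∀ x, x₁ ≤ x → Φ (2 * x) ≤ D * Φ x := fun x hx =>
    (hC x ((le_max_left _ _).trans hx)).trans
      (mul_le_mul_of_nonneg_right (le_max_left _ _) (hΦ.nonneg x))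
  refine ⟨D / 2, max 1 (Φ (x₁ + 1)), by linarith, by positivity, fun y hy => ?_⟩
  have hy1 : 1 ≤ y := (le_max_left _ _).trans hy
  have hy2 : Φ (x₁ + 1) ≤ y := (le_max_right _ _).trans hy
  have key : ∀ x, x₁ ≤ x → D * (x * y - Φ x) ≤ conj Φ (D / 2 * y) := fun x hx => by
    have h1 := hΦ.mul_sub_le_conj (2 * x) (D / 2 * y)
    have h2 := hDx x hx
    linarith
  have hD0 : 0 < D := by linarith
  have : conj Φ y ≤ conj Φ (D / 2 * y) / D := by
    refine ciSup_le fun x => ?_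
    rw [le_div_iff₀ hD0, mul_comm]
    rcases le_total x₁ x with h | h
    · exact key x h
    · refine le_trans ?_ (key (x₁ + 1) (by linarith))
      have := hΦ.nonneg x
      have : x * y ≤ x₁ * y := by gcongr
      exact mul_le_mul_of_nonneg_left (by linarith) hD0.le
  rw [le_div_iff₀ hD0] at this
  linarith

/-- `Φ*(x / N)` is `o(1 / N) Φ*(x)` as `x` and `N` grow. -/
theorem Delta2.exists_conj_div_le {Φ : ℝ → ℝ} (hΔ : Delta2 Φ) (hΦ : IsYoung Φ) {ε : ℝ}
    (hε : 0 < ε) : ∃ X N₀ : ℝ, ∀ x N : ℝ, X ≤ |x| → N₀ ≤ N →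
      conj Φ (x / N) ≤ ε / N * conj Φ x := by
  obtain ⟨l, y₀, hl, hy₀, hgrow⟩ := hΔ.exists_conj_growth hΦ
  have hΨ := hΦ.conj_isYoung
  have hiter : ∀ (m : ℕ) (y : ℝ), y₀ ≤ y → 2 ^ m * l ^ m * conj Φ y ≤ conj Φ (l ^ m * y) := by
    intro m
    induction m with
    | zero => intro y _; simp
    | succ m ih =>
      intro y hy
      have h1 : y₀ ≤ l ^ m * y := by
        have : (1 : ℝ) ≤ l ^ m := one_le_pow₀ (by linarith)
        nlinarith
      have h2 := hgrow _ h1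
      have h3 := ih y hy
      calc 2 ^ (m + 1) * l ^ (m + 1) * conj Φ y = 2 * l * (2 ^ m * l ^ m * conj Φ y) := by ring
        _ ≤ 2 * l * conj Φ (l ^ m * y) := by gcongr
        _ ≤ _ := h2
        _ = _ := by ring_nf
  obtain ⟨m, hm⟩ := pow_unbounded_of_one_lt (1 / ε) (show (1 : ℝ) < 2 by norm_num)
  obtain ⟨X, hX0, hX⟩ := hΨ.exists_mul_le (conj Φ y₀ / y₀ / ε)
  have hlm : (1 : ℝ) ≤ l ^ m := one_le_pow₀ (by linarith)
  refine ⟨X, l ^ m, fun x N hx hN => ?_⟩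
  have hN0 : 0 < N := by linarith
  have hx0 : 0 < |x| := by linarith
  rw [← hΨ.map_abs (x / N), ← hΨ.map_abs x, abs_div, abs_of_pos hN0]
  rcases le_total y₀ (|x| / N) with h | h
  · have h1 := hiter m _ h
    have h2 := hΨ.map_mul_le (t := l ^ m / N) (by positivity) ((div_le_one hN0).2 hN) |x|
    rw [show l ^ m / N * |x| = l ^ m * (|x| / N) by ring] at h2
    have h3 : 2 ^ m * l ^ m * conj Φ (|x| / N) ≤ l ^ m / N * conj Φ |x| := h1.trans h2
    have h4 : 2 ^ m * conj Φ (|x| / N) ≤ 1 / N * conj Φ |x| := by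
      have : l ^ m * (2 ^ m * conj Φ (|x| / N)) ≤ l ^ m * (1 / N * conj Φ |x|) := by
        calc _ = 2 ^ m * l ^ m * conj Φ (|x| / N) := by ring
          _ ≤ _ := h3
          _ = _ := by ring
      exact le_of_mul_le_mul_left this (by linarith)
    have h5 : 1 / ε * conj Φ (|x| / N) ≤ 1 / N * conj Φ |x| :=
      (mul_le_mul_of_nonneg_right hm.le (hΨ.nonneg _)).trans h4
    calc conj Φ (|x| / N) = ε * (1 / ε * conj Φ (|x| / N)) := by field_simp
      _ ≤ ε * (1 / N * conj Φ |x|) := by gcongr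
      _ = _ := by ring
  · have h1 := hΨ.map_mul_le (t := |x| / N / y₀) (by positivity) ((div_le_one hy₀).2 h) y₀
    rw [div_mul_cancel₀ _ hy₀.ne'] at h1
    have h2 := hX |x| (by rwa [abs_abs])
    rw [abs_abs] at h2
    calc conj Φ (|x| / N) ≤ |x| / N / y₀ * conj Φ y₀ := h1
      _ = ε / N * (conj Φ y₀ / y₀ / ε * |x|) := by field_simp
      _ ≤ ε / N * conj Φ |x| := by gcongr

end OrliczPaper

namespace OrliczPaper

/-! ### Cesàro means in Hilbert spaces and in `L¹` -/

/-- The averages of the first `N + 1` terms of a sequence in a vector space. -/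
def avg {E : Type*} [AddCommGroup E] [Module ℝ E] (x : ℕ → E) (N : ℕ) : E :=
  ((N : ℝ) + 1)⁻¹ • ∑ i ∈ Finset.range (N + 1), x i

theorem tendsto_avg {u : ℕ → ℝ} {l : ℝ} (h : Tendsto u atTop (𝓝 l)) :
    Tendsto (avg u) atTop (𝓝 l) := by
  refine ((tendsto_add_atTop_iff_nat 1).2 h.cesaro).congr fun N => ?_
  simp [avg]

theorem avg_sub_const {E : Type*} [AddCommGroup E] [Module ℝ E] (x : ℕ → E) (c : E) (N : ℕ) :
    avg x N - c = avg (fun i => x i - c) N := by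
  have h : ((N : ℝ) + 1) ≠ 0 := by positivity
  simp only [avg, Finset.sum_sub_distrib, Finset.sum_const, Finset.card_range, smul_sub]
  rw [← Nat.cast_smul_eq_nsmul ℝ, smul_smul]
  push_cast
  rw [inv_mul_cancel₀ h, one_smul]

theorem avg_sub {E : Type*} [AddCommGroup E] [Module ℝ E] (x y : ℕ → E) (N : ℕ) :
    avg x N - avg y N = avg (fun i => x i - y i) N := by
  simp only [avg, Finset.sum_sub_distrib, smul_sub]

theorem map_avg {E F : Type*} [AddCommGroup E] [Module ℝ E] [AddCommGroup F] [Module ℝ F]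
    (T : E →ₗ[ℝ] F) (x : ℕ → E) (N : ℕ) : T (avg x N) = avg (fun i => T (x i)) N := by
  simp [avg, map_sum]

theorem avg_mono {u v : ℕ → ℝ} (h : ∀ i, u i ≤ v i) (N : ℕ) : avg u N ≤ avg v N := by
  unfold avg
  gcongr with i
  exact h i

theorem norm_avg_le {E : Type*} [NormedAddCommGroup E] [NormedSpace ℝ E] (x : ℕ → E) (N : ℕ) :
    ‖avg x N‖ ≤ avg (fun i => ‖x i‖) N := by
  have h : (0 : ℝ) ≤ ((N : ℝ) + 1)⁻¹ := by positivity
  rw [avg, norm_smul, Real.norm_of_nonneg h]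
  exact mul_le_mul_of_nonneg_left (norm_sum_le _ _) h

theorem avg_const (c : ℝ) (N : ℕ) : avg (fun _ => c) N = c := by
  have h : ((N : ℝ) + 1) ≠ 0 := by positivity
  simp [avg, h]

theorem norm_avg_sub_avg_le {E : Type*} [NormedAddCommGroup E] [NormedSpace ℝ E] {x y : ℕ → E}
    {ε : ℝ} (h : ∀ i, ‖x i - y i‖ ≤ ε) (N : ℕ) : ‖avg x N - avg y N‖ ≤ ε := by
  rw [avg_sub]
  refine (norm_avg_le _ N).trans ?_
  rw [← avg_const ε N]
  exact avg_mono h N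

/-- If `R i j` holds for all large `j`, for each `i`, then `R` holds along some subsequence. -/
theorem exists_strictMono_chain {R : ℕ → ℕ → Prop} (h : ∀ i, ∀ᶠ j in atTop, R i j) :
    ∃ φ : ℕ → ℕ, StrictMono φ ∧ ∀ i j, i < j → R (φ i) (φ j) := by
  obtain ⟨φ, -, hφ⟩ := exists_seq_of_forall_finset_exists (fun _ : ℕ => True)
    (fun i j => i < j ∧ R i j) (fun s _ => by
      have : ∀ᶠ j in atTop, ∀ i ∈ s, i < j ∧ R i j :=
        (Finset.eventually_all s).2 fun i _ => (eventually_gt_atTop i).and (h i)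
      obtain ⟨j, hj⟩ := this.exists
      exact ⟨j, trivial, hj⟩)
  exact ⟨φ, fun i j hij => (hφ i j hij).1, fun i j hij => (hφ i j hij).2⟩

/-- Double averages of an array of reals that is small off a graph. -/
theorem tendsto_avg_avg {B : ℝ} {g : ℕ → ℕ → ℝ} {e : ℕ → ℝ} {k : ℕ → ℕ}
    (he : Tendsto e atTop (𝓝 0)) (he0 : ∀ i, 0 ≤ e i) (hB : ∀ i j, |g i j| ≤ B)
    (hg : ∀ i j, k i ≠ j → |g i j| ≤ e i + e j) :
    Tendsto (fun p : ℕ × ℕ => avg (fun i => avg (g i) p.2) p.1) atTop (𝓝 0) := by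
  have hB0 : 0 ≤ B := (abs_nonneg _).trans (hB 0 0)
  have hbound : ∀ N M,
      |avg (fun i => avg (g i) M) N| ≤ avg e N + avg e M + B * (1 / ((M : ℝ) + 1)) := by
    intro N M
    have h1 : ∀ i, |avg (g i) M| ≤ e i + (avg e M + B * (1 / ((M : ℝ) + 1))) := by
      intro i
      have h2 : ∀ j, |g i j| ≤ e i + e j + B * (if k i = j then 1 else 0) := by
        intro j
        split_ifs with hij
        · have := hB i j
          have := he0 i
          have := he0 j
          linarith
        · simpa using hg i j hij
      refine (norm_avg_le (g i) M).trans ((avg_mono h2 M).trans ?_)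
      have hM : (0 : ℝ) < (M : ℝ) + 1 := by positivity
      have h3 : (∑ j ∈ Finset.range (M + 1), if k i = j then (1 : ℝ) else 0) ≤ 1 := by
        rw [Finset.sum_ite_eq]
        split_ifs <;> norm_num
      have h4 : ((M : ℝ) + 1)⁻¹ * (B * ∑ j ∈ Finset.range (M + 1), if k i = j then (1 : ℝ) else 0)
          ≤ B * (1 / ((M : ℝ) + 1)) := by
        rw [one_div, mul_comm B (_⁻¹)]
        gcongr
        exact mul_le_of_le_one_right hB0 h3
      have h5 : ((M : ℝ) + 1)⁻¹ * (((M : ℝ) + 1) * e i) = e i := by field_simp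
      simp only [avg, smul_eq_mul, Finset.sum_add_distrib, ← Finset.mul_sum, Finset.sum_const,
        Finset.card_range, nsmul_eq_mul, mul_add] at h4 h5 ⊢
      push_cast
      simp only [← mul_add, one_div] at *
      linarith
    refine (norm_avg_le (fun i => avg (g i) M) N).trans ((avg_mono h1 N).trans ?_)
    have h6 := avg_const (avg e M + B * (1 / ((M : ℝ) + 1))) N
    have : avg (fun i => e i + (avg e M + B * (1 / ((M : ℝ) + 1)))) N
        = avg e N + avg (fun _ => avg e M + B * (1 / ((M : ℝ) + 1))) N := by
      simp only [avg, Finset.sum_add_distrib, smul_add]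
    rw [this, h6, ← add_assoc]
  have hlim : Tendsto (fun p : ℕ × ℕ => avg e p.1 + avg e p.2 + B * (1 / ((p.2 : ℝ) + 1))) atTop
      (𝓝 0) := by
    rw [← prod_atTop_atTop_eq]
    have h1 := (tendsto_avg he).comp (tendsto_fst (f := (atTop : Filter ℕ)) (g := (atTop : Filter ℕ)))
    have h2 := (tendsto_avg he).comp (tendsto_snd (f := (atTop : Filter ℕ)) (g := (atTop : Filter ℕ)))
    have h3 := (tendsto_one_div_add_atTop_nhds_zero_nat (𝕜 := ℝ)).comp
      (tendsto_snd (f := (atTop : Filter ℕ)) (g := (atTop : Filter ℕ)))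
    simpa using (h1.add h2).add (h3.const_mul B)
  exact squeeze_zero_norm (fun p => hbound p.1 p.2) hlim

theorem inner_avg_avg {H : Type*} [NormedAddCommGroup H] [InnerProductSpace ℝ H] (x y : ℕ → H)
    (N M : ℕ) : inner ℝ (avg x N) (avg y M) = avg (fun i => avg (fun j => inner ℝ (x i) (y j)) M) N := by
  simp only [avg, inner_smul_left, inner_smul_right, sum_inner, inner_sum, smul_eq_mul,
    RCLike.conj_to_real]
  simp only [Finset.mul_sum]
  rw [Finset.sum_comm]
  exact Finset.sum_congr rfl fun i _ => Finset.sum_congr rfl fun j _ => by ring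

/-- A bounded sequence in a Hilbert space has a subsequence with almost constant Gram matrix. -/
theorem exists_subseq_inner_almost_const {H : Type*} [NormedAddCommGroup H]
    [InnerProductSpace ℝ H] {x : ℕ → H} {B : ℝ} (hx : ∀ n, ‖x n‖ ≤ B) :
    ∃ n : ℕ → ℕ, StrictMono n ∧ ∃ c : ℝ, ∀ i j, i < j →
      |inner ℝ (x (n i)) (x (n j)) - c| ≤ 2 / ((i : ℝ) + 1) := by
  have hB0 : 0 ≤ B := (norm_nonneg _).trans (hx 0)
  have hin : ∀ m n, inner ℝ (x m) (x n) ∈ Icc (-(B * B)) (B * B) := fun m n =>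
    abs_le.1 ((abs_real_inner_le_norm _ _).trans (mul_le_mul (hx m) (hx n) (norm_nonneg _) hB0))
  obtain ⟨a, ha, φ, hφ, hlim⟩ := (isCompact_univ_pi fun _ : ℕ => isCompact_Icc
    (a := -(B * B)) (b := B * B)).tendsto_subseq
    (x := fun n m => inner ℝ (x m) (x n)) (fun n m _ => hin m n)
  rw [tendsto_pi_nhds] at hlim
  obtain ⟨c, -, ψ, hψ, hc⟩ := (isCompact_Icc (a := -(B * B)) (b := B * B)).tendsto_subseq
    (x := fun n => a (φ n)) (fun n => ha _ (mem_univ _))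
  have hc' : ∀ i : ℕ, ∀ᶠ j in atTop, |a (φ (ψ j)) - c| ≤ 1 / ((i : ℝ) + 1) := fun i => by
    filter_upwards [Metric.tendsto_nhds.1 hc (1 / ((i : ℝ) + 1)) (by positivity)] with j hj
    exact hj.le
  have hlim' : ∀ i : ℕ, ∀ᶠ j in atTop, |inner ℝ (x (φ (ψ i))) (x (φ (ψ j))) - a (φ (ψ i))| ≤
      1 / ((i : ℝ) + 1) := fun i => by
    filter_upwards [Metric.tendsto_nhds.1 ((hlim (φ (ψ i))).comp hψ.tendsto_atTop)
      (1 / ((i : ℝ) + 1)) (by positivity)] with j hj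
    exact hj.le
  obtain ⟨κ, hκ, hκ'⟩ := extraction_forall_of_eventually hc'
  obtain ⟨θ, hθ, hθ'⟩ := exists_strictMono_chain
    (R := fun i j => |inner ℝ (x (φ (ψ (κ i)))) (x (φ (ψ (κ j)))) - a (φ (ψ (κ i)))| ≤
      1 / ((κ i : ℝ) + 1)) (fun i => hκ.tendsto_atTop.eventually (hlim' (κ i)))
  refine ⟨φ ∘ ψ ∘ κ ∘ θ, hφ.comp (hψ.comp (hκ.comp hθ)), c, fun i j hij => ?_⟩
  have h1 := hθ' i j hij
  have h2 := hκ' (θ i)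
  have h3 : (i : ℝ) ≤ θ i := by exact_mod_cast hθ.id_le i
  have h4 : (i : ℝ) ≤ κ (θ i) := by exact_mod_cast (hθ.id_le i).trans (hκ.id_le _)
  have h5 : 1 / ((κ (θ i) : ℝ) + 1) ≤ 1 / ((i : ℝ) + 1) := by gcongr
  have h6 : 1 / ((θ i : ℝ) + 1) ≤ 1 / ((i : ℝ) + 1) := by gcongr
  have h7 := abs_sub_le (inner ℝ (x (φ (ψ (κ (θ i))))) (x (φ (ψ (κ (θ j)))))) (a (φ (ψ (κ (θ i))))) c
  have h8 : 2 / ((i : ℝ) + 1) = 1 / ((i : ℝ) + 1) + 1 / ((i : ℝ) + 1) := by ring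
  simp only [Function.comp_apply]
  linarith

theorem tendsto_inner_avg_avg {H : Type*} [NormedAddCommGroup H] [InnerProductSpace ℝ H]
    {x : ℕ → H} {B c : ℝ} {e : ℕ → ℝ} (hx : ∀ n, ‖x n‖ ≤ B)
    (he : Tendsto e atTop (𝓝 0)) (he0 : ∀ i, 0 ≤ e i) (hanti : Antitone e)
    (hc : ∀ i j, i < j → |inner ℝ (x i) (x j) - c| ≤ e i) {k : ℕ → ℕ} (hk : StrictMono k) :
    Tendsto (fun p : ℕ × ℕ => inner ℝ (avg (fun i => x (k i)) p.1) (avg x p.2)) atTop (𝓝 c) := by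
  have hB0 : 0 ≤ B := (norm_nonneg _).trans (hx 0)
  have h := tendsto_avg_avg (g := fun i j => inner ℝ (x (k i)) (x j) - c) (B := B * B + |c|)
    (k := k) he he0
    (fun i j => (abs_sub _ _).trans (add_le_add ((abs_real_inner_le_norm _ _).trans
      (mul_le_mul (hx _) (hx j) (norm_nonneg _) hB0)) le_rfl)) (fun i j hij => by
        have hki : e (k i) ≤ e i := hanti (hk.id_le i)
        rcases lt_or_gt_of_ne hij with h | h
        · exact (hc _ j h).trans (hki.trans (le_add_of_nonneg_right (he0 j)))
        · rw [real_inner_comm]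
          exact (hc j _ h).trans (le_add_of_nonneg_left (he0 i)))
  rw [← tendsto_sub_nhds_zero_iff]
  refine h.congr fun p => ?_
  rw [inner_avg_avg, avg_sub_const]
  congr 1
  funext i
  rw [avg_sub_const]

/-- The Banach–Saks property of Hilbert spaces, for all further subsequences at once. -/
theorem exists_subseq_tendsto_avg_hilbert {H : Type*} [NormedAddCommGroup H]
    [InnerProductSpace ℝ H] [CompleteSpace H] {x : ℕ → H} {B : ℝ} (hx : ∀ n, ‖x n‖ ≤ B) :
    ∃ n : ℕ → ℕ, StrictMono n ∧ ∃ x₀ : H, ∀ k : ℕ → ℕ, StrictMono k →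
      Tendsto (avg fun i => x (n (k i))) atTop (𝓝 x₀) := by
  obtain ⟨n, hn, c, hc⟩ := exists_subseq_inner_almost_const hx
  set y : ℕ → H := fun i => x (n i) with hy
  have hyB : ∀ i, ‖y i‖ ≤ B := fun i => hx _
  have he : Tendsto (fun i : ℕ => 2 / ((i : ℝ) + 1)) atTop (𝓝 0) := by
    simpa [div_eq_mul_inv] using
      (tendsto_one_div_add_atTop_nhds_zero_nat (𝕜 := ℝ)).const_mul (2 : ℝ)
  have he0 : ∀ i : ℕ, (0 : ℝ) ≤ 2 / ((i : ℝ) + 1) := fun i => by positivity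
  have hanti : Antitone (fun i : ℕ => 2 / ((i : ℝ) + 1)) := fun i j hij => by
    have : (i : ℝ) ≤ j := by exact_mod_cast hij
    dsimp only
    gcongr
  have key : ∀ k : ℕ → ℕ, StrictMono k → Tendsto (fun p : ℕ × ℕ =>
      ‖avg (fun i => y (k i)) p.1 - avg y p.2‖) atTop (𝓝 0) := by
    intro k hk
    have hck : ∀ i j, i < j → |inner ℝ (y (k i)) (y (k j)) - c| ≤ 2 / ((i : ℝ) + 1) :=
      fun i j hij => (hc _ _ (hk hij)).trans (hanti (hk.id_le i))
    have h1 := tendsto_inner_avg_avg (fun n => hyB (k n)) he he0 hanti hck strictMono_id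
    have h2 := tendsto_inner_avg_avg hyB he he0 hanti hc hk
    have h3 := tendsto_inner_avg_avg hyB he he0 hanti hc strictMono_id
    rw [← prod_atTop_atTop_eq] at h1 h2 h3 ⊢
    have hfst := tendsto_fst (f := (atTop : Filter ℕ)) (g := (atTop : Filter ℕ))
    have hsnd := tendsto_snd (f := (atTop : Filter ℕ)) (g := (atTop : Filter ℕ))
    have h4 := (((h1.comp (hfst.prodMk hfst)).sub (h2.const_mul 2)).add
      (h3.comp (hsnd.prodMk hsnd))).sqrt
    rw [show c - 2 * c + c = 0 by ring, Real.sqrt_zero] at h4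
    refine h4.congr fun p => ?_
    simp only [Function.comp_apply, id]
    rw [real_inner_self_eq_norm_sq, real_inner_self_eq_norm_sq, ← norm_sub_sq_real,
      Real.sqrt_sq (norm_nonneg _)]
  have hcauchy : CauchySeq (avg y) := by
    rw [cauchySeq_iff_tendsto_dist_atTop_0]
    simpa only [dist_eq_norm, id] using key id strictMono_id
  obtain ⟨x₀, hx₀⟩ := cauchySeq_tendsto_of_complete hcauchy
  refine ⟨n, hn, x₀, fun k hk => ?_⟩
  have h := key k hk
  rw [← prod_atTop_atTop_eq] at h
  have h' := h.comp ((tendsto_id (x := (atTop : Filter ℕ))).prodMk tendsto_id)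
  have h'' := (tendsto_zero_iff_norm_tendsto_zero.2 h').add hx₀
  rw [zero_add] at h''
  exact h''.congr fun N => by simp [hy]

end OrliczPaper

namespace OrliczPaper

/-- Simultaneous Banach–Saks extraction for countably many bounded sequences in a Hilbert space. -/
theorem exists_subseq_forall_tendsto_avg {H : Type*} [NormedAddCommGroup H]
    [InnerProductSpace ℝ H] [CompleteSpace H] {x : ℕ → ℕ → H} {B : ℕ → ℝ}
    (hx : ∀ K n, ‖x K n‖ ≤ B K) :
    ∃ n : ℕ → ℕ, StrictMono n ∧ ∀ K, ∃ x₀ : H, ∀ k : ℕ → ℕ, StrictMono k →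
      Tendsto (avg fun i => x K (n (k i))) atTop (𝓝 x₀) := by
  have hB : ∀ K, 0 ≤ B K := fun K => (norm_nonneg _).trans (hx K 0)
  set s : ℕ → ℝ := fun K => (1 / 2) ^ K / (B K + 1) with hs
  have hs0 : ∀ K, 0 < s K := fun K => by have := hB K; positivity
  have hle : ∀ K n, ‖s K • x K n‖ ≤ (1 / 2) ^ K := by
    intro K n
    have := hB K
    rw [norm_smul, Real.norm_of_nonneg (hs0 K).le, hs]
    dsimp only
    rw [div_mul_eq_mul_div, div_le_iff₀ (by linarith)]
    gcongr
    linarith [hx K n]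
  have hsq : Summable fun K : ℕ => ((1 / 4 : ℝ)) ^ K :=
    summable_geometric_of_lt_one (by norm_num) (by norm_num)
  have hterm : ∀ K n, ‖s K • x K n‖ ^ (2 : ℝ≥0∞).toReal ≤ (1 / 4 : ℝ) ^ K := by
    intro K n
    have h := hle K n
    have : ((1 / 4 : ℝ)) ^ K = ((1 / 2) ^ K) ^ 2 := by
      rw [← pow_mul, mul_comm, pow_mul]; norm_num
    simp only [ENNReal.toReal_ofNat, Real.rpow_ofNat]
    rw [this]
    gcongr
  have hmem : ∀ n, Memℓp (E := fun _ : ℕ => H) (fun K => s K • x K n) 2 := fun n =>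
    memℓp_gen (Summable.of_nonneg_of_le (fun K => by positivity) (fun K => hterm K n) hsq)
  let X : ℕ → lp (fun _ : ℕ => H) 2 := fun n => ⟨fun K => s K • x K n, hmem n⟩
  have hX : ∀ n, ‖X n‖ ≤ Real.sqrt (∑' K : ℕ, (1 / 4 : ℝ) ^ K) := by
    intro n
    refine Real.le_sqrt_of_sq_le ?_
    have h := lp.norm_rpow_eq_tsum (p := 2) (by norm_num) (X n)
    simp only [ENNReal.toReal_ofNat, Real.rpow_ofNat] at h
    rw [h]
    have h1 := fun K => hterm K n
    simp only [ENNReal.toReal_ofNat, Real.rpow_ofNat] at h1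
    exact (Summable.of_nonneg_of_le (fun K => by positivity) h1 hsq).tsum_le_tsum h1 hsq
  obtain ⟨n, hn, X₀, hX₀⟩ := exists_subseq_tendsto_avg_hilbert hX
  refine ⟨n, hn, fun K => ⟨(s K)⁻¹ • X₀ K, fun k hk => ?_⟩⟩
  have h1 : Tendsto (fun N => (avg (fun i => X (n (k i))) N) K) atTop (𝓝 (X₀ K)) := by
    rw [tendsto_iff_norm_sub_tendsto_zero]
    refine squeeze_zero (fun _ => norm_nonneg _) (fun N => ?_)
      (tendsto_iff_norm_sub_tendsto_zero.1 (hX₀ k hk))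
    exact lp.norm_apply_le_norm (p := 2) (by norm_num)
      (avg (fun i => X (n (k i))) N - X₀) K
  refine (h1.const_smul (s K)⁻¹).congr fun N => ?_
  have h2 : (avg (fun i => X (n (k i))) N) K = avg (fun i => s K • x K (n (k i))) N := by
    simp only [avg, X, lp.coeFn_smul, lp.coeFn_sum]
    exact congrArg (((N : ℝ) + 1)⁻¹ • ·) 
      (Finset.sum_apply (M := fun _ : ℕ => H) K _ fun i L => s L • x L (n (k i)))
  rw [h2]
  simp only [avg, ← Finset.smul_sum]
  rw [smul_comm, smul_smul (s K)⁻¹, inv_mul_cancel₀ (hs0 K).ne', one_smul]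

/-- Banach–Saks extraction in a Banach space for a sequence that can be uniformly approximated
by bounded sequences of a Hilbert space. -/
theorem exists_subseq_tendsto_avg_of_approx {E H : Type*} [NormedAddCommGroup E] [NormedSpace ℝ E]
    [CompleteSpace E] [NormedAddCommGroup H] [InnerProductSpace ℝ H] [CompleteSpace H]
    (T : H →L[ℝ] E) {x : ℕ → E} {z : ℕ → ℕ → H} {B : ℕ → ℝ} (hz : ∀ K n, ‖z K n‖ ≤ B K)
    (hxz : ∀ ε > 0, ∃ K, ∀ n, ‖x n - T (z K n)‖ ≤ ε) :
    ∃ n : ℕ → ℕ, StrictMono n ∧ ∃ x₀ : E, ∀ k : ℕ → ℕ, StrictMono k →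
      Tendsto (avg fun i => x (n (k i))) atTop (𝓝 x₀) := by
  obtain ⟨n, hn, hlim⟩ := exists_subseq_forall_tendsto_avg hz
  choose w hw using hlim
  have key : ∀ ε > 0, ∃ e : E, ∀ k : ℕ → ℕ, StrictMono k →
      ∀ᶠ N in atTop, ‖avg (fun i => x (n (k i))) N - e‖ < ε := by
    intro ε hε
    obtain ⟨K, hK⟩ := hxz (ε / 2) (by positivity)
    refine ⟨T (w K), fun k hk => ?_⟩
    have h1 : Tendsto (fun N => T (avg (fun i => z K (n (k i))) N)) atTop (𝓝 (T (w K))) :=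
      (T.continuous.tendsto _).comp (hw K k hk)
    filter_upwards [Metric.tendsto_nhds.1 h1 (ε / 2) (by positivity)] with N hN
    rw [dist_eq_norm] at hN
    have h2 : T (avg (fun i => z K (n (k i))) N) = avg (fun i => T (z K (n (k i)))) N :=
      map_avg (T : H →ₗ[ℝ] E) _ N
    rw [h2] at hN
    have h3 := norm_avg_sub_avg_le (x := fun i => x (n (k i))) (fun i => hK (n (k i))) N
    have h4 := norm_sub_le_norm_sub_add_norm_sub (avg (fun i => x (n (k i))) N)
      (avg (fun i => T (z K (n (k i)))) N) (T (w K))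
    linarith
  have hcauchy : CauchySeq (avg fun i => x (n i)) := by
    rw [Metric.cauchySeq_iff']
    intro ε hε
    obtain ⟨e, he⟩ := key (ε / 2) (by positivity)
    obtain ⟨N, hN⟩ := eventually_atTop.1 (he id strictMono_id)
    refine ⟨N, fun m hm => ?_⟩
    have h1 := hN m hm
    have h2 := hN N le_rfl
    simp only [id, ← dist_eq_norm] at h1 h2
    have := dist_triangle_right (avg (fun i => x (n i)) m) (avg (fun i => x (n i)) N) e
    linarith
  obtain ⟨x₀, hx₀⟩ := cauchySeq_tendsto_of_complete hcauchy
  refine ⟨n, hn, x₀, fun k hk => Metric.tendsto_nhds.2 fun ε hε => ?_⟩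
  obtain ⟨e, he⟩ := key (ε / 3) (by positivity)
  have h1 : dist x₀ e ≤ ε / 3 := by
    refine le_of_tendsto (hx₀.dist tendsto_const_nhds) ?_
    filter_upwards [he id strictMono_id] with N hN
    rw [dist_eq_norm]
    exact hN.le
  filter_upwards [he k hk] with N hN
  rw [← dist_eq_norm] at hN
  have := dist_triangle_right (avg (fun i => x (n (k i))) N) x₀ e
  linarith

end OrliczPaper

namespace OrliczPaper

variable {Ω : Type*} [MeasurableSpace Ω]

theorem measurable_cesaro {ξ : ℕ → Ω → ℝ} (h : ∀ n, Measurable (ξ n)) (N : ℕ) :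
    Measurable (cesaro ξ N) :=
  (Finset.measurable_sum _ fun i _ => h i).div_const _

/-- The inclusion of `L²` into `L¹` over a probability space. -/
def inclLp (P : Measure Ω) [IsProbabilityMeasure P] : Lp ℝ 2 P →L[ℝ] Lp ℝ 1 P :=
  LinearMap.mkContinuous
    { toFun := fun f => ⟨f, Lp.antitone one_le_two f.2⟩
      map_add' := fun _ _ => rfl
      map_smul' := fun _ _ => rfl } 1 (fun f => by
        rw [one_mul, Lp.norm_def, Lp.norm_def]
        exact ENNReal.toReal_mono (Lp.eLpNorm_ne_top f)
          (eLpNorm_le_eLpNorm_of_exponent_le one_le_two (Lp.aestronglyMeasurable f)))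

theorem inclLp_toLp {P : Measure Ω} [IsProbabilityMeasure P] {f : Ω → ℝ} (h2 : MemLp f 2 P)
    (h1 : MemLp f 1 P) : inclLp P (h2.toLp f) = h1.toLp f := rfl

theorem IsYoung.integrable_of_lintegral {P : Measure Ω} [IsProbabilityMeasure P] {Ψ : ℝ → ℝ}
    (hΨ : IsYoung Ψ) {f : Ω → ℝ} (hf : Measurable f)
    (h : ∫⁻ ω, ENNReal.ofReal (Ψ (f ω)) ∂P < ⊤) : Integrable f P := by
  obtain ⟨R, hR, h1⟩ := hΨ.exists_mul_le 1
  have h2 : Integrable (fun ω => Ψ (f ω)) P :=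
    ⟨(hΨ.measurable.comp hf).aestronglyMeasurable, by
      rw [hasFiniteIntegral_iff_ofReal (ae_of_all _ fun ω => hΨ.nonneg _)]; exact h⟩
  refine ((integrable_const R).add h2).mono' hf.aestronglyMeasurable (ae_of_all _ fun ω => ?_)
  have := hΨ.nonneg (f ω)
  simp only [Pi.add_apply, Real.norm_eq_abs]
  rcases le_total R |f ω| with h3 | h3
  · have := h1 _ h3
    linarith
  · linarith

/-- Komlós-type extraction in `L¹` for a sequence bounded in an Orlicz space. -/
theorem exists_subseq_cesaro_L1 {P : Measure Ω} [IsProbabilityMeasure P] {Ψ : ℝ → ℝ}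
    (hΨ : IsYoung Ψ) {x : ℕ → Ω → ℝ} (hx : ∀ n, Measurable (x n))
    (hb : ∀ n, ∫⁻ ω, ENNReal.ofReal (Ψ (x n ω)) ∂P ≤ 1) :
    ∃ n : ℕ → ℕ, StrictMono n ∧ ∃ x₀ : Ω → ℝ, Measurable x₀ ∧ ∀ k : ℕ → ℕ, StrictMono k →
      Tendsto (fun N => ∫⁻ ω, ENNReal.ofReal |cesaro (fun i => x (n (k i))) N ω - x₀ ω| ∂P)
        atTop (𝓝 0) := by
  choose L hL0 hL using fun K : ℕ => hΨ.exists_mul_le ((K : ℝ) + 1)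
  have hx1 : ∀ n, MemLp (x n) 1 P := fun n => memLp_one_iff_integrable.2
    (hΨ.integrable_of_lintegral (hx n) ((hb n).trans_lt ENNReal.one_lt_top))
  set c : ℕ → ℕ → Ω → ℝ := fun K n ω => max (-(L K)) (min (L K) (x n ω)) with hc
  have hcm : ∀ K n, Measurable (c K n) := fun K n =>
    measurable_const.max (measurable_const.min (hx n))
  have hcb : ∀ K n ω, |c K n ω| ≤ L K := fun K n ω => by
    have := hL0 K
    exact abs_le.2 ⟨le_max_left _ _, max_le (by linarith) (min_le_left _ _)⟩
  have hdiff : ∀ K n ω, |x n ω - c K n ω| ≤ Ψ (x n ω) / ((K : ℝ) + 1) := by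
    intro K n ω
    have h0 := hL0 K
    have hK : (0 : ℝ) < (K : ℝ) + 1 := by positivity
    have hpos : 0 ≤ Ψ (x n ω) / ((K : ℝ) + 1) := div_nonneg (hΨ.nonneg _) hK.le
    rcases le_total (L K) |x n ω| with h | h
    · have h1 : |x n ω| ≤ Ψ (x n ω) / ((K : ℝ) + 1) := by
        rw [le_div_iff₀ hK, mul_comm]
        exact hL K _ h
      refine le_trans ?_ h1
      simp only [hc]
      rcases le_total 0 (x n ω) with h2 | h2
      · rw [abs_of_nonneg h2] at h ⊢
        rw [min_eq_left h, max_eq_right (by linarith), abs_of_nonneg] <;> linarith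
      · rw [abs_of_nonpos h2] at h ⊢
        rw [min_eq_right (by linarith), max_eq_left (by linarith), abs_of_nonpos] <;> linarith
    · have h1 := abs_le.1 h
      simp only [hc]
      rw [min_eq_right h1.2, max_eq_right h1.1, sub_self, abs_zero]
      exact hpos
  have hc2 : ∀ K n p, MemLp (c K n) p P := fun K n p =>
    MemLp.of_bound (hcm K n).aestronglyMeasurable (L K) (ae_of_all _ (hcb K n))
  obtain ⟨n, hn, X₀, hX₀⟩ := exists_subseq_tendsto_avg_of_approx (inclLp P)
    (x := fun n => (hx1 n).toLp (x n)) (z := fun K n => (hc2 K n 2).toLp (c K n))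
    (B := fun K => (measureUnivNNReal P : ℝ) ^ ((2 : ℝ≥0∞).toReal)⁻¹ * L K) (fun K n => by
      refine Lp.norm_le_of_ae_bound (hL0 K).le ?_
      filter_upwards [(hc2 K n 2).coeFn_toLp] with ω hω
      rw [hω]
      exact hcb K n ω) (fun ε hε => by
      obtain ⟨K, hK⟩ := exists_nat_one_div_lt hε
      refine ⟨K, fun n => le_trans ?_ hK.le⟩
      rw [inclLp_toLp (hc2 K n 2) (hc2 K n 1), ← MemLp.toLp_sub, Lp.norm_toLp]
      refine ENNReal.toReal_le_of_le_ofReal (by positivity) ?_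
      rw [eLpNorm_one_eq_lintegral_enorm]
      calc ∫⁻ ω, ‖(x n - c K n) ω‖ₑ ∂P
          ≤ ∫⁻ ω, ENNReal.ofReal (1 / ((K : ℝ) + 1)) * ENNReal.ofReal (Ψ (x n ω)) ∂P := by
            refine lintegral_mono fun ω => ?_
            rw [← ENNReal.ofReal_mul (by positivity), Real.enorm_eq_ofReal_abs, one_div_mul_eq_div]
            exact ENNReal.ofReal_le_ofReal (hdiff K n ω)
        _ = ENNReal.ofReal (1 / ((K : ℝ) + 1)) * ∫⁻ ω, ENNReal.ofReal (Ψ (x n ω)) ∂P :=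
            lintegral_const_mul' _ _ ENNReal.ofReal_ne_top
        _ ≤ ENNReal.ofReal (1 / ((K : ℝ) + 1)) := mul_le_of_le_one_right' (hb n))
  obtain ⟨x₀, hx₀, hx₀'⟩ := (Lp.aestronglyMeasurable X₀)
  refine ⟨n, hn, x₀, hx₀.measurable, fun k hk => ?_⟩
  have h1 := tendsto_iff_edist_tendsto_0.1 (hX₀ k hk)
  refine h1.congr fun N => ?_
  rw [Lp.edist_def, eLpNorm_one_eq_lintegral_enorm]
  have h2 : (avg (fun i => (hx1 (n (k i))).toLp (x (n (k i)))) N : Lp ℝ 1 P) =ᵐ[P]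
      cesaro (fun i => x (n (k i))) N := by
    have h3 : ∀ᵐ ω ∂P, ∀ i, (hx1 (n (k i))).toLp (x (n (k i))) ω = x (n (k i)) ω :=
      ae_all_iff.2 fun i => (hx1 (n (k i))).coeFn_toLp
    filter_upwards [h3, Lp.coeFn_smul ((N : ℝ) + 1)⁻¹
      (∑ i ∈ Finset.range (N + 1), (hx1 (n (k i))).toLp (x (n (k i)))),
      Lp.coeFn_finsetSum (Finset.range (N + 1)) fun i => (hx1 (n (k i))).toLp (x (n (k i)))]
      with ω h4 h5 h6
    rw [avg, h5, Pi.smul_apply, h6, Finset.sum_apply, cesaro, div_eq_inv_mul, smul_eq_mul]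
    simp only [h4]
  refine lintegral_congr_ae ?_
  filter_upwards [h2, hx₀'] with ω h4 h5
  rw [Pi.sub_apply, Real.enorm_eq_ofReal_abs, h4, h5]

end OrliczPaper

namespace OrliczPaper

theorem cesaro_le {Ω : Type*} {Ψ : ℝ → ℝ} (hΨ : IsYoung Ψ) (x : ℕ → Ω → ℝ) (N : ℕ) (ω : Ω) :
    Ψ (cesaro x N ω) ≤ ((N : ℝ) + 1)⁻¹ * ∑ i ∈ Finset.range (N + 1), Ψ (x i ω) := by
  have h : ((N : ℝ) + 1) ≠ 0 := by positivity
  have := hΨ.convexOn.map_sum_le (t := Finset.range (N + 1)) (w := fun _ => ((N : ℝ) + 1)⁻¹)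
    (p := fun i => x i ω) (fun _ _ => by positivity) (by simp [h]) (fun _ _ => mem_univ _)
  simpa only [cesaro, smul_eq_mul, ← Finset.mul_sum, div_eq_inv_mul] using this

variable {Ω : Type*} [MeasurableSpace Ω]

theorem exists_subseq_ae_of_L1 {P : Measure Ω} {F : ℕ → Ω → ℝ} {x₀ : Ω → ℝ}
    (hF : ∀ N, Measurable (F N)) (hx₀ : Measurable x₀)
    (h : Tendsto (fun N => ∫⁻ ω, ENNReal.ofReal |F N ω - x₀ ω| ∂P) atTop (𝓝 0)) :
    ∃ ns : ℕ → ℕ, StrictMono ns ∧ ∀ᵐ ω ∂P, Tendsto (fun i => F (ns i) ω) atTop (𝓝 (x₀ ω)) := by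
  have h1 : TendstoInMeasure P F atTop x₀ :=
    tendstoInMeasure_of_tendsto_eLpNorm one_ne_zero (fun N => (hF N).aestronglyMeasurable)
      hx₀.aestronglyMeasurable (h.congr fun N => by
        rw [eLpNorm_one_eq_lintegral_enorm]
        simp [Real.enorm_eq_ofReal_abs])
  exact h1.exists_seq_tendsto_ae

theorem lintegral_avg_le {P : Measure Ω} {f : ℕ → Ω → ℝ} {b : ℝ≥0∞} (hf : ∀ i, Measurable (f i))
    (hf0 : ∀ i ω, 0 ≤ f i ω) (hb : ∀ i, ∫⁻ ω, ENNReal.ofReal (f i ω) ∂P ≤ b) (N : ℕ) :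
    ∫⁻ ω, ENNReal.ofReal (((N : ℝ) + 1)⁻¹ * ∑ i ∈ Finset.range (N + 1), f i ω) ∂P ≤ b := by
  have h1 : ∀ ω, ENNReal.ofReal (((N : ℝ) + 1)⁻¹ * ∑ i ∈ Finset.range (N + 1), f i ω) =
      ((N : ℝ≥0∞) + 1)⁻¹ * ∑ i ∈ Finset.range (N + 1), ENNReal.ofReal (f i ω) := fun ω => by
    rw [ENNReal.ofReal_mul (by positivity), ENNReal.ofReal_sum_of_nonneg fun i _ => hf0 i ω,
      ENNReal.ofReal_inv_of_pos (by positivity), ENNReal.ofReal_add (by positivity) zero_le_one,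
      ENNReal.ofReal_natCast, ENNReal.ofReal_one]
  simp only [h1]
  rw [lintegral_const_mul _ (by fun_prop), lintegral_finsetSum _ (by fun_prop)]
  calc ((N : ℝ≥0∞) + 1)⁻¹ * ∑ i ∈ Finset.range (N + 1), ∫⁻ ω, ENNReal.ofReal (f i ω) ∂P
      ≤ ((N : ℝ≥0∞) + 1)⁻¹ * ∑ _i ∈ Finset.range (N + 1), b := by
        gcongr with i; exact hb i
    _ = b := by
        rw [Finset.sum_const, Finset.card_range, nsmul_eq_mul, ← mul_assoc]
        push_cast
        rw [ENNReal.inv_mul_cancel (by positivity) (by finiteness), one_mul]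

theorem lintegral_cesaro_le {P : Measure Ω} {Ψ : ℝ → ℝ} (hΨ : IsYoung Ψ) {x : ℕ → Ω → ℝ}
    (hx : ∀ n, Measurable (x n)) {b : ℝ≥0∞}
    (hb : ∀ n, ∫⁻ ω, ENNReal.ofReal (Ψ (x n ω)) ∂P ≤ b) (N : ℕ) :
    ∫⁻ ω, ENNReal.ofReal (Ψ (cesaro x N ω)) ∂P ≤ b :=
  (lintegral_mono fun ω => ENNReal.ofReal_le_ofReal (cesaro_le hΨ x N ω)).trans
    (lintegral_avg_le (fun i => hΨ.measurable.comp (hx i)) (fun _ _ => hΨ.nonneg _) hb N)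

/-- Lower semicontinuity of the modular with respect to `L¹` convergence. -/
theorem lintegral_le_of_L1 {P : Measure Ω} {Ψ : ℝ → ℝ} (hΨ : IsYoung Ψ) {F : ℕ → Ω → ℝ}
    {x₀ : Ω → ℝ} (hF : ∀ N, Measurable (F N)) (hx₀ : Measurable x₀) {b : ℝ≥0∞}
    (hb : ∀ n, ∫⁻ ω, ENNReal.ofReal (Ψ (F n ω)) ∂P ≤ b)
    (h : Tendsto (fun N => ∫⁻ ω, ENNReal.ofReal |F N ω - x₀ ω| ∂P) atTop (𝓝 0)) :
    ∫⁻ ω, ENNReal.ofReal (Ψ (x₀ ω)) ∂P ≤ b := by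
  obtain ⟨ns, -, hns⟩ := exists_subseq_ae_of_L1 hF hx₀ h
  calc ∫⁻ ω, ENNReal.ofReal (Ψ (x₀ ω)) ∂P
      = ∫⁻ ω, liminf (fun i => ENNReal.ofReal (Ψ (F (ns i) ω))) atTop ∂P := by
        refine lintegral_congr_ae ?_
        filter_upwards [hns] with ω hω
        exact (ENNReal.tendsto_ofReal ((hΨ.continuous.tendsto _).comp hω)).liminf_eq.symm
    _ ≤ liminf (fun i => ∫⁻ ω, ENNReal.ofReal (Ψ (F (ns i) ω)) ∂P) atTop :=
        lintegral_liminf_le fun i => (hΨ.measurable.comp (hF (ns i))).ennreal_ofReal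
    _ ≤ b := liminf_le_of_frequently_le' (Frequently.of_forall fun i => hb _)

/-- A sequence `y` splits along the sets `A`: off the sets the moduli `Ψ (y i)` are uniformly
integrable, while the sets carry large values of `y` and almost no mass of earlier terms. -/
structure Splits (P : Measure Ω) (Ψ : ℝ → ℝ) (y : ℕ → Ω → ℝ) (A : ℕ → Set Ω) : Prop where
  measurableSet : ∀ i, MeasurableSet (A i)
  unif : ∀ ε : ℝ≥0∞, ε ≠ 0 → ∃ K : ℝ, 0 ≤ K ∧
    ∀ i, ∫⁻ ω in (A i)ᶜ ∩ {ω | K < Ψ (y i ω)}, ENNReal.ofReal (Ψ (y i ω)) ∂P ≤ ε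
  large : ∀ R : ℝ, ∀ᶠ i in atTop, ∀ ω ∈ A i, R ≤ |y i ω|
  overlap : ∀ i, ∫⁻ ω in ⋃ m > i, A m, ENNReal.ofReal (Ψ (y i ω)) ∂P ≤ (1 / 2) ^ i

theorem Splits.comp {P : Measure Ω} {Ψ : ℝ → ℝ} {y : ℕ → Ω → ℝ} {A : ℕ → Set Ω}
    (h : Splits P Ψ y A) {k : ℕ → ℕ} (hk : StrictMono k) :
    Splits P Ψ (fun i => y (k i)) (fun i => A (k i)) where
  measurableSet i := h.measurableSet _
  unif ε hε := by
    obtain ⟨K, hK0, hK⟩ := h.unif ε hε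
    exact ⟨K, hK0, fun i => hK _⟩
  large R := hk.tendsto_atTop.eventually (h.large R)
  overlap i := by
    refine (lintegral_mono_set ?_).trans ((h.overlap (k i)).trans ?_)
    · exact iUnion₂_subset fun m hm => subset_biUnion_of_mem (u := A) (hk hm)
    · exact pow_le_pow_right_of_le_one' (by simp) (hk.id_le i)

/-- Any sequence bounded in modular has a splitting subsequence. -/
theorem exists_subseq_splits {P : Measure Ω} {Ψ : ℝ → ℝ} (hΨ : IsYoung Ψ) {x : ℕ → Ω → ℝ}
    (hx : ∀ n, Measurable (x n)) (hb : ∀ n, ∫⁻ ω, ENNReal.ofReal (Ψ (x n ω)) ∂P ≤ 1) :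
    ∃ n : ℕ → ℕ, StrictMono n ∧ ∃ A : ℕ → Set Ω, Splits P Ψ (fun i => x (n i)) A := by
  set tail : ℕ → ℕ → ℝ≥0∞ := fun n j =>
    ∫⁻ ω in {ω | (2 : ℝ) ^ j < Ψ (x n ω)}, ENNReal.ofReal (Ψ (x n ω)) ∂P with htail
  have htail1 : ∀ n j, tail n j ≤ 1 := fun n j => (setLIntegral_le_lintegral _ _).trans (hb n)
  have hms : ∀ n j, MeasurableSet {ω | (2 : ℝ) ^ j < Ψ (x n ω)} := fun n j =>
    measurableSet_lt measurable_const (hΨ.measurable.comp (hx n))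
  have hsub : ∀ n {i j : ℕ}, i ≤ j → {ω | (2 : ℝ) ^ j < Ψ (x n ω)} ⊆ {ω | (2 : ℝ) ^ i < Ψ (x n ω)} :=
    fun n i j hij ω hω => show (2 : ℝ) ^ i < Ψ (x n ω) from
      lt_of_le_of_lt (pow_le_pow_right₀ one_le_two hij) hω
  obtain ⟨φ, -, θ, hθ, hlim⟩ := (isCompact_univ (X := ℕ → ℝ≥0∞)).tendsto_subseq
    (x := tail) (fun _ => mem_univ _)
  rw [tendsto_pi_nhds] at hlim
  have hφ1 : ∀ j, φ j ≤ 1 := fun j => le_of_tendsto' (hlim j) fun n => htail1 _ j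
  have hφanti : Antitone φ := fun i j hij => le_of_tendsto_of_tendsto' (hlim j) (hlim i)
    fun n => lintegral_mono_set (hsub _ hij)
  have hev : ∀ k : ℕ, ∀ᶠ n in atTop, ∀ j ∈ Finset.range (k + 1),
      tail (θ n) j ∈ Icc (φ j - (1 / 2) ^ k) (φ j + (1 / 2) ^ k) := fun k =>
    (Finset.eventually_all _).2 fun j _ =>
      (ENNReal.tendsto_nhds ((hφ1 j).trans_lt ENNReal.one_lt_top).ne).1 (hlim j) _
        (by simp [ENNReal.pow_pos])
  obtain ⟨κ, hκ, hκ'⟩ := extraction_forall_of_eventually hev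
  set y : ℕ → Ω → ℝ := fun i => x (θ (κ i)) with hy
  set A : ℕ → Set Ω := fun i => {ω | (2 : ℝ) ^ i < Ψ (y i ω)} with hA
  have hunif : ∀ ε : ℝ≥0∞, ε ≠ 0 → ∃ K : ℝ, 0 ≤ K ∧
      ∀ i, ∫⁻ ω in (A i)ᶜ ∩ {ω | K < Ψ (y i ω)}, ENNReal.ofReal (Ψ (y i ω)) ∂P ≤ ε := by
    intro ε hε
    have hε3 : 0 < ε / 3 := ENNReal.div_pos hε (by simp)
    have h1 : ∀ᶠ j in atTop, φ j < (⨅ j, φ j) + ε / 3 :=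
      (tendsto_atTop_iInf hφanti).eventually_lt_const
        (ENNReal.lt_add_right (((iInf_le φ 0).trans (hφ1 0)).trans_lt ENNReal.one_lt_top).ne
          hε3.ne')
    have h2 : ∀ᶠ j : ℕ in atTop, ((1 / 2 : ℝ≥0∞)) ^ j < ε / 3 :=
      (ENNReal.tendsto_pow_atTop_nhds_zero_of_lt_one (by simp)).eventually_lt_const hε3
    obtain ⟨j, hj1, hj2⟩ := (h1.and h2).exists
    refine ⟨2 ^ j, by positivity, fun i => ?_⟩
    rcases le_total i j with hij | hij
    · have : (A i)ᶜ ∩ {ω | (2 : ℝ) ^ j < Ψ (y i ω)} = ∅ := by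
        ext ω
        simp only [hA, mem_inter_iff, mem_compl_iff, mem_ofPred_eq, mem_empty_iff_false, iff_false,
          not_and, not_lt, not_lt]
        intro h
        exact h.trans (pow_le_pow_right₀ one_le_two hij)
      rw [this]
      simp
    · have hi := (hκ' i i (by simp)).1
      have hj := (hκ' i j (by simp; omega)).2
      have hpow : ((1 / 2 : ℝ≥0∞)) ^ i ≤ (1 / 2) ^ j := pow_le_pow_right_of_le_one' (by simp) hij
      have hsplit : tail (θ (κ i)) i + ∫⁻ ω in (A i)ᶜ ∩ {ω | (2 : ℝ) ^ j < Ψ (y i ω)},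
          ENNReal.ofReal (Ψ (y i ω)) ∂P = tail (θ (κ i)) j := by
        simp only [htail]
        rw [← lintegral_inter_add_sdiff _ {ω | (2 : ℝ) ^ j < Ψ (x (θ (κ i)) ω)} (hms (θ (κ i)) i)]
        congr 2
        · rw [inter_eq_right.2 (hsub _ hij)]
        · rw [sdiff_eq, inter_comm]
      have hfin : tail (θ (κ i)) i ≠ ⊤ := ((htail1 _ _).trans_lt ENNReal.one_lt_top).ne
      refine (ENNReal.add_le_add_iff_left hfin).1 ?_
      rw [hsplit]
      rw [tsub_le_iff_right] at hi
      calc tail (θ (κ i)) j ≤ φ j + (1 / 2) ^ i := hj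
        _ ≤ (φ i + ε / 3) + ε / 3 := by
            gcongr
            · exact hj1.le.trans (by gcongr; exact iInf_le _ _)
            · exact hpow.trans hj2.le
        _ ≤ (tail (θ (κ i)) i + ε / 3 + ε / 3) + ε / 3 := by
            gcongr
            exact hi.trans (by gcongr; exact hpow.trans hj2.le)
        _ = tail (θ (κ i)) i + ε := by
            rw [add_assoc, add_assoc, ← add_assoc (ε / 3), ENNReal.add_thirds]
  have hlarge : ∀ R : ℝ, ∀ᶠ i in atTop, ∀ ω ∈ A i, R ≤ |y i ω| := by
    intro R
    filter_upwards [(tendsto_pow_atTop_atTop_of_one_lt (one_lt_two (α := ℝ))).eventually_ge_atTop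
      (Ψ R)] with i hi ω hω
    by_contra! hlt
    exact absurd (hΨ.mono (hlt.le.trans (le_abs_self R))) (not_le.2 (hi.trans_lt hω))
  have hAm : ∀ i, MeasurableSet (A i) := fun i => hms _ i
  have hPA : ∀ i, P (A i) ≤ (1 / 2) ^ i := by
    intro i
    have h1 : (2 : ℝ≥0∞) ^ i * P {ω | (2 : ℝ≥0∞) ^ i ≤ ENNReal.ofReal (Ψ (y i ω))} ≤ 1 :=
      (mul_meas_ge_le_lintegral (hΨ.measurable.comp (hx _)).ennreal_ofReal _).trans (hb _)
    have h2 : A i ⊆ {ω | (2 : ℝ≥0∞) ^ i ≤ ENNReal.ofReal (Ψ (y i ω))} := fun ω hω => by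
      have : (2 : ℝ≥0∞) ^ i = ENNReal.ofReal (2 ^ i) := by
        rw [ENNReal.ofReal_pow (by norm_num)]; simp
      rw [mem_ofPred_eq, this]
      exact ENNReal.ofReal_le_ofReal (le_of_lt hω)
    rw [one_div, ← ENNReal.inv_pow, ENNReal.le_inv_iff_mul_le, mul_comm]
    exact (mul_le_mul_right (measure_mono h2) _).trans h1
  have htails : Tendsto (fun m => P (⋃ l ≥ m, A l)) atTop (𝓝 0) := by
    have h1 := ENNReal.tendsto_sum_nat_add (fun i => P (A i)) (ne_top_of_le_ne_top
      (by rw [ENNReal.tsum_geometric]; simp) (ENNReal.tsum_le_tsum hPA))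
    refine tendsto_of_tendsto_of_tendsto_of_le_of_le tendsto_const_nhds h1
      (fun _ => zero_le) (fun m => ?_)
    refine (measure_mono ?_).trans (measure_iUnion_le _)
    refine iUnion₂_subset fun l hl => ?_
    exact (subset_iUnion (fun i => A (i + m)) (l - m)).trans' (by rw [Nat.sub_add_cancel hl])
  have hchain : ∀ i : ℕ, ∀ᶠ m in atTop,
      ∫⁻ ω in ⋃ l ≥ m, A l, ENNReal.ofReal (Ψ (y i ω)) ∂P ≤ (1 / 2) ^ i := by
    intro i
    have h1 := tendsto_setLIntegral_zero (f := fun ω => ENNReal.ofReal (Ψ (y i ω))) (μ := P)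
      ((hb _).trans_lt ENNReal.one_lt_top).ne htails
    exact (h1.eventually_lt_const (by simp [ENNReal.pow_pos])).mono fun m hm => hm.le
  obtain ⟨ψ, hψ, hψ'⟩ := exists_strictMono_chain hchain
  refine ⟨fun i => θ (κ (ψ i)), hθ.comp (hκ.comp hψ), fun i => A (ψ i), fun i => hAm _,
    fun ε hε => ?_, fun R => hψ.tendsto_atTop.eventually (hlarge R), fun i => ?_⟩
  · obtain ⟨K, hK0, hK⟩ := hunif ε hε
    exact ⟨K, hK0, fun i => hK _⟩
  · refine (lintegral_mono_set (iUnion₂_subset fun m hm => ?_)).trans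
      ((hψ' i (i + 1) (Nat.lt_succ_self i)).trans
        (pow_le_pow_right_of_le_one' (by simp) (hψ.id_le i)))
    exact subset_biUnion_of_mem (u := A) (hψ.monotone hm)

end OrliczPaper

namespace OrliczPaper

theorem IsYoung.map_quarter_le {Ψ : ℝ → ℝ} (hΨ : IsYoung Ψ) (a b c d : ℝ) :
    Ψ (1 / 4 * (a + b + c - d)) ≤ Ψ a + Ψ b + Ψ c + Ψ d := by
  have half : ∀ p q, Ψ ((1 / 2) * p + (1 / 2) * q) ≤ (1 / 2) * Ψ p + (1 / 2) * Ψ q := fun p q => by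
    simpa using hΨ.convexOn.2 (mem_univ p) (mem_univ q) (by norm_num : (0 : ℝ) ≤ 1 / 2)
      (by norm_num : (0 : ℝ) ≤ 1 / 2) (by norm_num)
  have h1 := half ((1 / 2) * a + (1 / 2) * b) ((1 / 2) * c + (1 / 2) * (-d))
  have h2 := half a b
  have h3 := half c (-d)
  rw [hΨ.even] at h3
  have := hΨ.nonneg a
  have := hΨ.nonneg b
  have := hΨ.nonneg c
  have := hΨ.nonneg d
  rw [show 1 / 4 * (a + b + c - d) = (1 / 2) * ((1 / 2) * a + (1 / 2) * b) +
    (1 / 2) * ((1 / 2) * c + (1 / 2) * (-d)) by ring]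
  linarith

/-- The modular of an average of functions with disjoint supports. -/
theorem IsYoung.map_cesaro_disjoint_le {Ω : Type*} {Ψ : ℝ → ℝ} (hΨ : IsYoung Ψ) {g : ℕ → Ω → ℝ}
    {ω : Ω} (hg : ∀ i j, i < j → g i ω ≠ 0 → g j ω = 0) (N : ℕ) :
    Ψ (cesaro g N ω) ≤ ∑ i ∈ Finset.range (N + 1), Ψ (g i ω / ((N : ℝ) + 1)) := by
  by_cases h : ∃ i ∈ Finset.range (N + 1), g i ω ≠ 0
  · obtain ⟨i, hi, hne⟩ := h
    have hsum : ∑ j ∈ Finset.range (N + 1), g j ω = g i ω := by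
      refine Finset.sum_eq_single_of_mem i hi fun j _ hji => ?_
      rcases lt_or_gt_of_ne hji with h | h
      · by_contra h0
        exact hne (hg j i h h0)
      · exact hg i j h hne
    rw [cesaro, hsum]
    exact Finset.single_le_sum (f := fun i => Ψ (g i ω / ((N : ℝ) + 1)))
      (fun j _ => hΨ.nonneg _) hi
  · push Not at h
    rw [cesaro, Finset.sum_eq_zero h, zero_div, hΨ.map_zero]
    exact Finset.sum_nonneg fun j _ => hΨ.nonneg _

variable {Ω : Type*} [MeasurableSpace Ω]

theorem lintegral_mul_sum {P : Measure Ω} {f : ℕ → Ω → ℝ} (hf : ∀ i, Measurable (f i))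
    (hf0 : ∀ i ω, 0 ≤ f i ω) {c : ℝ} (hc : 0 ≤ c) (s : Finset ℕ) :
    ∫⁻ ω, ENNReal.ofReal (c * ∑ i ∈ s, f i ω) ∂P =
      ENNReal.ofReal c * ∑ i ∈ s, ∫⁻ ω, ENNReal.ofReal (f i ω) ∂P := by
  have h1 : ∀ ω, ENNReal.ofReal (c * ∑ i ∈ s, f i ω) =
      ENNReal.ofReal c * ∑ i ∈ s, ENNReal.ofReal (f i ω) := fun ω => by
    rw [ENNReal.ofReal_mul hc, ENNReal.ofReal_sum_of_nonneg fun i _ => hf0 i ω]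
  simp only [h1]
  rw [lintegral_const_mul _ (by fun_prop), lintegral_finsetSum _ (by fun_prop)]

/-- Truncated moduli of an `L¹`-null sequence tend to zero in `L¹`. -/
theorem tendsto_lintegral_min_of_L1 {P : Measure Ω} {Ψ : ℝ → ℝ} (hΨ : IsYoung Ψ) {F : ℕ → Ω → ℝ}
    {x₀ : Ω → ℝ} (hF : ∀ N, Measurable (F N)) (hx₀ : Measurable x₀) {G : Ω → ℝ}
    (hG : Measurable G) (hG0 : ∀ ω, 0 ≤ G ω) (hGfin : ∫⁻ ω, ENNReal.ofReal (G ω) ∂P ≠ ⊤)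
    (h : Tendsto (fun N => ∫⁻ ω, ENNReal.ofReal |F N ω - x₀ ω| ∂P) atTop (𝓝 0)) (a : ℝ) :
    Tendsto (fun N => ∫⁻ ω, ENNReal.ofReal (min (Ψ (a * (F N ω - x₀ ω))) (G ω)) ∂P) atTop
      (𝓝 0) := by
  refine tendsto_of_subseq_tendsto fun ns hns => ?_
  obtain ⟨ms, -, hms⟩ := exists_subseq_ae_of_L1 (fun N => hF (ns N)) hx₀ (h.comp hns)
  refine ⟨ms, ?_⟩
  have h0 : ∫⁻ _ : Ω, (0 : ℝ≥0∞) ∂P = 0 := lintegral_zero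
  rw [← h0]
  refine tendsto_lintegral_of_dominated_convergence (fun ω => ENNReal.ofReal (G ω))
    (fun N => ((hΨ.measurable.comp (((hF _).sub hx₀).const_mul a)).min hG).ennreal_ofReal)
    (fun N => ae_of_all _ fun ω => ENNReal.ofReal_le_ofReal (min_le_right _ _)) hGfin ?_
  filter_upwards [hms] with ω hω
  have h1 : Tendsto (fun i => Ψ (a * (F (ns (ms i)) ω - x₀ ω))) atTop (𝓝 (Ψ 0)) := by
    refine (hΨ.continuous.tendsto _).comp ?_
    simpa using (hω.sub_const (x₀ ω)).const_mul a
  have h2 := (h1.min (tendsto_const_nhds (x := G ω)))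
  rw [hΨ.map_zero, min_eq_left (hG0 ω)] at h2
  simpa using ENNReal.tendsto_ofReal h2

/-- Along a splitting sequence, `L¹` convergence of the averages implies modular convergence. -/
theorem Splits.tendsto_modular {P : Measure Ω} [IsProbabilityMeasure P] {Φ : ℝ → ℝ}
    (hΦ : IsYoung Φ) (hΔ : Delta2 Φ) {y : ℕ → Ω → ℝ} {A : ℕ → Set Ω}
    (hS : Splits P (conj Φ) y A) (hy : ∀ i, Measurable (y i))
    (hb : ∀ i, ∫⁻ ω, ENNReal.ofReal (conj Φ (y i ω)) ∂P ≤ 1) {x₀ : Ω → ℝ} (hx₀ : Measurable x₀)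
    (hx₀b : ∫⁻ ω, ENNReal.ofReal (conj Φ (x₀ ω)) ∂P ≤ 1)
    (hL : Tendsto (fun N => ∫⁻ ω, ENNReal.ofReal |cesaro y N ω - x₀ ω| ∂P) atTop (𝓝 0)) :
    Tendsto (fun N => ∫⁻ ω, ENNReal.ofReal (conj Φ (1 / 4 * (cesaro y N ω - x₀ ω))) ∂P) atTop
      (𝓝 0) := by
  have hΨ := hΦ.conj_isYoung
  set Ψ := conj Φ with hΨdef
  set B : ℕ → Set Ω := fun i => ⋃ m > i, A m with hB
  have hBm : ∀ i, MeasurableSet (B i) := fun i =>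
    MeasurableSet.iUnion fun m => MeasurableSet.iUnion fun _ => hS.measurableSet m
  set u : ℕ → Ω → ℝ := fun i => (A i)ᶜ.indicator (y i) with hu
  set f : ℕ → Ω → ℝ := fun i => (A i ∩ B i).indicator (y i) with hf
  set g : ℕ → Ω → ℝ := fun i => (A i \ B i).indicator (y i) with hg
  have hfm : ∀ i, Measurable (f i) := fun i => (hy i).indicator ((hS.measurableSet i).inter (hBm i))
  have hsplit : ∀ i ω, y i ω = u i ω + f i ω + g i ω := fun i ω => by
    by_cases h1 : ω ∈ A i <;> by_cases h2 : ω ∈ B i <;> simp [hu, hf, hg, h1, h2]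
  have hces : ∀ N ω, cesaro y N ω = cesaro u N ω + cesaro f N ω + cesaro g N ω := fun N ω => by
    simp only [cesaro, hsplit, Finset.sum_add_distrib, add_div]
  have hmeas : ∀ N, Measurable (cesaro y N) := measurable_cesaro hy
  rw [ENNReal.tendsto_nhds_zero]
  intro δ hδ
  obtain ⟨r, hr0, hrδ⟩ := ENNReal.lt_iff_exists_nnreal_btwn.1 hδ
  have hr : (0 : ℝ) < r := by exact_mod_cast hr0
  set ε : ℝ := r / 4 with hε
  have hε0 : 0 < ε := by positivity
  obtain ⟨K, hK0, hK⟩ := hS.unif (ENNReal.ofReal ε) (by simpa using hε0)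
  obtain ⟨X, N₀, hXN⟩ := hΔ.exists_conj_div_le hΦ hε0
  obtain ⟨i₀, hi₀⟩ := eventually_atTop.1 (hS.large X)
  set v : ℕ → Ω → ℝ := fun i => ((A i)ᶜ ∩ {ω | K < Ψ (y i ω)}).indicator (fun ω => Ψ (y i ω)) with hv
  have hVm : ∀ i, MeasurableSet ((A i)ᶜ ∩ {ω | K < Ψ (y i ω)}) := fun i =>
    (hS.measurableSet i).compl.inter
      (measurableSet_lt measurable_const (hΨ.measurable.comp (hy i)))
  have hvm : ∀ i, Measurable (v i) := fun i => (hΨ.measurable.comp (hy i)).indicator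
    (hVm i)
  have hv0 : ∀ i ω, 0 ≤ v i ω := fun i => indicator_nonneg fun ω _ => hΨ.nonneg _
  have hvint : ∀ i, ∫⁻ ω, ENNReal.ofReal (v i ω) ∂P ≤ ENNReal.ofReal ε := fun i => by
    refine le_trans (le_of_eq ?_) (hK i)
    rw [← lintegral_indicator (hVm i)]
    refine lintegral_congr fun ω => ?_
    simp only [hv, indicator]
    split_ifs <;> simp
  have hub : ∀ i ω, Ψ (u i ω) ≤ K + v i ω := fun i ω => by
    by_cases h1 : ω ∈ A i
    · simp [hu, h1, hΨ.map_zero, hv, hK0]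
    · by_cases h2 : K < Ψ (y i ω)
      · simp [hu, hv, h1, h2, hK0]
      · simp [hu, hv, h1, h2, not_lt.1 h2]
  have hfint : ∀ i, ∫⁻ ω, ENNReal.ofReal (Ψ (f i ω)) ∂P ≤ (1 / 2) ^ i := fun i => by
    refine le_trans ?_ (hS.overlap i)
    rw [← lintegral_indicator (hBm i)]
    refine lintegral_mono fun ω => ?_
    by_cases h1 : ω ∈ B i
    · rw [indicator_of_mem h1]
      by_cases h2 : ω ∈ A i <;> simp [hf, h1, h2, hΨ.map_zero]
    · simp [hf, h1, hΨ.map_zero]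
  have hgdisj : ∀ ω i j, i < j → g i ω ≠ 0 → g j ω = 0 := by
    intro ω i j hij hne
    have h1 : ω ∈ A i \ B i := mem_of_indicator_ne_zero hne
    refine indicator_of_notMem (fun h2 => h1.2 ?_) _
    exact mem_iUnion₂.2 ⟨j, hij, h2.1⟩
  have hgb : ∀ (N : ℕ), N₀ ≤ (N : ℝ) + 1 → ∀ i ω, Ψ (g i ω / ((N : ℝ) + 1)) ≤
      (ε + if i < i₀ then 1 else 0) / ((N : ℝ) + 1) * Ψ (y i ω) := by
    intro N hN i ω
    have hpos : (0 : ℝ) < (N : ℝ) + 1 := by positivity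
    have hnn := hΨ.nonneg (y i ω)
    by_cases h1 : ω ∈ A i \ B i
    · simp only [hg, indicator_of_mem h1]
      split_ifs with h2
      · have h3 := hΨ.map_mul_le (t := ((N : ℝ) + 1)⁻¹) (x := y i ω) (by positivity)
          (inv_le_one_of_one_le₀ (by linarith [Nat.cast_nonneg (α := ℝ) N]))
        rw [div_eq_inv_mul]
        refine h3.trans ?_
        rw [div_eq_inv_mul]
        gcongr
        refine le_mul_of_one_le_right (by positivity) (by linarith)
      · rw [add_zero]
        exact hXN _ _ (hi₀ i (not_lt.1 h2) ω h1.1) hN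
    · simp only [hg, indicator_of_notMem h1, zero_div, hΨ.map_zero]
      split_ifs <;> positivity
  have hmin := tendsto_lintegral_min_of_L1 (P := P) hΨ hmeas hx₀ (G := fun ω => K + Ψ (x₀ ω))
    (measurable_const.add (hΨ.measurable.comp hx₀)) (fun ω => add_nonneg hK0 (hΨ.nonneg _)) (by
      refine ne_top_of_le_ne_top (b := ENNReal.ofReal K + 1) (by finiteness) ?_
      calc ∫⁻ ω, ENNReal.ofReal (K + Ψ (x₀ ω)) ∂P
          ≤ ∫⁻ ω, (ENNReal.ofReal K + ENNReal.ofReal (Ψ (x₀ ω))) ∂P :=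
            lintegral_mono fun ω => ENNReal.ofReal_add_le
        _ = ENNReal.ofReal K + ∫⁻ ω, ENNReal.ofReal (Ψ (x₀ ω)) ∂P := by
            rw [lintegral_add_left measurable_const]; simp
        _ ≤ _ := by gcongr) hL (1 / 4)
  have hsmall : ∀ᶠ N : ℕ in atTop, ((2 : ℝ) + i₀) * (1 / ((N : ℝ) + 1)) < ε := by
    have h1 := (tendsto_one_div_add_atTop_nhds_zero_nat (𝕜 := ℝ)).const_mul ((2 : ℝ) + i₀)
    rw [mul_zero] at h1
    exact h1.eventually_lt_const hε0
  have hlargeN : ∀ᶠ N : ℕ in atTop, N₀ ≤ (N : ℝ) + 1 :=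
    (tendsto_natCast_atTop_atTop.atTop_add tendsto_const_nhds).eventually_ge_atTop N₀
  filter_upwards [ENNReal.tendsto_nhds_zero.1 hmin (ENNReal.ofReal ε) (by simpa using hε0),
    hsmall, hlargeN] with N hN1 hN2 hN3
  set a : ℝ := ((N : ℝ) + 1)⁻¹ with ha
  have ha0 : 0 ≤ a := by positivity
  have hpt : ∀ ω, Ψ (1 / 4 * (cesaro y N ω - x₀ ω)) ≤
      min (Ψ (1 / 4 * (cesaro y N ω - x₀ ω))) (K + Ψ (x₀ ω)) +
        a * ∑ i ∈ Finset.range (N + 1), v i ω + a * ∑ i ∈ Finset.range (N + 1), Ψ (f i ω) +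
        a * ∑ i ∈ Finset.range (N + 1), (ε + if i < i₀ then 1 else 0) * Ψ (y i ω) := by
    intro ω
    have h1 := hΨ.map_quarter_le (cesaro u N ω) (cesaro f N ω) (cesaro g N ω) (x₀ ω)
    rw [← hces] at h1
    have h2 : Ψ (cesaro u N ω) ≤ K + a * ∑ i ∈ Finset.range (N + 1), v i ω := by
      refine (cesaro_le hΨ u N ω).trans ?_
      calc a * ∑ i ∈ Finset.range (N + 1), Ψ (u i ω)
          ≤ a * ∑ i ∈ Finset.range (N + 1), (K + v i ω) := by
            gcongr with i; exact hub i ω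
        _ = K + a * ∑ i ∈ Finset.range (N + 1), v i ω := by
            rw [Finset.sum_add_distrib, Finset.sum_const, Finset.card_range, nsmul_eq_mul, mul_add,
              ha]
            push_cast
            rw [inv_mul_cancel_left₀ (by positivity)]
    have h3 := cesaro_le hΨ f N ω
    have h4 : Ψ (cesaro g N ω) ≤
        a * ∑ i ∈ Finset.range (N + 1), (ε + if i < i₀ then 1 else 0) * Ψ (y i ω) := by
      refine (hΨ.map_cesaro_disjoint_le (hgdisj ω) N).trans ?_
      rw [Finset.mul_sum]
      refine Finset.sum_le_sum fun i _ => (hgb N hN3 i ω).trans (le_of_eq ?_)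
      rw [ha, div_eq_inv_mul, mul_assoc]
    have h5 : 0 ≤ a * ∑ i ∈ Finset.range (N + 1), v i ω :=
      mul_nonneg ha0 (Finset.sum_nonneg fun i _ => hv0 i ω)
    have h6 : 0 ≤ a * ∑ i ∈ Finset.range (N + 1), Ψ (f i ω) :=
      mul_nonneg ha0 (Finset.sum_nonneg fun i _ => hΨ.nonneg _)
    have h7 := hΨ.nonneg (cesaro g N ω)
    rcases min_choice (Ψ (1 / 4 * (cesaro y N ω - x₀ ω))) (K + Ψ (x₀ ω)) with h | h <;> rw [h] <;>
      linarith
  have hite : ∀ i, (0 : ℝ) ≤ ε + if i < i₀ then 1 else 0 := fun i => by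
    split_ifs <;> linarith
  have hV := lintegral_avg_le hvm hv0 hvint N
  have hF : ∫⁻ ω, ENNReal.ofReal (a * ∑ i ∈ Finset.range (N + 1), Ψ (f i ω)) ∂P ≤
      ENNReal.ofReal (2 * a) := by
    rw [lintegral_mul_sum (f := fun i ω => Ψ (f i ω)) (fun i => hΨ.measurable.comp (hfm i)) (fun _ _ => hΨ.nonneg _) ha0,
      mul_comm 2 a, ENNReal.ofReal_mul ha0]
    gcongr
    refine (Finset.sum_le_sum fun i _ => hfint i).trans ((ENNReal.sum_le_tsum _).trans ?_)
    rw [ENNReal.tsum_geometric]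
    simp
  have hG : ∫⁻ ω, ENNReal.ofReal (a * ∑ i ∈ Finset.range (N + 1),
      (ε + if i < i₀ then 1 else 0) * Ψ (y i ω)) ∂P ≤ ENNReal.ofReal (ε + i₀ * a) := by
    rw [lintegral_mul_sum (f := fun i ω => (ε + if i < i₀ then 1 else 0) * Ψ (y i ω))
      (fun i => (hΨ.measurable.comp (hy i)).const_mul _)
      (fun i _ => mul_nonneg (hite i) (hΨ.nonneg _)) ha0]
    have h1 : ∀ i, ∫⁻ ω, ENNReal.ofReal ((ε + if i < i₀ then 1 else 0) * Ψ (y i ω)) ∂P ≤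
        ENNReal.ofReal (ε + if i < i₀ then 1 else 0) := fun i => by
      simp_rw [ENNReal.ofReal_mul (hite i)]
      rw [lintegral_const_mul' _ _ ENNReal.ofReal_ne_top]
      exact mul_le_of_le_one_right' (hb i)
    have h2 : ∑ i ∈ Finset.range (N + 1), (if i < i₀ then (1 : ℝ) else 0) ≤ i₀ := by
      rw [Finset.sum_boole]
      have : (Finset.range (N + 1)).filter (· < i₀) ⊆ Finset.range i₀ := fun i hi => by
        simpa using (Finset.mem_filter.1 hi).2
      exact_mod_cast (Finset.card_le_card this).trans (by simp)
    calc ENNReal.ofReal a * ∑ i ∈ Finset.range (N + 1), ∫⁻ ω,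
          ENNReal.ofReal ((ε + if i < i₀ then 1 else 0) * Ψ (y i ω)) ∂P
        ≤ ENNReal.ofReal a * ∑ i ∈ Finset.range (N + 1),
            ENNReal.ofReal (ε + if i < i₀ then 1 else 0) := by
          gcongr with i; exact h1 i
      _ = ENNReal.ofReal (a * ∑ i ∈ Finset.range (N + 1), (ε + if i < i₀ then 1 else 0)) := by
          rw [ENNReal.ofReal_mul ha0, ENNReal.ofReal_sum_of_nonneg fun i _ => hite i]
      _ ≤ ENNReal.ofReal (ε + i₀ * a) := by
          refine ENNReal.ofReal_le_ofReal ?_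
          rw [Finset.sum_add_distrib, Finset.sum_const, Finset.card_range, nsmul_eq_mul, mul_add]
          have h3 : a * (((N + 1 : ℕ) : ℝ) * ε) = ε := by
            rw [ha]
            push_cast
            rw [inv_mul_cancel_left₀ (by positivity)]
          rw [h3, mul_comm (i₀ : ℝ)]
          gcongr
  have hmeas1 : Measurable fun ω => ENNReal.ofReal (min (Ψ (1 / 4 * (cesaro y N ω - x₀ ω)))
      (K + Ψ (x₀ ω))) :=
    ((hΨ.measurable.comp (((hmeas N).sub hx₀).const_mul _)).min
      (measurable_const.add (hΨ.measurable.comp hx₀))).ennreal_ofReal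
  have hmeas2 : Measurable fun ω => ENNReal.ofReal (a * ∑ i ∈ Finset.range (N + 1), v i ω) :=
    ((Finset.measurable_fun_sum _ fun i _ => hvm i).const_mul a).ennreal_ofReal
  have hmeas3 : Measurable fun ω => ENNReal.ofReal (a * ∑ i ∈ Finset.range (N + 1), Ψ (f i ω)) :=
    ((Finset.measurable_fun_sum _ fun i _ => hΨ.measurable.comp (hfm i)).const_mul a).ennreal_ofReal
  calc ∫⁻ ω, ENNReal.ofReal (Ψ (1 / 4 * (cesaro y N ω - x₀ ω))) ∂P
      ≤ ∫⁻ ω, (ENNReal.ofReal (min (Ψ (1 / 4 * (cesaro y N ω - x₀ ω))) (K + Ψ (x₀ ω))) +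
        ENNReal.ofReal (a * ∑ i ∈ Finset.range (N + 1), v i ω) +
        ENNReal.ofReal (a * ∑ i ∈ Finset.range (N + 1), Ψ (f i ω)) +
        ENNReal.ofReal (a * ∑ i ∈ Finset.range (N + 1),
          (ε + if i < i₀ then 1 else 0) * Ψ (y i ω))) ∂P := by
        refine lintegral_mono fun ω => (ENNReal.ofReal_le_ofReal (hpt ω)).trans ?_
        refine ENNReal.ofReal_add_le.trans (add_le_add ?_ le_rfl)
        exact ENNReal.ofReal_add_le.trans (add_le_add ENNReal.ofReal_add_le le_rfl)
    _ ≤ ENNReal.ofReal ε + ENNReal.ofReal ε + ENNReal.ofReal (2 * a) +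
        ENNReal.ofReal (ε + i₀ * a) := by
        rw [lintegral_add_left ((hmeas1.fun_add hmeas2).fun_add hmeas3),
          lintegral_add_left (hmeas1.fun_add hmeas2), lintegral_add_left hmeas1]
        gcongr
    _ ≤ ENNReal.ofReal r := by
        rw [← ENNReal.ofReal_add hε0.le hε0.le, ← ENNReal.ofReal_add (by positivity) (by positivity),
          ← ENNReal.ofReal_add (by positivity) (by positivity)]
        refine ENNReal.ofReal_le_ofReal ?_
        rw [one_div, ← ha] at hN2
        linarith
    _ ≤ δ := by
        rw [ENNReal.ofReal_coe_nnreal]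
        exact hrδ.le

end OrliczPaper

namespace OrliczPaper

/-! ### A Schur-type lemma on compact sets -/

theorem tendsto_tsum_tail {f : ℕ → ℝ} (hf : Summable fun i => |f i|) :
    Tendsto (fun n => ∑' i, if n ≤ i then |f i| else 0) atTop (𝓝 0) := by
  have h := tendsto_tsum_of_dominated_convergence (𝓕 := atTop)
    (f := fun (n : ℕ) i => if n ≤ i then |f i| else 0) (g := fun _ => (0 : ℝ)) hf
    (fun i => tendsto_const_nhds.congr' (by
      filter_upwards [eventually_gt_atTop i] with n hn
      rw [if_neg (not_le.2 hn)]))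
    (Eventually.of_forall fun n i => by
      split_ifs <;> simp)
  simpa using h

theorem eq_of_mapClusterPt_of_tendsto {S T : Type*} [TopologicalSpace S] [TopologicalSpace T]
    [T2Space T] {F : S → T} (hF : Continuous F) {u : ℕ → S} {p : S} (hp : MapClusterPt p atTop u)
    {a : T} (h : Tendsto (fun n => F (u n)) atTop (𝓝 a)) : F p = a := by
  have h1 : MapClusterPt (F p) atTop (F ∘ u) := hp.continuousAt_comp hF.continuousAt
  have h2 : ClusterPt (F p) (𝓝 a) := ClusterPt.mono h1 h
  exact eq_of_nhds_neBot h2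

/-- If the series `∑ s i * x i` converge to continuous functions for all bounded `s`, then `x`
tends to zero uniformly on compact sets. -/
theorem exists_abs_lt_of_continuous_tsum {S : Type*} [TopologicalSpace S] {A : Set S}
    (hA : IsCompact A) {x : ℕ → S → ℝ} (hsum : ∀ p, Summable fun i => |x i p|)
    (hcont : ∀ s : ℕ → ℝ, (∀ i, |s i| ≤ 1) → Continuous fun p => ∑' i, s i * x i p)
    {ε : ℝ} (hε : 0 < ε) {η : ℕ → S} (hη : ∀ n, η n ∈ A) : ∃ n, |x n (η n)| < ε := by
  by_contra! hbig
  have hxc : ∀ l, Continuous (x l) := fun l => by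
    have h := hcont (fun i => if i = l then 1 else 0) (fun i => by split_ifs <;> simp)
    refine h.congr fun p => ?_
    rw [tsum_eq_single l (fun i hi => by simp [hi])]
    simp
  have hbd : ∀ l, ∃ C, ∀ p ∈ A, |x l p| ≤ C := fun l => by
    obtain ⟨C, hC⟩ := hA.exists_bound_of_continuousOn (hxc l).continuousOn
    exact ⟨C, hC⟩
  choose C hC using hbd
  obtain ⟨a, -, φ, hφ, hlim⟩ := (isCompact_univ_pi fun l : ℕ => isCompact_Icc
    (a := -(C l)) (b := C l)).tendsto_subseq
    (x := fun n l => x l (η n)) (fun n l _ => abs_le.1 (hC l _ (hη n)))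
  rw [tendsto_pi_nhds] at hlim
  have hcluster : ∀ u : ℕ → ℕ, ∃ p, MapClusterPt p atTop (fun n => η (u n)) := fun u => by
    obtain ⟨p, -, hp⟩ := hA (f := map (fun n => η (u n)) atTop)
      (tendsto_principal.2 (Eventually.of_forall fun n => hη _))
    exact ⟨p, hp⟩
  obtain ⟨p₁, hp₁⟩ := hcluster φ
  have ha₁ : ∀ l, x l p₁ = a l := fun l => eq_of_mapClusterPt_of_tendsto (hxc l) hp₁ (hlim l)
  have hasum : Summable fun i => |a i| := by
    simpa only [ha₁] using hsum p₁
  have hchain : ∀ i, ∀ᶠ j in atTop,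
      |x (φ i) (η (φ j)) - a (φ i)| ≤ ε / 16 * (1 / 2) ^ (φ i) ∧
        ∑' l, (if φ j ≤ l then |x l (η (φ i))| else 0) ≤ ε / 8 := fun i => by
    refine Eventually.and ?_ ?_
    · filter_upwards [Metric.tendsto_nhds.1 (hlim (φ i)) (ε / 16 * (1 / 2) ^ (φ i))
        (by positivity)] with j hj
      exact hj.le
    · exact (((tendsto_tsum_tail (hsum (η (φ i)))).comp hφ.tendsto_atTop).eventually_lt_const
        (by positivity : (0 : ℝ) < ε / 8)).mono fun j hj => hj.le
  obtain ⟨ψ, hψ, hψ'⟩ := exists_strictMono_chain hchain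
  set m : ℕ → ℕ := fun k => φ (ψ k) with hm
  have hmono : StrictMono m := hφ.comp hψ
  classical
  set s : ℕ → ℝ := fun i => if i ∈ range m then (SignType.sign (x i (η i)) : ℝ) else 0 with hs
  have hs1 : ∀ i, |s i| ≤ 1 := fun i => by
    simp only [hs]
    split_ifs
    · rcases SignType.sign (x i (η i)) <;> simp
    · simp
  obtain ⟨p₂, hp₂⟩ := hcluster m
  have ha₂ : ∀ l, x l p₂ = a l := fun l => eq_of_mapClusterPt_of_tendsto (hxc l) hp₂
    ((hlim l).comp hψ.tendsto_atTop)
  have hbsum : ∀ p, Summable fun i => s i * x i p := fun p => by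
    refine Summable.of_norm_bounded (hsum p) fun i => ?_
    rw [norm_mul]
    exact mul_le_of_le_one_left (abs_nonneg _) (hs1 i)
  have hev : ∀ᶠ k in atTop, (∑' i, s i * x i p₂) + ε / 2 ≤ ∑' i, s i * x i (η (m k)) := by
    filter_upwards [((tendsto_tsum_tail hasum).comp hmono.tendsto_atTop).eventually_lt_const
      (by positivity : (0 : ℝ) < ε / 8)] with k hk
    have hk' : ∑' i, (if m k ≤ i then |a i| else 0) < ε / 8 := hk
    set D : ℕ → ℝ := fun i => s i * (x i (η (m k)) - a i) with hD
    have hDsum : Summable D := by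
      have := (hbsum (η (m k))).sub (hbsum p₂)
      refine this.congr fun i => ?_
      rw [ha₂, ← mul_sub]
    have hdiff : (∑' i, s i * x i (η (m k))) - ∑' i, s i * x i p₂ = ∑' i, D i := by
      rw [← (hbsum (η (m k))).tsum_sub (hbsum p₂)]
      refine tsum_congr fun i => ?_
      rw [ha₂, ← mul_sub]
    have hite : ∀ (f : ℕ → ℝ) (n : ℕ), (Summable fun i => |f i|) →
        Summable fun i => if n ≤ i then |f i| else 0 := fun f n hf =>
      Summable.of_nonneg_of_le (fun i => by split_ifs <;> simp)
        (fun i => by split_ifs <;> simp) hf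
    have hgeo : HasSum (fun i : ℕ => ε / 16 * (1 / 2 : ℝ) ^ i) (ε / 8) := by
      have := hasSum_geometric_two.mul_left (ε / 16)
      rwa [show ε / 16 * 2 = ε / 8 by ring] at this
    have hr := (hgeo.add (hite _ (m (k + 1)) (hsum (η (m k)))).hasSum).add
      (hite a (m k) hasum).hasSum
    have hrest : ‖∑' i, if i = m k then 0 else D i‖ ≤ _ := tsum_of_norm_bounded hr fun i => by
      have hg0 : (0 : ℝ) ≤ ε / 16 * (1 / 2) ^ i := by positivity
      have h1 : (0 : ℝ) ≤ if m (k + 1) ≤ i then |x i (η (m k))| else 0 := by split_ifs <;> simp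
      have h2 : (0 : ℝ) ≤ if m k ≤ i then |a i| else 0 := by split_ifs <;> simp
      by_cases hik : i = m k
      · rw [if_pos hik, norm_zero]
        positivity
      rw [if_neg hik]
      by_cases hir : i ∈ range m
      · obtain ⟨l, rfl⟩ := hir
        have hDle : ‖D (m l)‖ ≤ |x (m l) (η (m k)) - a (m l)| := by
          rw [hD, norm_mul]
          exact mul_le_of_le_one_left (abs_nonneg _) (hs1 _)
        rcases lt_trichotomy l k with h | h | h
        · have := (hψ' l k h).1
          simp only [hm] at *
          linarith
        · exact absurd (by rw [h]) hik
        · have h3 : m (k + 1) ≤ m l := hmono.monotone h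
          have h4 : m k ≤ m l := hmono.monotone h.le
          rw [if_pos h3, if_pos h4]
          have := abs_sub (x (m l) (η (m k))) (a (m l))
          linarith
      · have hsi : s i = 0 := if_neg hir
        have : D i = 0 := by simp only [hD, hsi, zero_mul]
        rw [this, norm_zero]
        positivity
    have htail := (hψ' k (k + 1) (Nat.lt_succ_self k)).2
    have hmain : ε - |a (m k)| ≤ D (m k) := by
      have h1 : s (m k) = SignType.sign (x (m k) (η (m k))) := if_pos ⟨k, rfl⟩
      have h2 : D (m k) = |x (m k) (η (m k))| - s (m k) * a (m k) := by
        simp only [hD]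
        rw [mul_sub, h1, sign_mul_self]
      have h3 : |s (m k) * a (m k)| ≤ |a (m k)| := by
        rw [abs_mul]
        exact mul_le_of_le_one_left (abs_nonneg _) (hs1 _)
      have h4 := le_abs_self (s (m k) * a (m k))
      have h5 := hbig (m k)
      linarith
    have hak : |a (m k)| ≤ ∑' i, (if m k ≤ i then |a i| else 0) := by
      have := (hite a (m k) hasum).le_tsum (m k) (fun i _ => by split_ifs <;> simp)
      simpa using this
    have heq := hDsum.tsum_eq_add_tsum_ite (m k)
    have h6 := (abs_le.1 hrest).1
    simp only [hm] at *
    linarith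
  have hb := hcont s hs1
  have hb₂ : MapClusterPt (∑' i, s i * x i p₂) atTop
      ((fun p => ∑' i, s i * x i p) ∘ fun n => η (m n)) := hp₂.continuousAt_comp hb.continuousAt
  have hfreq := hb₂.frequently (Iio_mem_nhds (show (∑' i, s i * x i p₂) <
    (∑' i, s i * x i p₂) + ε / 2 by linarith))
  obtain ⟨k, hk1, hk2⟩ := (hfreq.and_eventually hev).exists
  exact absurd hk2 (not_le.2 hk1)

end OrliczPaper

namespace OrliczPaper

variable {Ω : Type*} [MeasurableSpace Ω]

/-! ### Uniform smallness on weakly compact sets -/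

theorem MemOrlicz.integrable_mul {P : Measure Ω} {Φ : ℝ → ℝ} (hΦ : IsYoung Φ) {f g : Ω → ℝ}
    (hf : MemOrlicz P Φ f) (hg : MemOrlicz P (conj Φ) g) :
    Integrable (fun ω => f ω * g ω) P := by
  obtain ⟨hfm, l, hl, hfl⟩ := hf
  obtain ⟨hgm, r, hr, hgr⟩ := hg
  have hΨ := hΦ.conj_isYoung
  have h1 : Integrable (fun ω => (l * f ω) * (r * g ω)) P := by
    refine ⟨((hfm.const_mul l).mul (hgm.const_mul r)).aestronglyMeasurable, ?_⟩
    rw [hasFiniteIntegral_iff_norm]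
    calc ∫⁻ ω, ENNReal.ofReal ‖(l * f ω) * (r * g ω)‖ ∂P
        ≤ ∫⁻ ω, (ENNReal.ofReal (Φ (l * f ω)) + ENNReal.ofReal (conj Φ (r * g ω))) ∂P := by
          refine lintegral_mono fun ω => ?_
          rw [← ENNReal.ofReal_add (hΦ.nonneg _) (hΨ.nonneg _)]
          exact ENNReal.ofReal_le_ofReal (hΦ.abs_mul_le _ _)
      _ = _ := lintegral_add_left (hΦ.measurable.comp (hfm.const_mul l)).ennreal_ofReal _
      _ < ⊤ := ENNReal.add_lt_top.2 ⟨hfl, hgr⟩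
  refine (h1.const_mul (l⁻¹ * r⁻¹)).congr (ae_of_all _ fun ω => ?_)
  field_simp

theorem MemOrlicz.of_abs_le {P : Measure Ω} {Ψ : ℝ → ℝ} (hΨ : IsYoung Ψ) {f g : Ω → ℝ}
    (hf : MemOrlicz P Ψ f) (hg : Measurable g) (h : ∀ ω, |g ω| ≤ |f ω|) : MemOrlicz P Ψ g := by
  obtain ⟨-, l, hl, hfl⟩ := hf
  refine ⟨hg, l, hl, (lintegral_mono fun ω => ENNReal.ofReal_le_ofReal (hΨ.mono ?_)).trans_lt hfl⟩
  rw [abs_mul, abs_mul]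
  exact mul_le_mul_of_nonneg_left (h ω) (abs_nonneg l)

theorem summable_abs_of_le_geometric {p : ℕ → ℝ} {k : ℕ} (h : ∀ i ≠ k, |p i| ≤ (1 / 2) ^ i) :
    Summable (fun i => |p i|) ∧ ∑' i, |p i| ≤ 2 + |p k| := by
  have hle : ∀ i, |p i| ≤ (1 / 2) ^ i + (if i = k then |p k| else 0) := by
    intro i
    split_ifs with hik
    · rw [hik]
      have : (0 : ℝ) ≤ (1 / 2) ^ k := by positivity
      linarith
    · simpa using h i hik
  have hs := hasSum_geometric_two.add (hasSum_ite_eq k |p k|)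
  have h1 := Summable.of_nonneg_of_le (fun i => abs_nonneg (p i)) hle hs.summable
  exact ⟨h1, (h1.tsum_le_tsum hle hs.summable).trans_eq hs.tsum_eq⟩

theorem measurable_tsum_real {p : ℕ → Ω → ℝ} (hp : ∀ i, Measurable (p i))
    (hs : ∀ ω, Summable fun i => p i ω) : Measurable fun ω => ∑' i, p i ω :=
  measurable_of_tendsto_metrizable (fun n => Finset.measurable_sum (Finset.range n) fun i _ => hp i)
    (tendsto_pi_nhds.2 fun ω => by simpa using (hs ω).hasSum.tendsto_sum_nat)

theorem memOrlicz_tsum_abs {P : Measure Ω} [IsProbabilityMeasure P] {Ψ : ℝ → ℝ} (hΨ : IsYoung Ψ)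
    {p : ℕ → Ω → ℝ} (hp : ∀ i, Measurable (p i))
    (hgeom : ∀ ω, ∃ k, ∀ i ≠ k, |p i ω| ≤ (1 / 2) ^ i) {c : ℝ} (hc : 0 < c)
    (hsum : ∑' i, ∫⁻ ω, ENNReal.ofReal (Ψ (c * p i ω)) ∂P ≠ ⊤) :
    MemOrlicz P Ψ fun ω => ∑' i, |p i ω| := by
  have hms : ∀ ω, Summable fun i => |p i ω| := fun ω => by
    obtain ⟨k, hk⟩ := hgeom ω
    exact (summable_abs_of_le_geometric hk).1
  refine ⟨measurable_tsum_real (fun i => (hp i).abs) hms, c / 2, by positivity, ?_⟩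
  calc ∫⁻ ω, ENNReal.ofReal (Ψ (c / 2 * ∑' i, |p i ω|)) ∂P
      ≤ ∫⁻ ω, (ENNReal.ofReal (Ψ (2 * c)) + ∑' i, ENNReal.ofReal (Ψ (c * p i ω))) ∂P := by
        refine lintegral_mono fun ω => ?_
        obtain ⟨k, hk⟩ := hgeom ω
        refine le_trans ?_ (add_le_add_right (ENNReal.le_tsum k) _)
        rw [← ENNReal.ofReal_add (hΨ.nonneg _) (hΨ.nonneg _)]
        refine ENNReal.ofReal_le_ofReal ?_
        have h1 := (summable_abs_of_le_geometric hk).2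
        have h0 : 0 ≤ ∑' i, |p i ω| := tsum_nonneg fun i => abs_nonneg _
        have h2 : Ψ (c / 2 * ∑' i, |p i ω|) ≤ Ψ ((1 / 2) * (2 * c) + (1 / 2) * (c * |p k ω|)) := by
          refine hΨ.mono ?_
          rw [abs_of_nonneg (by positivity), abs_of_nonneg (by positivity)]
          nlinarith
        have h3 := hΨ.convexOn.2 (mem_univ (2 * c)) (mem_univ (c * |p k ω|))
          (by norm_num : (0 : ℝ) ≤ 1 / 2) (by norm_num : (0 : ℝ) ≤ 1 / 2) (by norm_num)
        have h4 : Ψ (c * |p k ω|) = Ψ (c * p k ω) := by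
          rw [← hΨ.map_abs (c * p k ω), abs_mul, abs_of_pos hc]
        have h5 := hΨ.nonneg (2 * c)
        have h6 := hΨ.nonneg (c * p k ω)
        simp only [smul_eq_mul] at h3
        linarith
    _ = ENNReal.ofReal (Ψ (2 * c)) + ∑' i, ∫⁻ ω, ENNReal.ofReal (Ψ (c * p i ω)) ∂P := by
        have hm : ∀ i, AEMeasurable (fun ω => ENNReal.ofReal (Ψ (c * p i ω))) P := fun i =>
          (hΨ.measurable.comp ((hp i).const_mul c)).ennreal_ofReal.aemeasurable
        rw [lintegral_add_left measurable_const, lintegral_tsum hm]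
        simp
    _ < ⊤ := ENNReal.add_lt_top.2 ⟨ENNReal.ofReal_lt_top, hsum.lt_top⟩

theorem exists_abs_pairing_lt_of_geometric {P : Measure Ω} [IsProbabilityMeasure P] {Φ : ℝ → ℝ}
    (hΦ : IsYoung Φ) {p : ℕ → Ω → ℝ} (hp : ∀ i, Measurable (p i))
    (hgeom : ∀ ω, ∃ k, ∀ i ≠ k, |p i ω| ≤ (1 / 2) ^ i) {c : ℝ} (hc : 0 < c)
    (hsum : ∑' i, ∫⁻ ω, ENNReal.ofReal (conj Φ (c * p i ω)) ∂P ≠ ⊤)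
    {A : Set (Orlicz P Φ)} (hA : @IsCompact _ (weakT P (Orlicz P Φ) (Orlicz P (conj Φ))) A)
    {η : ℕ → Orlicz P Φ} (hη : ∀ i, η i ∈ A) {ε : ℝ} (hε : 0 < ε) :
    ∃ i, |pairing P (η i) (p i)| < ε := by
  have hΨ := hΦ.conj_isYoung
  have hG := memOrlicz_tsum_abs hΨ hp hgeom hc hsum
  have hms : ∀ ω, Summable fun i => |p i ω| := fun ω => by
    obtain ⟨k, hk⟩ := hgeom ω
    exact (summable_abs_of_le_geometric hk).1
  have hle : ∀ s : ℕ → ℝ, (∀ i, |s i| ≤ 1) → ∀ ω i, ‖s i * p i ω‖ ≤ |p i ω| := fun s hs ω i => by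
    rw [norm_mul]
    exact mul_le_of_le_one_left (abs_nonneg _) (hs i)
  have hss : ∀ s : ℕ → ℝ, (∀ i, |s i| ≤ 1) → ∀ ω, Summable fun i => s i * p i ω :=
    fun s hs ω => (hms ω).of_norm_bounded (hle s hs ω)
  have hmem : ∀ s : ℕ → ℝ, (∀ i, |s i| ≤ 1) →
      (fun ω => ∑' i, s i * p i ω) ∈ Orlicz P (conj Φ) := fun s hs => by
    refine MemOrlicz.of_abs_le hΨ hG
      (measurable_tsum_real (fun i => (hp i).const_mul (s i)) (hss s hs)) fun ω => ?_
    exact (tsum_of_norm_bounded (hms ω).hasSum (hle s hs ω)).trans (le_abs_self _)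
  have hhas : ∀ s : ℕ → ℝ, (∀ i, |s i| ≤ 1) → ∀ θ : Orlicz P Φ,
      HasSum (fun i => s i * pairing P θ (p i)) (pairing P θ fun ω => ∑' i, s i * p i ω) := by
    intro s hs θ
    have hint : Integrable (fun ω => abs ((θ : Ω → ℝ) ω * ∑' i, |p i ω|)) P :=
      (θ.2.integrable_mul hΦ hG).abs
    have := hasSum_integral_of_dominated_convergence (μ := P)
      (F := fun i ω => s i * ((θ : Ω → ℝ) ω * p i ω))
      (f := fun ω => (θ : Ω → ℝ) ω * ∑' i, s i * p i ω)
      (fun i ω => |(θ : Ω → ℝ) ω| * |p i ω|)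
      (fun i => ((θ.2.1.mul (hp i)).const_mul (s i)).aestronglyMeasurable)
      (fun i => ae_of_all _ fun ω => by
        rw [norm_mul, norm_mul]
        exact mul_le_of_le_one_left (by positivity) (hs i))
      (ae_of_all _ fun ω => (hms ω).mul_left _)
      (hint.congr (ae_of_all _ fun ω => by
        simp only
        rw [tsum_mul_left, abs_mul, abs_of_nonneg (tsum_nonneg fun i => abs_nonneg (p i ω))]))
      (ae_of_all _ fun ω => by
        have := (hss s hs ω).hasSum.mul_left ((θ : Ω → ℝ) ω)
        refine this.congr_fun fun i => ?_
        ring)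
    simpa only [pairing, integral_const_mul] using this
  let _ : TopologicalSpace (Orlicz P Φ) := weakT P (Orlicz P Φ) (Orlicz P (conj Φ))
  refine exists_abs_lt_of_continuous_tsum (S := Orlicz P Φ) hA
    (x := fun i θ => pairing P θ (p i)) (fun θ => ?_) (fun s hs => ?_) hε hη
  · have := (hhas (fun i => SignType.sign (pairing P θ (p i))) (fun i => ?_) θ).summable
    · simpa only [sign_mul_self] using this
    · rcases lt_trichotomy (pairing P θ (p i)) 0 with h | h | h <;> simp [h]
  · have h1 : (fun θ : Orlicz P Φ => ∑' i, s i * pairing P θ (p i)) =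
        (fun u : Orlicz P (conj Φ) → ℝ => u ⟨_, hmem s hs⟩) ∘
          (fun θ : Orlicz P Φ => fun b : Orlicz P (conj Φ) => pairing P (θ : Ω → ℝ) (b : Ω → ℝ)) :=
      funext fun θ => (hhas s hs θ).tsum_eq
    rw [h1]
    exact (continuous_apply _).comp continuous_induced_dom

theorem exists_abs_pairing_lt {P : Measure Ω} [IsProbabilityMeasure P] {Φ : ℝ → ℝ}
    (hΦ : IsYoung Φ) {z : ℕ → Ω → ℝ} (hz : ∀ i, Measurable (z i))
    (hgeom : ∀ᵐ ω ∂P, ∀ᶠ i in atTop, |z i ω| ≤ (1 / 2) ^ i) {c : ℝ} (hc : 0 < c)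
    (hsum : ∑' i, ∫⁻ ω, ENNReal.ofReal (conj Φ (c * z i ω)) ∂P ≠ ⊤)
    {A : Set (Orlicz P Φ)} (hA : @IsCompact _ (weakT P (Orlicz P Φ) (Orlicz P (conj Φ))) A)
    {η : ℕ → Orlicz P Φ} (hη : ∀ i, η i ∈ A) {ε : ℝ} (hε : 0 < ε) :
    ∃ i, |pairing P (η i) (z i)| < ε := by
  have hΨ := hΦ.conj_isYoung
  have hmem : ∀ i, MemOrlicz P (conj Φ) (z i) := fun i =>
    ⟨hz i, c, hc, (ENNReal.le_tsum i).trans_lt hsum.lt_top⟩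
  have hint : ∀ i, Integrable (fun ω => (η i : Ω → ℝ) ω * z i ω) P := fun i =>
    (η i).2.integrable_mul hΦ (hmem i)
  set B : ℕ → Set Ω := fun j => ⋃ m ≥ j, {ω | (1 / 2) ^ m < |z m ω|} with hB
  have hBm : ∀ j, MeasurableSet (B j) := fun j =>
    MeasurableSet.iUnion fun m => MeasurableSet.iUnion fun _ =>
      measurableSet_lt measurable_const (hz m).abs
  have hBanti : Antitone B := fun i j hij =>
    iUnion_mono fun m => iUnion_mono' fun hm => ⟨hij.trans hm, subset_rfl⟩
  have hBnull : P (⋂ j, B j) = 0 := by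
    refine measure_mono_null (fun ω hω => ?_) hgeom
    intro hev
    obtain ⟨j, hj⟩ := eventually_atTop.1 hev
    obtain ⟨m, hm, h⟩ := mem_iUnion₂.1 (mem_iInter.1 hω j)
    exact absurd (hj m hm) (not_le.2 h)
  obtain ⟨φ, hφ, hR⟩ := exists_strictMono_chain
    (R := fun i j => ∫ ω in B j, |(η i : Ω → ℝ) ω * z i ω| ∂P < ε / 2) (fun i => by
      have h := tendsto_setIntegral_of_antitone hBm hBanti
        ⟨0, ((hint i).abs).integrableOn (s := B 0)⟩
      rw [setIntegral_measure_zero _ hBnull] at h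
      exact h.eventually (gt_mem_nhds (half_pos hε)))
  set p : ℕ → Ω → ℝ := fun i => (B (φ (i + 1)))ᶜ.indicator (z (φ i)) with hp
  have hple : ∀ i ω, |p i ω| ≤ |z (φ i) ω| := fun i ω => by
    simp only [hp, indicator]
    split_ifs <;> simp
  have hpgeom : ∀ ω, ∃ k, ∀ i ≠ k, |p i ω| ≤ (1 / 2) ^ i := by
    intro ω
    by_cases hex : ∃ k, ω ∉ B (φ (k + 1))
    · classical
      refine ⟨Nat.find hex, fun i hi => ?_⟩
      rcases lt_or_gt_of_ne hi with h | h
      · have h1 : ω ∈ B (φ (i + 1)) := not_not.1 (Nat.find_min hex h)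
        have h2 : p i ω = 0 := indicator_of_notMem (notMem_compl_iff.2 h1) _
        rw [h2, abs_zero]
        positivity
      · have h1 := Nat.find_spec hex
        have h2 : |z (φ i) ω| ≤ (1 / 2) ^ φ i := by
          by_contra hcon
          exact h1 (mem_iUnion₂.2 ⟨φ i, hφ.monotone h, not_le.1 hcon⟩)
        exact (hple i ω).trans (h2.trans
          (pow_le_pow_of_le_one (by norm_num) (by norm_num) (hφ.id_le i)))
    · push Not at hex
      refine ⟨0, fun i _ => ?_⟩
      have h2 : p i ω = 0 := indicator_of_notMem (notMem_compl_iff.2 (hex i)) _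
      rw [h2, abs_zero]
      positivity
  have hpsum : ∑' i, ∫⁻ ω, ENNReal.ofReal (conj Φ (c * p i ω)) ∂P ≠ ⊤ := by
    refine ne_top_of_le_ne_top hsum (le_trans (ENNReal.tsum_le_tsum fun i => ?_)
      (ENNReal.tsum_comp_le_tsum_of_injective hφ.injective
        fun i => ∫⁻ ω, ENNReal.ofReal (conj Φ (c * z i ω)) ∂P))
    refine lintegral_mono fun ω => ENNReal.ofReal_le_ofReal (hΨ.mono ?_)
    rw [abs_mul, abs_mul]
    exact mul_le_mul_of_nonneg_left (hple i ω) (abs_nonneg c)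
  obtain ⟨i, hi⟩ := exists_abs_pairing_lt_of_geometric hΦ
    (fun i => (hz (φ i)).indicator (hBm (φ (i + 1))).compl) hpgeom hc hpsum hA
    (η := fun i => η (φ i)) (fun i => hη _) (half_pos hε)
  refine ⟨φ i, ?_⟩
  have hRi := hR i (i + 1) (Nat.lt_succ_self i)
  have hsplit : pairing P (η (φ i)) (z (φ i)) = pairing P (η (φ i)) (p i) +
      ∫ ω in B (φ (i + 1)), (η (φ i) : Ω → ℝ) ω * z (φ i) ω ∂P := by
    have h1 : pairing P (η (φ i)) (p i) =
        ∫ ω in (B (φ (i + 1)))ᶜ, (η (φ i) : Ω → ℝ) ω * z (φ i) ω ∂P := by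
      rw [← integral_indicator (hBm _).compl]
      refine integral_congr_ae (ae_of_all _ fun ω => ?_)
      simp only [hp, indicator]
      split_ifs <;> simp
    rw [h1, add_comm, integral_add_compl (hBm _) (hint _)]
    rfl
  have h2 := abs_integral_le_integral_abs (μ := P.restrict (B (φ (i + 1))))
    (f := fun ω => (η (φ i) : Ω → ℝ) ω * z (φ i) ω)
  rw [hsplit]
  refine (abs_add_le _ _).trans_lt ?_
  linarith

end OrliczPaper

namespace OrliczPaper

variable {Ω : Type*} [MeasurableSpace Ω]

/-! ### Mackey convergence -/

theorem tendsto_mackeyT {P : Measure Ω} [IsProbabilityMeasure P] {Φ : ℝ → ℝ} (hΦ : IsYoung Φ)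
    {f : ℕ → Orlicz P (conj Φ)} {g : Orlicz P (conj Φ)} {c : ℝ} (hc : 0 < c)
    (h1 : Tendsto (fun N => ∫⁻ ω, ENNReal.ofReal |(f N : Ω → ℝ) ω - (g : Ω → ℝ) ω| ∂P) atTop (𝓝 0))
    (h2 : Tendsto (fun N => ∫⁻ ω,
      ENNReal.ofReal (conj Φ (c * ((f N : Ω → ℝ) ω - (g : Ω → ℝ) ω))) ∂P) atTop (𝓝 0)) :
    Tendsto f atTop (@nhds _ (mackeyT P (Orlicz P (conj Φ)) (Orlicz P Φ)) g) := by
  rw [mackeyT, nhds_induced, tendsto_comap_iff, UniformOnFun.tendsto_iff_tendstoUniformlyOn]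
  intro A hA
  rw [Metric.tendstoUniformlyOn_iff]
  intro ε hε
  by_contra hcon
  have hfreq : ∃ᶠ N in atTop, ∃ η ∈ A, ε ≤ |pairing P (g : Ω → ℝ) (η : Orlicz P Φ) -
      pairing P (f N : Ω → ℝ) (η : Orlicz P Φ)| := by
    refine (not_eventually.1 hcon).mono fun N hN => ?_
    push Not at hN
    exact hN
  have hgeo : ∑' m : ℕ, (2⁻¹ : ℝ≥0∞) ^ m ≠ ⊤ := by simp
  obtain ⟨φ, -, hφ⟩ := extraction_forall_of_frequently (fun m : ℕ =>
    hfreq.and_eventually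
      ((h1.eventually_le_const (u := ENNReal.ofReal ((1 / 2) ^ m) * 2⁻¹ ^ m)
        (ENNReal.mul_pos (by simp) (by simp))).and
      (h2.eventually_le_const (u := (2⁻¹ : ℝ≥0∞) ^ m) (ENNReal.pow_pos (by simp) m))))
  choose hη hL hM using hφ
  choose η hηA hηε using hη
  set z : ℕ → Ω → ℝ := fun m ω => (f (φ m) : Ω → ℝ) ω - (g : Ω → ℝ) ω with hz
  have hzm : ∀ m, Measurable (z m) := fun m => (f (φ m)).2.1.sub g.2.1
  have hmeas : ∀ m, P {ω | (1 / 2) ^ m < |z m ω|} ≤ 2⁻¹ ^ m := fun m => by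
    have h : P {ω | ENNReal.ofReal ((1 / 2) ^ m) ≤ ENNReal.ofReal |z m ω|} ≤
        (∫⁻ ω, ENNReal.ofReal |z m ω| ∂P) / ENNReal.ofReal ((1 / 2) ^ m) :=
      meas_ge_le_lintegral_div (hzm m).abs.ennreal_ofReal.aemeasurable (by simp) (by simp)
    refine (measure_mono fun ω hω => ?_).trans (h.trans (ENNReal.div_le_of_le_mul' (hL m)))
    exact ENNReal.ofReal_le_ofReal (le_of_lt hω)
  have hae : ∀ᵐ ω ∂P, ∀ᶠ m in atTop, |z m ω| ≤ (1 / 2) ^ m := by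
    filter_upwards [ae_eventually_notMem
      (ne_top_of_le_ne_top hgeo (ENNReal.tsum_le_tsum hmeas))] with ω hω
    exact hω.mono fun m hm => not_lt.1 hm
  obtain ⟨m, hm⟩ := exists_abs_pairing_lt hΦ hzm hae hc
    (ne_top_of_le_ne_top hgeo (ENNReal.tsum_le_tsum hM)) hA.2.2 hηA hε
  have heq : pairing P (η m : Ω → ℝ) (z m) = pairing P (f (φ m) : Ω → ℝ) (η m : Ω → ℝ) -
      pairing P (g : Ω → ℝ) (η m : Ω → ℝ) := by
    have e1 := (η m).2.integrable_mul hΦ (f (φ m)).2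
    have e2 := (η m).2.integrable_mul hΦ g.2
    simp only [pairing, hz, mul_sub]
    rw [integral_sub e1 e2]
    simp only [mul_comm]
  rw [heq, abs_sub_comm] at hm
  exact absurd hm (not_lt.2 (hηε m))

theorem lintegral_div_le_one_of_luxNorm_lt {P : Measure Ω} {Ψ : ℝ → ℝ} (hΨ : IsYoung Ψ)
    {f : Ω → ℝ} (hf : MemOrlicz P Ψ f) {M : ℝ} (hM : luxNorm P Ψ f < M) :
    ∫⁻ ω, ENNReal.ofReal (Ψ (f ω / M)) ∂P ≤ 1 := by
  have hne : {l : ℝ | 0 < l ∧ ∫⁻ ω, ENNReal.ofReal (Ψ (f ω / l)) ∂P ≤ 1}.Nonempty := by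
    obtain ⟨hfm, l, hl, hfl⟩ := hf
    set I := ∫⁻ ω, ENNReal.ofReal (Ψ (l * f ω)) ∂P with hI
    set t : ℝ := 1 / (I.toReal + 1) with ht
    have hI0 : 0 ≤ I.toReal := ENNReal.toReal_nonneg
    have ht0 : 0 < t := by positivity
    have ht1 : t ≤ 1 := by
      rw [ht, div_le_one (by positivity)]
      linarith
    refine ⟨(t * l)⁻¹, by positivity, ?_⟩
    calc ∫⁻ ω, ENNReal.ofReal (Ψ (f ω / (t * l)⁻¹)) ∂P
        ≤ ∫⁻ ω, ENNReal.ofReal t * ENNReal.ofReal (Ψ (l * f ω)) ∂P := by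
          refine lintegral_mono fun ω => ?_
          rw [← ENNReal.ofReal_mul ht0.le]
          refine ENNReal.ofReal_le_ofReal ?_
          have : f ω / (t * l)⁻¹ = t * (l * f ω) := by
            rw [div_inv_eq_mul]
            ring
          rw [this]
          exact hΨ.map_mul_le ht0.le ht1 _
      _ = ENNReal.ofReal (t * I.toReal) := by
          rw [lintegral_const_mul' _ _ ENNReal.ofReal_ne_top,
            ENNReal.ofReal_mul ht0.le, ENNReal.ofReal_toReal hfl.ne]
      _ ≤ 1 := by
          rw [ENNReal.ofReal_le_one, ht, one_div_mul_eq_div, div_le_one (by positivity)]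
          linarith
  obtain ⟨l, ⟨hl, hfl⟩, hlM⟩ := exists_lt_of_csInf_lt hne hM
  refine (lintegral_mono fun ω => ENNReal.ofReal_le_ofReal (hΨ.mono ?_)).trans hfl
  rw [abs_div, abs_div, abs_of_pos hl, abs_of_pos (hl.trans hlM)]
  exact div_le_div_of_nonneg_left (abs_nonneg _) hl hlM.le

theorem cesaro_div {Ω : Type*} (ξ : ℕ → Ω → ℝ) (M : ℝ) (N : ℕ) (ω : Ω) :
    cesaro (fun i ω => ξ i ω / M) N ω = cesaro ξ N ω / M := by
  simp only [cesaro]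
  rw [← Finset.sum_div, div_right_comm]

end OrliczPaper

namespace OrliczPaper

/-- If `Φ ∈ Δ₂`, every norm-bounded sequence in `L_{Φ*}` has
a subsequence and a `ξ ∈ L_{Φ*}` such that the Cesàro means of every further
subsequence converge to `ξ` in the Mackey topology `τ(L_{Φ*},L_Φ)`. -/
theorem statement11
    {Ω : Type*} [MeasurableSpace Ω] (P : Measure Ω) [IsProbabilityMeasure P]
    (Φ : ℝ → ℝ) (hΦ : IsYoung Φ) (hΔ : Delta2 Φ)
    (ξ : ℕ → Ω → ℝ) (hmem : ∀ n, MemOrlicz P (conj Φ) (ξ n))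
    (hbdd : ∃ M : ℝ, ∀ n, luxNorm P (conj Φ) (ξ n) ≤ M) :
    ∃ n : ℕ → ℕ, StrictMono n ∧
      ∃ ξ₀ : Ω → ℝ, ∃ h₀ : ξ₀ ∈ Orlicz P (conj Φ),
        ∀ k : ℕ → ℕ, StrictMono k →
          ∃ hc : ∀ N, cesaro (fun i => ξ (n (k i))) N ∈ Orlicz P (conj Φ),
            Tendsto
              (fun N => (⟨cesaro (fun i => ξ (n (k i))) N, hc N⟩ : Orlicz P (conj Φ)))
              atTop
              (@nhds _ (mackeyT P (Orlicz P (conj Φ)) (Orlicz P Φ)) ⟨ξ₀, h₀⟩) := by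

  obtain ⟨M₀, hM₀⟩ := hbdd
  have hΨ := hΦ.conj_isYoung
  set M : ℝ := max (M₀ + 1) 1 with hM
  have hMpos : 0 < M := lt_of_lt_of_le one_pos (le_max_right _ _)
  set x : ℕ → Ω → ℝ := fun n ω => ξ n ω / M with hx
  have hxm : ∀ n, Measurable (x n) := fun n => (hmem n).1.div_const M
  have hxb : ∀ n, ∫⁻ ω, ENNReal.ofReal (conj Φ (x n ω)) ∂P ≤ 1 := fun n =>
    lintegral_div_le_one_of_luxNorm_lt hΨ (hmem n)
      (lt_of_lt_of_le (lt_of_le_of_lt (hM₀ n) (lt_add_one M₀)) (le_max_left _ _))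
  obtain ⟨n₁, hn₁, x₀, hx₀, hL⟩ := exists_subseq_cesaro_L1 hΨ hxm hxb
  obtain ⟨n₂, hn₂, A, hS⟩ := exists_subseq_splits hΨ (fun i => hxm (n₁ i)) (fun i => hxb (n₁ i))
  have hx₀b : ∫⁻ ω, ENNReal.ofReal (conj Φ (x₀ ω)) ∂P ≤ 1 :=
    lintegral_le_of_L1 hΨ (measurable_cesaro fun i => hxm (n₁ i)) hx₀
      (lintegral_cesaro_le hΨ (fun i => hxm (n₁ i)) fun i => hxb (n₁ i)) (hL id strictMono_id)
  refine ⟨fun i => n₁ (n₂ i), hn₁.comp hn₂, fun ω => M * x₀ ω,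
    ⟨hx₀.const_mul M, M⁻¹, inv_pos.2 hMpos, ?_⟩, fun k hk => ⟨fun N => ?_, ?_⟩⟩
  · simp only [inv_mul_cancel_left₀ hMpos.ne']
    exact hx₀b.trans_lt ENNReal.one_lt_top
  · refine ⟨measurable_cesaro (fun i => (hmem _).1) N, M⁻¹, inv_pos.2 hMpos, ?_⟩
    simp only [inv_mul_eq_div, ← cesaro_div]
    exact (lintegral_cesaro_le hΨ (fun i => hxm (n₁ (n₂ (k i))))
      (fun i => hxb _) N).trans_lt ENNReal.one_lt_top
  · have hLk := hL (fun i => n₂ (k i)) (hn₂.comp hk)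
    have hmod := Splits.tendsto_modular hΦ hΔ (hS.comp hk) (fun i => hxm _) (fun i => hxb _)
      hx₀ hx₀b hLk
    have hdiff : ∀ N ω, cesaro (fun i => ξ (n₁ (n₂ (k i)))) N ω - M * x₀ ω =
        M * (cesaro (fun i => x (n₁ (n₂ (k i)))) N ω - x₀ ω) := fun N ω => by
      simp only [hx]
      rw [cesaro_div (fun i => ξ (n₁ (n₂ (k i)))), mul_sub, mul_div_cancel₀ _ hMpos.ne']
    refine tendsto_mackeyT hΦ (c := 1 / 4 * M⁻¹) (by positivity) ?_ ?_
    · simp only [hdiff, abs_mul, abs_of_pos hMpos, ENNReal.ofReal_mul hMpos.le,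
        lintegral_const_mul' _ _ ENNReal.ofReal_ne_top]
      simpa using ENNReal.Tendsto.const_mul hLk (Or.inr ENNReal.ofReal_ne_top)
    · simp only [hdiff, mul_assoc, inv_mul_cancel_left₀ hMpos.ne']
      exact hmod

end OrliczPaper
end
end

section
/- Let Φ be a Young function satisfying the Δ2-condition. Every sequence (ξ_n) in L_{Φ*} with sup_n ‖ξ_n‖_{Φ*} < ∞ admits a sequence of forward convex combinations ξ̄_n ∈ conv(ξ_k : k ≥ n) and a ξ ∈ L_{Φ*} such that ξ̄_n → ξ in order, i.e. sup_n |ξ̄_n| ∈ L_{Φ*} and ξ̄_n → ξ a.s. -/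
open MeasureTheory Filter Topology Set
open scoped ENNReal

noncomputable section

namespace OrliczPaper

/-- The midpoint convexity deficit of the power function `x ↦ |x| ^ p`. -/
def powDeficit (p x y : ℝ) : ℝ := (|x| ^ p + |y| ^ p) / 2 - |(x + y) / 2| ^ p

lemma powDeficit_pos {p : ℝ} (hp : 1 < p) {x y : ℝ} (hxy : x ≠ y) : 0 < powDeficit p x y := by
  unfold powDeficit
  have htri : |(x + y) / 2| ≤ (|x| + |y|) / 2 := by
    rw [abs_div, abs_two]
    linarith [abs_add_le x y]
  by_cases h : |x| = |y|
  · obtain h' | h' := abs_eq_abs.1 h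
    · exact absurd h' hxy
    · have hy : 0 < |y| := by
        rw [abs_pos]
        rintro rfl
        exact hxy (by simpa using h')
      have := Real.rpow_pos_of_pos hy p
      rw [h, h']
      simp [Real.zero_rpow (by linarith : p ≠ 0)]
      linarith
  · have h1 := (strictConvexOn_rpow hp).2 (abs_nonneg x) (abs_nonneg y) h
      (by norm_num : (0 : ℝ) < 1 / 2) (by norm_num : (0 : ℝ) < 1 / 2) (by norm_num)
    simp only [smul_eq_mul] at h1
    have h2 : |(x + y) / 2| ^ p ≤ (1 / 2 * |x| + 1 / 2 * |y|) ^ p :=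
      Real.rpow_le_rpow (abs_nonneg _) (by linarith) (by linarith)
    linarith

lemma powDeficit_nonneg {p : ℝ} (hp : 1 < p) (x y : ℝ) : 0 ≤ powDeficit p x y := by
  by_cases h : x = y
  · subst h
    unfold powDeficit
    rw [show (x + x) / 2 = x by ring]
    linarith
  · exact (powDeficit_pos hp h).le

lemma continuous_abs_rpow {p : ℝ} (hp : 1 < p) : Continuous fun x : ℝ => |x| ^ p :=
  continuous_abs.rpow_const fun _ => Or.inr (by linarith)

lemma abs_mul_rpow (p : ℝ) {t : ℝ} (ht : 0 ≤ t) (x : ℝ) : |t * x| ^ p = t ^ p * |x| ^ p := by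
  rw [abs_mul, abs_of_nonneg ht, Real.mul_rpow ht (abs_nonneg x)]

/-- Quantitative uniform convexity of `x ↦ |x| ^ p`. -/
lemma abs_sub_rpow_le {p : ℝ} (hp : 1 < p) {δ : ℝ} (hδ : 0 < δ) :
    ∃ c : ℝ, 0 ≤ c ∧ ∀ x y : ℝ,
      |x - y| ^ p ≤ δ * (|x| ^ p + |y| ^ p) + c * powDeficit p x y := by
  have hc := continuous_abs_rpow hp
  have hF : Continuous fun z : ℝ × ℝ => |z.1 - z.2| ^ p :=
    hc.comp (continuous_fst.sub continuous_snd)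
  have hS : Continuous fun z : ℝ × ℝ => |z.1| ^ p + |z.2| ^ p :=
    (hc.comp continuous_fst).add (hc.comp continuous_snd)
  have hD : Continuous fun z : ℝ × ℝ => powDeficit p z.1 z.2 :=
    (hS.div_const 2).sub (hc.comp ((continuous_fst.add continuous_snd).div_const 2))
  set K : Set (ℝ × ℝ) := Metric.sphere 0 1 ∩
    {z | δ * (|z.1| ^ p + |z.2| ^ p) ≤ |z.1 - z.2| ^ p} with hK
  have hKc : IsCompact K :=
    (isCompact_sphere 0 1).inter_right (isClosed_le (continuous_const.mul hS) hF)
  obtain ⟨c, hc0, hcK⟩ : ∃ c : ℝ, 0 ≤ c ∧ ∀ z ∈ Metric.sphere (0 : ℝ × ℝ) 1,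
      |z.1 - z.2| ^ p ≤ δ * (|z.1| ^ p + |z.2| ^ p) + c * powDeficit p z.1 z.2 := by
    have hnn : ∀ z : ℝ × ℝ, 0 ≤ δ * (|z.1| ^ p + |z.2| ^ p) := fun z => by positivity
    have hpos : ∀ z ∈ K, 0 < powDeficit p z.1 z.2 := by
      rintro ⟨x, y⟩ ⟨h1, h2⟩
      refine powDeficit_pos hp fun hxy => ?_
      simp only at hxy
      subst hxy
      simp only [mem_ofPred_eq, sub_self, abs_zero, Real.zero_rpow (by linarith : p ≠ 0)] at h2
      have hx : x = 0 := by
        by_contra hx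
        have := Real.rpow_pos_of_pos (abs_pos.2 hx) p
        have : 0 < δ * (|x| ^ p + |x| ^ p) := by positivity
        linarith
      subst hx
      simp at h1
    have hq : ContinuousOn (fun z : ℝ × ℝ => |z.1 - z.2| ^ p / powDeficit p z.1 z.2) K :=
      hF.continuousOn.div hD.continuousOn fun z hz => (hpos z hz).ne'
    obtain ⟨c, hcb⟩ := (hKc.image_of_continuousOn hq).bddAbove
    refine ⟨max c 0, le_max_right _ _, fun z hz => ?_⟩
    have hDn := powDeficit_nonneg hp z.1 z.2
    by_cases h : δ * (|z.1| ^ p + |z.2| ^ p) ≤ |z.1 - z.2| ^ p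
    · have hzK : z ∈ K := ⟨hz, h⟩
      have h1 := hcb (mem_image_of_mem _ hzK)
      rw [div_le_iff₀ (hpos z hzK)] at h1
      have h2 := mul_le_mul_of_nonneg_right (le_max_left c 0) hDn
      linarith [hnn z]
    · have := mul_nonneg (le_max_right c 0) hDn
      linarith
  refine ⟨c, hc0, fun x y => ?_⟩
  by_cases hz : ((x, y) : ℝ × ℝ) = 0
  · obtain ⟨rfl, rfl⟩ := Prod.mk_eq_zero.1 hz
    simp [powDeficit, Real.zero_rpow (by linarith : p ≠ 0)]
  · set t := ‖((x, y) : ℝ × ℝ)‖ with ht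
    have htpos : 0 < t := norm_pos_iff.2 hz
    have hw := hcK (t⁻¹ • ((x, y) : ℝ × ℝ)) (by
      rw [mem_sphere_zero_iff_norm, norm_smul, norm_inv, norm_norm, inv_mul_cancel₀ htpos.ne'])
    have hti : 0 ≤ t⁻¹ := by positivity
    simp only [powDeficit, Prod.smul_mk, smul_eq_mul] at hw ⊢
    rw [← mul_sub, ← mul_add, mul_div_assoc, abs_mul_rpow p hti, abs_mul_rpow p hti,
      abs_mul_rpow p hti, abs_mul_rpow p hti] at hw
    have htp : 0 < t⁻¹ ^ p := Real.rpow_pos_of_pos (by positivity) p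
    refine le_of_mul_le_mul_left ?_ htp
    linarith

/-- Almost minimising a nonnegative functional over the forward convex hulls of a sequence
produces forward convex combinations with vanishing midpoint deficit. -/
lemma exists_forward_almost_minimizers {E : Type*} [AddCommGroup E] [Module ℝ E] (N : E → ℝ)
    (hN : ∀ v, 0 ≤ N v) (u : ℕ → E) {M : ℝ} (hM : ∀ n, N (u n) ≤ M) :
    ∃ g : ℕ → E, (∀ n, g n ∈ convexHull ℝ {v | ∃ k ≥ n, v = u k}) ∧ (∀ n, N (g n) ≤ M + 1) ∧
      ∀ ε > 0, ∃ n₀, ∀ n ≥ n₀, ∀ m ≥ n₀,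
        (N (g n) + N (g m)) / 2 - N ((1 / 2 : ℝ) • (g n + g m)) ≤ ε := by
  set C : ℕ → Set E := fun n => convexHull ℝ {v | ∃ k ≥ n, v = u k} with hC
  have huC : ∀ n, u n ∈ C n := fun n => subset_convexHull ℝ _ ⟨n, le_rfl, rfl⟩
  have hCanti : ∀ m n, m ≤ n → C n ⊆ C m := fun m n hmn =>
    convexHull_mono fun v ⟨k, hk, hv⟩ => ⟨k, hmn.trans hk, hv⟩
  set a : ℕ → ℝ := fun n => sInf (N '' C n) with ha
  have hbb : ∀ n, BddBelow (N '' C n) := fun n => ⟨0, by rintro _ ⟨v, -, rfl⟩; exact hN v⟩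
  have hne : ∀ n, (N '' C n).Nonempty := fun n => ⟨_, mem_image_of_mem _ (huC n)⟩
  have haM : ∀ n, a n ≤ M := fun n =>
    (csInf_le (hbb n) (mem_image_of_mem _ (huC n))).trans (hM n)
  have hamono : Monotone a := fun m n hmn =>
    csInf_le_csInf (hbb m) (hne n) (image_mono (hCanti m n hmn))
  have habdd : BddAbove (range a) := ⟨M, by rintro _ ⟨n, rfl⟩; exact haM n⟩
  have hlim := tendsto_atTop_ciSup hamono habdd
  have hex : ∀ n : ℕ, ∃ v ∈ C n, N v < a n + 1 / ((n : ℝ) + 1) := fun n => by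
    obtain ⟨_, ⟨v, hv, rfl⟩, h⟩ := exists_lt_of_csInf_lt (hne n)
      (show sInf (N '' C n) < a n + 1 / ((n : ℝ) + 1) from
        lt_add_of_pos_right _ Nat.one_div_pos_of_nat)
    exact ⟨v, hv, h⟩
  choose g hgC hgN using hex
  refine ⟨g, hgC, fun n => ?_, fun ε hε => ?_⟩
  · have : 1 / ((n : ℝ) + 1) ≤ 1 := by
      rw [div_le_one (by positivity)]
      linarith [(Nat.cast_nonneg n : (0 : ℝ) ≤ n)]
    linarith [haM n, hgN n]
  · have h0 : Tendsto (fun n : ℕ => (⨆ i, a i) + 1 / ((n : ℝ) + 1) - a n) atTop (𝓝 0) := by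
      simpa using ((tendsto_const_nhds (x := ⨆ i, a i)).add
        tendsto_one_div_add_atTop_nhds_zero_nat).sub hlim
    obtain ⟨n₀, hn₀⟩ := (h0.eventually (gt_mem_nhds hε)).exists
    have key : ∀ n ≥ n₀, N (g n) ≤ (⨆ i, a i) + 1 / ((n₀ : ℝ) + 1) := fun n hn => by
      have h1 := le_ciSup habdd n
      have h2 := Nat.one_div_le_one_div (α := ℝ) hn
      linarith [hgN n]
    refine ⟨n₀, fun n hn m hm => ?_⟩
    have hmid : (1 / 2 : ℝ) • (g n + g m) ∈ C n₀ := by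
      rw [smul_add]
      exact convex_convexHull ℝ _ (hCanti _ _ hn (hgC n)) (hCanti _ _ hm (hgC m))
        (by norm_num) (by norm_num) (by norm_num)
    have h3 : a n₀ ≤ N ((1 / 2 : ℝ) • (g n + g m)) := csInf_le (hbb n₀) (mem_image_of_mem _ hmid)
    linarith [key n hn, key m hm]

namespace IsYoung

variable {Φ : ℝ → ℝ}

lemma nonneg_s12 (h : IsYoung Φ) (x : ℝ) : 0 ≤ Φ x := by
  have := h.convexOn.2 (mem_univ x) (mem_univ (-x)) (by norm_num : (0 : ℝ) ≤ 1 / 2)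
    (by norm_num : (0 : ℝ) ≤ 1 / 2) (by norm_num)
  simp only [smul_eq_mul, h.even] at this
  rw [show 1 / 2 * x + 1 / 2 * -x = 0 by ring, h.map_zero] at this
  linarith

lemma abs_eq (h : IsYoung Φ) (x : ℝ) : Φ |x| = Φ x := by
  obtain hx | hx := abs_choice x <;> rw [hx]
  exact h.even x

lemma bddAbove_conj_s12 (h : IsYoung Φ) (y : ℝ) : BddAbove (range fun x : ℝ => x * y - Φ x) := by
  obtain ⟨R, hR⟩ := (h.coercive.eventually_ge_atTop |y|).exists_forall_of_atTop
  refine ⟨max R 0 * |y|, ?_⟩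
  rintro _ ⟨x, rfl⟩
  have hxy : x * y ≤ |x| * |y| := (le_abs_self _).trans (abs_mul x y).le
  have hy := abs_nonneg y
  obtain hx | hx := le_or_gt |x| (max R 0)
  · have := mul_le_mul_of_nonneg_right hx hy
    simp only
    linarith [h.nonneg_s12 x]
  · have h1 := hR |x| ((le_max_left R 0).trans hx.le)
    rw [le_div_iff₀ ((le_max_right R 0).trans_lt hx), h.abs_eq] at h1
    have : 0 ≤ max R 0 * |y| := mul_nonneg (le_max_right _ _) hy
    simp only
    linarith

lemma le_conj (h : IsYoung Φ) (x y : ℝ) : x * y - Φ x ≤ conj Φ y :=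
  le_ciSup (h.bddAbove_conj_s12 y) x

lemma abs_mul_abs_sub_le_conj (h : IsYoung Φ) (x y : ℝ) : |x| * |y| - Φ x ≤ conj Φ y := by
  rw [← h.abs_eq x]
  obtain hy | hy := abs_choice y
  · rw [hy]
    exact h.le_conj _ _
  · rw [hy, ← h.even |x|, mul_neg, ← neg_mul]
    exact h.le_conj _ _

lemma conj_nonneg (h : IsYoung Φ) (y : ℝ) : 0 ≤ conj Φ y := by
  simpa [h.map_zero] using h.le_conj 0 y

lemma conj_mono (h : IsYoung Φ) {y z : ℝ} (hyz : |y| ≤ |z|) : conj Φ y ≤ conj Φ z := by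
  refine ciSup_le fun x => (le_trans ?_ (h.abs_mul_abs_sub_le_conj x z))
  have h1 : x * y ≤ |x| * |y| := (le_abs_self _).trans (abs_mul x y).le
  have h2 := mul_le_mul_of_nonneg_left hyz (abs_nonneg x)
  linarith

lemma abs_le_conj (h : IsYoung Φ) (y : ℝ) : |y| ≤ Φ 1 + conj Φ y := by
  have := h.abs_mul_abs_sub_le_conj 1 y
  rw [abs_one, one_mul] at this
  linarith

lemma conj_mul_le (h : IsYoung Φ) {t : ℝ} (ht0 : 0 ≤ t) (ht1 : t ≤ 1) (y : ℝ) :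
    conj Φ (t * y) ≤ t * conj Φ y := by
  refine ciSup_le fun x => ?_
  have h1 := mul_le_mul_of_nonneg_left (h.le_conj x y) ht0
  have h2 := mul_le_mul_of_nonneg_right ht1 (h.nonneg_s12 x)
  linarith

/-- The Δ₂-condition on `Φ` dualises to superlinear growth of the conjugate function. -/
lemma exists_conj_growth (h : IsYoung Φ) (hΔ : Delta2 Φ) :
    ∃ K s₀ : ℝ, 2 ≤ K ∧ 0 < s₀ ∧ 0 < conj Φ s₀ ∧
      ∀ y ≥ s₀, 2 * K * conj Φ y ≤ conj Φ (K * y) := by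
  obtain ⟨C, x₀, hC⟩ := hΔ
  set x₁ := max x₀ 1 with hx₁
  have hx₁1 : 1 ≤ x₁ := le_max_right _ _
  set K := max (C / 2) 2 with hK
  have hK2 : 2 ≤ K := le_max_right _ _
  have hCK : C ≤ 2 * K := by linarith [le_max_left (C / 2) 2]
  set s₀ := max (Φ (2 * x₁) / x₁) (Φ 1 + 1) with hs
  have hs1 : Φ 1 + 1 ≤ s₀ := le_max_right _ _
  have hs0 : 0 < s₀ := by linarith [h.nonneg_s12 1]
  refine ⟨K, s₀, hK2, hs0, ?_, fun y hy => ?_⟩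
  · have := h.abs_le_conj s₀
    rw [abs_of_pos hs0] at this
    linarith
  · have hypos : 0 < y := hs0.trans_le hy
    have big : ∀ x ≥ x₁, 2 * K * (x * y - Φ x) ≤ conj Φ (K * y) := fun x hx => by
      have h1 := h.le_conj (2 * x) (K * y)
      have h2 := hC x ((le_max_left _ _).trans hx)
      have h3 := mul_le_mul_of_nonneg_right hCK (h.nonneg_s12 x)
      linarith
    rw [← le_div_iff₀' (by positivity : 0 < 2 * K)]
    refine ciSup_le fun x => ?_
    rw [le_div_iff₀' (by positivity : 0 < 2 * K)]
    obtain hx | hx := le_or_gt x₁ x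
    · exact big x hx
    · refine le_trans ?_ (big (2 * x₁) (by linarith))
      refine mul_le_mul_of_nonneg_left ?_ (by positivity)
      have h1 : Φ (2 * x₁) ≤ y * x₁ := by
        rw [← div_le_iff₀ (by linarith)]
        exact (le_max_left _ _).trans hy
      have h2 := mul_le_mul_of_nonneg_right hx.le hypos.le
      linarith [h.nonneg_s12 x]

/-- The `p`-th root of the conjugate of a Δ₂ Young function is almost
`s ↦ s * (increasing function)`. -/
lemma exists_conj_rpow_growth (h : IsYoung Φ) (hΔ : Delta2 Φ) :
    ∃ p K s₀ : ℝ, 1 < p ∧ 0 < K ∧ 0 < s₀ ∧ 0 < conj Φ s₀ ∧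
      ∀ s y, s₀ ≤ s → s ≤ y → conj Φ s ^ p⁻¹ * y ≤ K * conj Φ y ^ p⁻¹ * s := by
  obtain ⟨K, s₀, hK2, hs0, hpos, hg⟩ := h.exists_conj_growth hΔ
  have hK : 0 < K := by linarith
  have hlogK : 0 < Real.log K := Real.log_pos (by linarith)
  set p := 1 + Real.log 2 / Real.log K with hp
  have hp1 : 1 < p := by
    have := div_pos (Real.log_pos one_lt_two) hlogK
    linarith
  have hKp : K ^ p = 2 * K := by
    rw [hp, Real.rpow_add hK, Real.rpow_one, Real.rpow_def_of_pos hK,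
      mul_div_cancel₀ _ hlogK.ne', Real.exp_log two_pos, mul_comm]
  have hp0 : 0 ≤ p⁻¹ := by positivity
  have hstep : ∀ y ≥ s₀, K * conj Φ y ^ p⁻¹ ≤ conj Φ (K * y) ^ p⁻¹ := fun y hy => by
    have h1 := Real.rpow_le_rpow (by have := h.conj_nonneg y; positivity) (hg y hy) hp0
    rwa [← hKp, Real.mul_rpow (by positivity) (h.conj_nonneg y),
      Real.rpow_rpow_inv hK.le (by linarith)] at h1
  have hiter : ∀ (j : ℕ), ∀ y ≥ s₀, K ^ j * conj Φ y ^ p⁻¹ ≤ conj Φ (K ^ j * y) ^ p⁻¹ := by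
    intro j y hy
    induction j with
    | zero => simp
    | succ j ih =>
      have h1 : s₀ ≤ K ^ j * y := by
        have := one_le_pow₀ (by linarith : 1 ≤ K) (n := j)
        nlinarith
      calc K ^ (j + 1) * conj Φ y ^ p⁻¹ = K * (K ^ j * conj Φ y ^ p⁻¹) := by ring
        _ ≤ K * conj Φ (K ^ j * y) ^ p⁻¹ := mul_le_mul_of_nonneg_left ih hK.le
        _ ≤ conj Φ (K * (K ^ j * y)) ^ p⁻¹ := hstep _ h1
        _ = conj Φ (K ^ (j + 1) * y) ^ p⁻¹ := by rw [← mul_assoc, pow_succ' K j]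
  refine ⟨p, K, s₀, hp1, hK, hs0, hpos, fun s y hs hsy => ?_⟩
  have hspos : 0 < s := hs0.trans_le hs
  obtain ⟨j, hj1, hj2⟩ := exists_nat_pow_near ((one_le_div hspos).2 hsy) (by linarith : 1 < K)
  rw [le_div_iff₀ hspos] at hj1
  rw [div_lt_iff₀ hspos] at hj2
  have hρ : 0 ≤ conj Φ s ^ p⁻¹ := Real.rpow_nonneg (h.conj_nonneg _) _
  have h1 : conj Φ (K ^ j * s) ^ p⁻¹ ≤ conj Φ y ^ p⁻¹ :=
    Real.rpow_le_rpow (h.conj_nonneg _) (h.conj_mono (by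
      rwa [abs_of_pos (by positivity), abs_of_pos (hspos.trans_le hsy)])) hp0
  calc conj Φ s ^ p⁻¹ * y ≤ conj Φ s ^ p⁻¹ * (K ^ (j + 1) * s) :=
        mul_le_mul_of_nonneg_left hj2.le hρ
    _ = K * (K ^ j * conj Φ s ^ p⁻¹) * s := by ring
    _ ≤ K * conj Φ y ^ p⁻¹ * s :=
        mul_le_mul_of_nonneg_right
          (mul_le_mul_of_nonneg_left ((hiter j s hs).trans h1) hK.le) hspos.le

/-- The conjugate of a Δ₂ Young function is equivalent to the `p`-th power of a convex function
for some `p > 1`. -/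
lemma exists_convex_root (h : IsYoung Φ) (hΔ : Delta2 Φ) :
    ∃ (p A : ℝ) (G : ℝ → ℝ), 1 < p ∧ 0 ≤ A ∧ ConvexOn ℝ univ G ∧ (∀ y, 0 ≤ G y) ∧
      (∀ y, G y ^ p ≤ A * conj Φ y) ∧ (∀ y, conj Φ (y / 2) ≤ A + G y ^ p) ∧
      (∀ y, |y| ^ p ≤ A * (1 + conj Φ y)) := by
  obtain ⟨p, K, s₀, hp1, hK, hs0, hpos, hg⟩ := h.exists_conj_rpow_growth hΔ
  have hp0 : 0 < p := by linarith
  have hpi : 0 ≤ p⁻¹ := by positivity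
  have hρ : ∀ y, 0 ≤ conj Φ y ^ p⁻¹ := fun y => Real.rpow_nonneg (h.conj_nonneg _) _
  have hρp : ∀ y, (conj Φ y ^ p⁻¹) ^ p = conj Φ y := fun y =>
    Real.rpow_inv_rpow (h.conj_nonneg y) hp0.ne'
  have habs : ∀ y, conj Φ |y| = conj Φ y := fun y =>
    le_antisymm (h.conj_mono (abs_abs y).le) (h.conj_mono (abs_abs y).ge)
  set T : Ici s₀ → ℝ → ℝ := fun s y => conj Φ s ^ p⁻¹ / s * max (|y| - s) 0 with hT
  have hspos : ∀ s : Ici s₀, 0 < (s : ℝ) := fun s => hs0.trans_le s.2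
  have hβ : ∀ s : Ici s₀, 0 ≤ conj Φ s ^ p⁻¹ / s := fun s => div_nonneg (hρ s) (hspos s).le
  have hTnn : ∀ s y, 0 ≤ T s y := fun s y => mul_nonneg (hβ s) (le_max_right _ _)
  have hTle : ∀ s y, T s y ≤ K * conj Φ y ^ p⁻¹ := fun s y => by
    have hKρ : 0 ≤ K * conj Φ y ^ p⁻¹ := mul_nonneg hK.le (hρ y)
    obtain hys | hys := le_or_gt |y| s
    · simpa [hT, max_eq_right (sub_nonpos.2 hys)] using hKρ
    · have h1 := hg s |y| s.2 hys.le
      rw [habs] at h1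
      have h2 : max (|y| - (s : ℝ)) 0 ≤ |y| := max_le (by linarith [hspos s]) (abs_nonneg y)
      calc T s y ≤ conj Φ s ^ p⁻¹ / s * |y| := mul_le_mul_of_nonneg_left h2 (hβ s)
        _ = conj Φ s ^ p⁻¹ * |y| / s := by ring
        _ ≤ K * conj Φ y ^ p⁻¹ := (div_le_iff₀ (hspos s)).2 h1
  have hbdd : ∀ y, BddAbove (range fun s => T s y) := fun y =>
    ⟨K * conj Φ y ^ p⁻¹, by rintro _ ⟨s, rfl⟩; exact hTle s y⟩
  have : Nonempty (Ici s₀) := ⟨⟨s₀, self_mem_Ici⟩⟩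
  set G : ℝ → ℝ := fun y => ⨆ s, T s y with hG
  have hTG : ∀ s y, T s y ≤ G y := fun s y => le_ciSup (hbdd y) s
  have hGnn : ∀ y, 0 ≤ G y := fun y => (hTnn ⟨s₀, self_mem_Ici⟩ y).trans (hTG _ y)
  have hGle : ∀ y, G y ≤ K * conj Φ y ^ p⁻¹ := fun y => ciSup_le fun s => hTle s y
  have hconv : ConvexOn ℝ univ G := by
    refine ⟨convex_univ, fun x _ y _ a b ha hb hab => ciSup_le fun s => ?_⟩
    have h1 : max (|a • x + b • y| - (s : ℝ)) 0 ≤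
        a * max (|x| - (s : ℝ)) 0 + b * max (|y| - (s : ℝ)) 0 := by
      have hx := mul_le_mul_of_nonneg_left (le_max_left (|x| - (s : ℝ)) 0) ha
      have hy := mul_le_mul_of_nonneg_left (le_max_left (|y| - (s : ℝ)) 0) hb
      have hx0 := mul_nonneg ha (le_max_right (|x| - (s : ℝ)) 0)
      have hy0 := mul_nonneg hb (le_max_right (|y| - (s : ℝ)) 0)
      refine max_le ?_ (by linarith)
      have h2 : |a • x + b • y| ≤ a * |x| + b * |y| := by
        refine (abs_add_le _ _).trans ?_
        rw [smul_eq_mul, smul_eq_mul, abs_mul, abs_mul, abs_of_nonneg ha, abs_of_nonneg hb]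
      have h3 : (s : ℝ) = a * s + b * s := by rw [← add_mul, hab, one_mul]
      linarith
    calc T s (a • x + b • y)
        ≤ conj Φ s ^ p⁻¹ / s * (a * max (|x| - (s : ℝ)) 0 + b * max (|y| - (s : ℝ)) 0) :=
          mul_le_mul_of_nonneg_left h1 (hβ s)
      _ = a * T s x + b * T s y := by simp only [hT]; ring
      _ ≤ a • G x + b • G y :=
          add_le_add (mul_le_mul_of_nonneg_left (hTG s x) ha)
            (mul_le_mul_of_nonneg_left (hTG s y) hb)
  set A := K ^ p + conj Φ s₀ + s₀ ^ p + K ^ p * s₀ ^ p / conj Φ s₀ with hA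
  have hA1 : 0 ≤ K ^ p := by positivity
  have hA2 : 0 ≤ s₀ ^ p := by positivity
  have hA3 : 0 ≤ K ^ p * s₀ ^ p / conj Φ s₀ := by positivity
  have hA0 : 0 ≤ A := by positivity
  refine ⟨p, A, G, hp1, hA0, hconv, hGnn, fun y => ?_, fun y => ?_, fun y => ?_⟩
  · calc G y ^ p ≤ (K * conj Φ y ^ p⁻¹) ^ p := Real.rpow_le_rpow (hGnn y) (hGle y) hp0.le
      _ = K ^ p * conj Φ y := by rw [Real.mul_rpow hK.le (hρ y), hρp]
      _ ≤ A * conj Φ y := mul_le_mul_of_nonneg_right (by linarith) (h.conj_nonneg y)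
  · obtain hy | hy := le_or_gt s₀ (|y| / 2)
    · have hy0 : 0 < |y| / 2 := hs0.trans_le hy
      have h1 := hTG ⟨|y| / 2, hy⟩ y
      have h2 : T ⟨|y| / 2, hy⟩ y = conj Φ (y / 2) ^ p⁻¹ := by
        have h3 : conj Φ (|y| / 2) = conj Φ (y / 2) := by
          rw [← habs (y / 2), abs_div, abs_two]
        simp only [hT, h3]
        rw [show |y| - |y| / 2 = |y| / 2 by ring, max_eq_left hy0.le, div_mul_cancel₀ _ hy0.ne']
      rw [h2] at h1
      have h4 := Real.rpow_le_rpow (hρ _) h1 hp0.le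
      rw [hρp] at h4
      linarith
    · have h1 : conj Φ (y / 2) ≤ conj Φ s₀ := h.conj_mono (by
        rw [abs_div, abs_two, abs_of_pos hs0]
        exact hy.le)
      have h2 : 0 ≤ G y ^ p := Real.rpow_nonneg (hGnn y) _
      linarith
  · have hc := h.conj_nonneg y
    have hAc : 0 ≤ A * conj Φ y := mul_nonneg hA0 hc
    obtain hy | hy := le_or_gt s₀ |y|
    · have h1 := hg s₀ |y| le_rfl hy
      rw [habs] at h1
      have h2 := Real.rpow_le_rpow (mul_nonneg (hρ _) (abs_nonneg y)) h1 hp0.le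
      rw [Real.mul_rpow (hρ _) (abs_nonneg y), hρp, Real.mul_rpow (mul_nonneg hK.le (hρ _)) hs0.le,
        Real.mul_rpow hK.le (hρ _), hρp] at h2
      have h3 : |y| ^ p ≤ K ^ p * s₀ ^ p / conj Φ s₀ * conj Φ y := by
        rw [div_mul_eq_mul_div, le_div_iff₀ hpos]
        linarith
      have h4 := mul_le_mul_of_nonneg_right
        (by linarith : K ^ p * s₀ ^ p / conj Φ s₀ ≤ A) hc
      linarith
    · have h1 := Real.rpow_le_rpow (abs_nonneg y) hy.le hp0.le
      linarith

end IsYoung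

section Lp

variable {Ω : Type*} [MeasurableSpace Ω] {P : Measure Ω} {p : ℝ}

lemma integrable_abs_rpow_iff (hp : 1 < p) {f : Ω → ℝ} (hf : AEStronglyMeasurable f P) :
    Integrable (fun ω => |f ω| ^ p) P ↔ MemLp f (ENNReal.ofReal p) P := by
  have hp0 : 0 < p := by linarith
  have := integrable_norm_rpow_iff (p := ENNReal.ofReal p) hf
    (by simpa using hp0) ENNReal.ofReal_ne_top
  rwa [ENNReal.toReal_ofReal hp0.le] at this

lemma integrable_abs_rpow (hp : 1 < p) {f : Ω → ℝ} (hf : MemLp f (ENNReal.ofReal p) P) :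
    Integrable (fun ω => |f ω| ^ p) P :=
  (integrable_abs_rpow_iff hp hf.1).2 hf

/-- Completeness of `L^p`, in terms of integrals of `p`-th powers. -/
lemma exists_tendsto_integral_abs_sub_rpow (hp : 1 < p) {f : ℕ → Ω → ℝ}
    (hf : ∀ n, MemLp (f n) (ENNReal.ofReal p) P)
    (hcau : ∀ ε > 0, ∃ n₀, ∀ n ≥ n₀, ∀ m ≥ n₀, ∫ ω, |f n ω - f m ω| ^ p ∂P ≤ ε) :
    ∃ f' : Ω → ℝ, Measurable f' ∧ MemLp f' (ENNReal.ofReal p) P ∧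
      Tendsto (fun n => ∫ ω, |f n ω - f' ω| ^ p ∂P) atTop (𝓝 0) := by
  have hp0 : 0 < p := by linarith
  have : Fact (1 ≤ ENNReal.ofReal p) := ⟨by simpa using hp.le⟩
  have hnorm : ∀ {v w : Ω → ℝ} (hv : MemLp v (ENNReal.ofReal p) P)
      (hw : MemLp w (ENNReal.ofReal p) P),
      ‖hv.toLp v - hw.toLp w‖ ^ p = ∫ ω, |v ω - w ω| ^ p ∂P := fun {v w} hv hw => by
    have hI : 0 ≤ ∫ ω, |v ω - w ω| ^ p ∂P := integral_nonneg fun ω => by positivity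
    rw [← MemLp.toLp_sub, Lp.norm_toLp, (hv.sub hw).eLpNorm_eq_integral_rpow_norm
      (by simpa using hp0) ENNReal.ofReal_ne_top, ENNReal.toReal_ofReal hp0.le]
    simp only [Pi.sub_apply, Real.norm_eq_abs]
    rw [ENNReal.toReal_ofReal (Real.rpow_nonneg hI _), Real.rpow_inv_rpow hI hp0.ne']
  have hC : CauchySeq fun n => (hf n).toLp (f n) := by
    refine Metric.cauchySeq_iff.2 fun ε hε => ?_
    obtain ⟨n₀, h⟩ := hcau ((ε / 2) ^ p) (by positivity)
    refine ⟨n₀, fun m hm n hn => ?_⟩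
    have h1 := h m hm n hn
    rw [← hnorm (hf m) (hf n), Real.rpow_le_rpow_iff (norm_nonneg _) (by positivity) hp0] at h1
    rw [dist_eq_norm]
    linarith
  obtain ⟨F, hF⟩ := cauchySeq_tendsto_of_complete hC
  have hFm := Lp.memLp F
  refine ⟨hFm.1.mk F, hFm.1.stronglyMeasurable_mk.measurable,
    hFm.ae_eq hFm.1.ae_eq_mk, ?_⟩
  have h0 := (tendsto_iff_norm_sub_tendsto_zero.1 hF).rpow_const (p := p) (Or.inr hp0.le)
  rw [Real.zero_rpow hp0.ne'] at h0
  refine h0.congr fun n => ?_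
  have h1 := hnorm (hf n) hFm
  rw [Lp.toLp_coeFn] at h1
  rw [h1]
  refine integral_congr_ae ?_
  filter_upwards [hFm.1.ae_eq_mk] with ω hω
  rw [hω]

lemma integral_powDeficit (hp : 1 < p) {v w : Ω → ℝ} (hv : MemLp v (ENNReal.ofReal p) P)
    (hw : MemLp w (ENNReal.ofReal p) P) :
    Integrable (fun ω => powDeficit p (v ω) (w ω)) P ∧
      ∫ ω, powDeficit p (v ω) (w ω) ∂P =
        (∫ ω, |v ω| ^ p ∂P + ∫ ω, |w ω| ^ p ∂P) / 2 - ∫ ω, |(v ω + w ω) / 2| ^ p ∂P := by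
  have h1 := integrable_abs_rpow hp hv
  have h2 := integrable_abs_rpow hp hw
  have h3 : Integrable (fun ω => |(v ω + w ω) / 2| ^ p) P := by
    refine integrable_abs_rpow hp ?_
    have := (hv.add hw).const_mul (1 / 2 : ℝ)
    refine this.ae_eq (ae_of_all _ fun ω => ?_)
    simp only [Pi.add_apply]
    ring
  have h4 : Integrable (fun ω => (|v ω| ^ p + |w ω| ^ p) / 2) P := (h1.add h2).div_const 2
  refine ⟨h4.sub h3, ?_⟩
  simp only [powDeficit]
  rw [integral_sub h4 h3, integral_div, integral_add h1 h2]

lemma integral_abs_sub_rpow_le (hp : 1 < p) {δ c : ℝ}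
    (hc : ∀ x y : ℝ, |x - y| ^ p ≤ δ * (|x| ^ p + |y| ^ p) + c * powDeficit p x y)
    {v w : Ω → ℝ} (hv : MemLp v (ENNReal.ofReal p) P) (hw : MemLp w (ENNReal.ofReal p) P) :
    ∫ ω, |v ω - w ω| ^ p ∂P ≤ δ * (∫ ω, |v ω| ^ p ∂P + ∫ ω, |w ω| ^ p ∂P) +
      c * ∫ ω, powDeficit p (v ω) (w ω) ∂P := by
  have h1 := integrable_abs_rpow hp hv
  have h2 := integrable_abs_rpow hp hw
  have h3 := (integral_powDeficit hp hv hw).1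
  have h4 := integrable_abs_rpow hp (hv.sub hw)
  have h5 : Integrable (fun ω => δ * (|v ω| ^ p + |w ω| ^ p)) P := (h1.add h2).const_mul δ
  rw [← integral_add h1 h2, ← integral_const_mul, ← integral_const_mul,
    ← integral_add h5 (h3.const_mul c)]
  exact integral_mono h4 (h5.add (h3.const_mul c)) fun ω => hc (v ω) (w ω)

lemma lintegral_tsum_abs_sub_rpow_lt_top (hp : 1 < p) {f : ℕ → Ω → ℝ} {f' : Ω → ℝ}
    (hf : ∀ n, MemLp (f n) (ENNReal.ofReal p) P) (hf' : MemLp f' (ENNReal.ofReal p) P)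
    (h : ∀ n, ∫ ω, |f n ω - f' ω| ^ p ∂P ≤ (1 / 2) ^ n) :
    ∫⁻ ω, ∑' n, ENNReal.ofReal (|f n ω - f' ω| ^ p) ∂P < ⊤ := by
  have hint : ∀ n, Integrable (fun ω => |f n ω - f' ω| ^ p) P := fun n =>
    integrable_abs_rpow hp ((hf n).sub hf')
  rw [lintegral_tsum fun n => (hint n).1.aemeasurable.ennreal_ofReal]
  calc ∑' n, ∫⁻ ω, ENNReal.ofReal (|f n ω - f' ω| ^ p) ∂P
      ≤ ∑' n : ℕ, ENNReal.ofReal ((1 / 2) ^ n) := by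
        refine ENNReal.tsum_le_tsum fun n => ?_
        rw [← ofReal_integral_eq_lintegral_ofReal (hint n) (ae_of_all _ fun ω => by positivity)]
        exact ENNReal.ofReal_le_ofReal (h n)
    _ < ⊤ := by
        rw [← ENNReal.ofReal_tsum_of_nonneg (fun n => by positivity) summable_geometric_two]
        exact ENNReal.ofReal_lt_top

lemma tendsto_of_tsum_abs_sub_rpow_ne_top (hp : 1 < p) {x : ℕ → ℝ} {x' : ℝ}
    (h : ∑' n, ENNReal.ofReal (|x n - x'| ^ p) ≠ ⊤) : Tendsto x atTop (𝓝 x') := by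
  have hp0 : 0 < p := by linarith
  have h1 := (ENNReal.tendsto_toReal ENNReal.zero_ne_top).comp
    (ENNReal.tendsto_atTop_zero_of_tsum_ne_top h)
  have h2 := h1.rpow_const (p := p⁻¹) (Or.inr (by positivity))
  rw [ENNReal.toReal_zero, Real.zero_rpow (by positivity)] at h2
  rw [tendsto_iff_norm_sub_tendsto_zero]
  refine h2.congr fun n => ?_
  simp only [Function.comp]
  rw [ENNReal.toReal_ofReal (by positivity), Real.rpow_rpow_inv (abs_nonneg _) hp0.ne',
    Real.norm_eq_abs]

lemma abs_rpow_le_two_rpow_mul (hp : 1 < p) (x y : ℝ) :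
    |x| ^ p ≤ 2 ^ p * (|y| ^ p + |x - y| ^ p) := by
  have h1 : |x| ≤ 2 * max |y| |x - y| := by
    have := abs_add_le y (x - y)
    rw [add_sub_cancel] at this
    linarith [le_max_left |y| |x - y|, le_max_right |y| |x - y|]
  have hp0 : 0 ≤ p := by linarith
  have hm : 0 ≤ max |y| |x - y| := (abs_nonneg y).trans (le_max_left _ _)
  calc |x| ^ p ≤ (2 * max |y| |x - y|) ^ p := Real.rpow_le_rpow (abs_nonneg x) h1 hp0
    _ = 2 ^ p * (max |y| |x - y|) ^ p := Real.mul_rpow two_pos.le hm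
    _ ≤ 2 ^ p * (|y| ^ p + |x - y| ^ p) := by
        refine mul_le_mul_of_nonneg_left ?_ (by positivity)
        have h2 : 0 ≤ |y| ^ p := by positivity
        have h3 : 0 ≤ |x - y| ^ p := by positivity
        obtain h | h := max_choice |y| |x - y| <;> rw [h] <;> linarith

lemma memLp_of_lintegral_le (hp : 1 < p) {f : Ω → ℝ} (hf : Measurable f) {B : ℝ}
    (hB : ∫⁻ ω, ENNReal.ofReal (|f ω| ^ p) ∂P ≤ ENNReal.ofReal B) (hB0 : 0 ≤ B) :
    MemLp f (ENNReal.ofReal p) P ∧ ∫ ω, |f ω| ^ p ∂P ≤ B := by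
  have hm : AEStronglyMeasurable (fun ω => |f ω| ^ p) P :=
    ((continuous_abs_rpow hp).measurable.comp hf).aestronglyMeasurable
  have hnn : 0 ≤ᵐ[P] fun ω => |f ω| ^ p := ae_of_all _ fun ω => by positivity
  have hint : Integrable (fun ω => |f ω| ^ p) P :=
    ⟨hm, (hasFiniteIntegral_iff_ofReal hnn).2 (hB.trans_lt ENNReal.ofReal_lt_top)⟩
  refine ⟨(integrable_abs_rpow_iff hp hf.aestronglyMeasurable).1 hint, ?_⟩
  rw [← ofReal_integral_eq_lintegral_ofReal hint hnn] at hB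
  exact (ENNReal.ofReal_le_ofReal_iff hB0).1 hB

/-- Bounded sequences in `L^p`, `p > 1`, whose images under a convex function `g` are also bounded
in `L^p`, have a.s. convergent forward convex combinations along which `g` is dominated
in `L^p`. -/
theorem exists_fwdConvComb_dominated (hp : 1 < p) {g : ℝ → ℝ} (hg : ConvexOn ℝ univ g)
    (hg0 : ∀ y, 0 ≤ g y) {ξ : ℕ → Ω → ℝ} (hξ : ∀ n, Measurable (ξ n)) {B : ℝ} (hB0 : 0 ≤ B)
    (hB : ∀ n, ∫⁻ ω, ENNReal.ofReal (|ξ n ω| ^ p) ∂P ≤ ENNReal.ofReal B)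
    (hgB : ∀ n, ∫⁻ ω, ENNReal.ofReal (g (ξ n ω) ^ p) ∂P ≤ ENNReal.ofReal B) :
    ∃ ξb : ℕ → Ω → ℝ, FwdConvComb ξ ξb ∧ (∀ n, Measurable (ξb n)) ∧
      ∃ ξ₀ : Ω → ℝ, Measurable ξ₀ ∧ (∀ᵐ ω ∂P, Tendsto (fun n => ξb n ω) atTop (𝓝 (ξ₀ ω))) ∧
      ∃ W : Ω → ℝ≥0∞, AEMeasurable W P ∧ ∫⁻ ω, W ω ∂P < ⊤ ∧
        ∀ n ω, ENNReal.ofReal (g (ξb n ω) ^ p) ≤ W ω := by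
  have hp0 : 0 < p := by linarith
  have hgm : Measurable g := (continuousOn_univ.1 (hg.continuousOn isOpen_univ)).measurable
  have hξp := fun n => memLp_of_lintegral_le hp (hξ n) (hB n) hB0
  have hgp := fun n => memLp_of_lintegral_le (P := P) hp (hgm.comp (hξ n)) (B := B)
    (by simpa [abs_of_nonneg (hg0 _)] using hgB n) hB0
  set N : (Ω → ℝ) × (Ω → ℝ) → ℝ := fun v => ∫ ω, |v.1 ω| ^ p ∂P + ∫ ω, |v.2 ω| ^ p ∂P with hN
  have hI0 : ∀ f : Ω → ℝ, 0 ≤ ∫ ω, |f ω| ^ p ∂P := fun f =>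
    integral_nonneg fun ω => by positivity
  obtain ⟨v, hv, hvN, hvd⟩ := exists_forward_almost_minimizers N
    (fun v => add_nonneg (hI0 _) (hI0 _)) (fun n => (ξ n, g ∘ ξ n)) (M := B + B)
    (fun n => add_le_add (hξp n).2 (hgp n).2)
  set S : Set ((Ω → ℝ) × (Ω → ℝ)) := {v | Measurable v.1 ∧ MemLp v.1 (ENNReal.ofReal p) P ∧
    MemLp v.2 (ENNReal.ofReal p) P ∧ ∀ ω, g (v.1 ω) ≤ v.2 ω} with hS
  have hSconv : Convex ℝ S := by
    rintro v ⟨h1, h2, h3, h4⟩ w ⟨k1, k2, k3, k4⟩ a b ha hb hab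
    refine ⟨(h1.const_smul a).add (k1.const_smul b), (h2.const_smul a).add (k2.const_smul b),
      (h3.const_smul a).add (k3.const_smul b), fun ω => ?_⟩
    refine (hg.2 (mem_univ (v.1 ω)) (mem_univ (w.1 ω)) ha hb hab).trans ?_
    exact add_le_add (mul_le_mul_of_nonneg_left (h4 ω) ha) (mul_le_mul_of_nonneg_left (k4 ω) hb)
  have hvS : ∀ n, v n ∈ S := fun n => by
    refine convexHull_min ?_ hSconv (hv n)
    rintro _ ⟨k, -, rfl⟩
    exact ⟨hξ k, (hξp k).1, (hgp k).1, fun ω => le_rfl⟩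
  have hD0 : ∀ f f' : Ω → ℝ, 0 ≤ ∫ ω, powDeficit p (f ω) (f' ω) ∂P := fun f f' =>
    integral_nonneg fun ω => powDeficit_nonneg hp _ _
  have hcau : ∀ ε > 0, ∃ n₀, ∀ n ≥ n₀, ∀ m ≥ n₀,
      ∫ ω, |(v n).1 ω - (v m).1 ω| ^ p ∂P ≤ ε ∧ ∫ ω, |(v n).2 ω - (v m).2 ω| ^ p ∂P ≤ ε := by
    intro ε hε
    set R := 2 * (B + B + 1) with hR
    have hR0 : 0 < R := by positivity
    obtain ⟨c, hc0, hc⟩ := abs_sub_rpow_le hp (δ := ε / 2 / R) (by positivity)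
    obtain ⟨n₀, hn₀⟩ := hvd (ε / 2 / (c + 1)) (by positivity)
    refine ⟨n₀, fun n hn m hm => ?_⟩
    have hd := hn₀ n hn m hm
    have hsum : ∫ ω, powDeficit p ((v n).1 ω) ((v m).1 ω) ∂P +
        ∫ ω, powDeficit p ((v n).2 ω) ((v m).2 ω) ∂P ≤ ε / 2 / (c + 1) := by
      rw [(integral_powDeficit hp (hvS n).2.1 (hvS m).2.1).2,
        (integral_powDeficit hp (hvS n).2.2.1 (hvS m).2.2.1).2]
      have hhalf : ∀ x y : ℝ, (x + y) / 2 = 1 / 2 * (x + y) := fun x y => by ring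
      simp only [hN, Prod.smul_fst, Prod.smul_snd, Prod.fst_add, Prod.snd_add, Pi.smul_apply,
        Pi.add_apply, smul_eq_mul, ← hhalf] at hd
      linarith
    have hfin : ∀ {a d I : ℝ}, a ≤ R → 0 ≤ d → d ≤ ε / 2 / (c + 1) →
        I ≤ ε / 2 / R * a + c * d → I ≤ ε := fun {a d I} ha hd0 hd hI => by
      have h1 : ε / 2 / R * a ≤ ε / 2 := by
        calc ε / 2 / R * a ≤ ε / 2 / R * R := mul_le_mul_of_nonneg_left ha (by positivity)
          _ = ε / 2 := div_mul_cancel₀ _ hR0.ne'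
      have h2 : (c + 1) * d ≤ ε / 2 := by
        rw [le_div_iff₀ (by positivity)] at hd
        linarith
      linarith
    have hn1 := hvN n
    have hm1 := hvN m
    simp only [hN] at hn1 hm1
    have i1 := hI0 (v n).1
    have i2 := hI0 (v n).2
    have i3 := hI0 (v m).1
    have i4 := hI0 (v m).2
    have d1 := hD0 (v n).1 (v m).1
    have d2 := hD0 (v n).2 (v m).2
    exact ⟨hfin (by linarith) d1 (by linarith)
        (integral_abs_sub_rpow_le hp hc (hvS n).2.1 (hvS m).2.1),
      hfin (by linarith) d2 (by linarith)
        (integral_abs_sub_rpow_le hp hc (hvS n).2.2.1 (hvS m).2.2.1)⟩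
  obtain ⟨ξ₀, hξ₀m, hξ₀p, hξ₀⟩ := exists_tendsto_integral_abs_sub_rpow hp
    (fun n => (hvS n).2.1) fun ε hε => (hcau ε hε).imp fun n₀ h n hn m hm => (h n hn m hm).1
  obtain ⟨γ, hγm, hγp, hγ⟩ := exists_tendsto_integral_abs_sub_rpow hp
    (fun n => (hvS n).2.2.1) fun ε hε => (hcau ε hε).imp fun n₀ h n hn m hm => (h n hn m hm).2
  obtain ⟨φ, hφ, hφk⟩ := extraction_forall_of_eventually (P := fun k n =>
      ∫ ω, |(v n).1 ω - ξ₀ ω| ^ p ∂P ≤ (1 / 2) ^ k ∧ ∫ ω, |(v n).2 ω - γ ω| ^ p ∂P ≤ (1 / 2) ^ k)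
    fun k => (hξ₀.eventually (ge_mem_nhds (by positivity))).and
      (hγ.eventually (ge_mem_nhds (by positivity)))
  have hsum1 := lintegral_tsum_abs_sub_rpow_lt_top hp (fun k => (hvS (φ k)).2.1) hξ₀p
    fun k => (hφk k).1
  have hsum2 := lintegral_tsum_abs_sub_rpow_lt_top hp (fun k => (hvS (φ k)).2.2.1) hγp
    fun k => (hφk k).2
  refine ⟨fun k => (v (φ k)).1, fun k => ?_, fun k => (hvS (φ k)).1, ξ₀, hξ₀m, ?_, fun ω =>
    ENNReal.ofReal (2 ^ p) * (ENNReal.ofReal (|γ ω| ^ p) +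
      ∑' k, ENNReal.ofReal (|(v (φ k)).2 ω - γ ω| ^ p)), ?_, ?_, fun k ω => ?_⟩
  · have h1 := mem_image_of_mem (LinearMap.fst ℝ (Ω → ℝ) (Ω → ℝ)) (hv (φ k))
    rw [LinearMap.image_convexHull] at h1
    refine convexHull_mono ?_ h1
    rintro _ ⟨_, ⟨j, hj, rfl⟩, rfl⟩
    exact ⟨j, (hφ.id_le k).trans hj, rfl⟩
  · have hm : AEMeasurable (fun ω => ∑' k, ENNReal.ofReal (|(v (φ k)).1 ω - ξ₀ ω| ^ p)) P :=
      AEMeasurable.tsum fun k => (integrable_abs_rpow hp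
        ((hvS (φ k)).2.1.sub hξ₀p)).1.aemeasurable.ennreal_ofReal
    filter_upwards [ae_lt_top' hm hsum1.ne] with ω hω
    exact tendsto_of_tsum_abs_sub_rpow_ne_top hp hω.ne
  · exact ((integrable_abs_rpow hp hγp).1.aemeasurable.ennreal_ofReal.add
      (AEMeasurable.tsum fun k => (integrable_abs_rpow hp
        ((hvS (φ k)).2.2.1.sub hγp)).1.aemeasurable.ennreal_ofReal)).const_mul _
  · have hγi := integrable_abs_rpow hp hγp
    rw [lintegral_const_mul' _ _ ENNReal.ofReal_ne_top,
      lintegral_add_left' hγi.1.aemeasurable.ennreal_ofReal]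
    exact ENNReal.mul_lt_top ENNReal.ofReal_lt_top (ENNReal.add_lt_top.2
      ⟨(hasFiniteIntegral_iff_ofReal (ae_of_all _ fun ω => by positivity)).1 hγi.2, hsum2⟩)
  · have h1 : g ((v (φ k)).1 ω) ^ p ≤ |(v (φ k)).2 ω| ^ p :=
      Real.rpow_le_rpow (hg0 _) (((hvS (φ k)).2.2.2 ω).trans (le_abs_self _)) hp0.le
    refine (ENNReal.ofReal_le_ofReal (h1.trans (abs_rpow_le_two_rpow_mul hp _ (γ ω)))).trans ?_
    rw [ENNReal.ofReal_mul (by positivity), ENNReal.ofReal_add (by positivity) (by positivity)]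
    exact mul_le_mul' le_rfl (add_le_add le_rfl (ENNReal.le_tsum k))

end Lp

/-- A bound on the Luxemburg norm controls the modular of the rescaled function. -/
lemma IsYoung.lintegral_conj_div_le_one {Ω : Type*} [MeasurableSpace Ω] {P : Measure Ω}
    {Φ : ℝ → ℝ} (h : IsYoung Φ) {f : Ω → ℝ} (hf : MemOrlicz P (conj Φ) f) {L : ℝ}
    (hL : luxNorm P (conj Φ) f < L) :
    ∫⁻ ω, ENNReal.ofReal (conj Φ (f ω / L)) ∂P ≤ 1 := by
  have hne : {l : ℝ | 0 < l ∧ ∫⁻ ω, ENNReal.ofReal (conj Φ (f ω / l)) ∂P ≤ 1}.Nonempty := by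
    obtain ⟨-, l, hl, hI⟩ := hf
    set I := ∫⁻ ω, ENNReal.ofReal (conj Φ (l * f ω)) ∂P with hIdef
    have hI0 : 0 ≤ I.toReal := ENNReal.toReal_nonneg
    set t := 1 / (1 + I.toReal) with ht
    have ht0 : 0 < t := by positivity
    have ht1 : t ≤ 1 := by
      rw [ht, div_le_one (by positivity)]
      linarith
    refine ⟨(t * l)⁻¹, by positivity, ?_⟩
    calc ∫⁻ ω, ENNReal.ofReal (conj Φ (f ω / (t * l)⁻¹)) ∂P
        ≤ ∫⁻ ω, ENNReal.ofReal t * ENNReal.ofReal (conj Φ (l * f ω)) ∂P := by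
          refine lintegral_mono fun ω => ?_
          rw [← ENNReal.ofReal_mul ht0.le,
            show f ω / (t * l)⁻¹ = t * (l * f ω) by rw [div_inv_eq_mul]; ring]
          exact ENNReal.ofReal_le_ofReal (h.conj_mul_le ht0.le ht1 _)
      _ = ENNReal.ofReal (t * I.toReal) := by
          rw [lintegral_const_mul' _ _ ENNReal.ofReal_ne_top, ENNReal.ofReal_mul ht0.le,
            ENNReal.ofReal_toReal hI.ne]
      _ ≤ 1 := by
          rw [ENNReal.ofReal_le_one, ht, one_div_mul_eq_div, div_le_one (by positivity)]
          linarith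
  obtain ⟨l, ⟨hl, hI⟩, hlL⟩ := exists_lt_of_csInf_lt hne hL
  refine (lintegral_mono fun ω => ENNReal.ofReal_le_ofReal (h.conj_mono ?_)).trans hI
  rw [abs_div, abs_div, abs_of_pos hl, abs_of_pos (hl.trans hlL)]
  exact div_le_div_of_nonneg_left (abs_nonneg _) hl hlL.le

/-- If `Φ ∈ Δ₂`, every norm-bounded sequence `(ξ_n)` in
`L_{Φ*}` admits forward convex combinations `ξ̄_n ∈ conv(ξ_k ; k ≥ n)` and a
`ξ ∈ L_{Φ*}` with `ξ̄_n → ξ` in order: `sup_n |ξ̄_n| ∈ L_{Φ*}` and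
`ξ̄_n → ξ` a.s. -/
theorem statement12
    {Ω : Type*} [MeasurableSpace Ω] (P : Measure Ω) [IsProbabilityMeasure P]
    (Φ : ℝ → ℝ) (hΦ : IsYoung Φ) (hΔ : Delta2 Φ)
    (ξ : ℕ → Ω → ℝ) (hmem : ∀ n, MemOrlicz P (conj Φ) (ξ n))
    (hbdd : ∃ M : ℝ, ∀ n, luxNorm P (conj Φ) (ξ n) ≤ M) :
    ∃ ξb : ℕ → Ω → ℝ, FwdConvComb ξ ξb ∧
      ∃ ξ₀ : Ω → ℝ, MemOrlicz P (conj Φ) ξ₀ ∧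
        supMem P (conj Φ) ξb ∧
        ∀ᵐ ω ∂P, Tendsto (fun n => ξb n ω) atTop (𝓝 (ξ₀ ω)) := by
  obtain ⟨p, A, G, hp, hA, hGc, hG0, hGle, hleG, hpow⟩ := hΦ.exists_convex_root hΔ
  obtain ⟨M, hM⟩ := hbdd
  set L := max M 0 + 1 with hL
  have hL0 : 0 < L := by positivity
  have hmod : ∀ n, ∫⁻ ω, ENNReal.ofReal (conj Φ (ξ n ω / L)) ∂P ≤ 1 := fun n =>
    hΦ.lintegral_conj_div_le_one (hmem n)
      ((hM n).trans_lt (by linarith [le_max_left M 0]))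
  have hgc : ConvexOn ℝ univ fun y => G (y / L) := by
    refine ⟨convex_univ, fun x _ y _ a b ha hb hab => ?_⟩
    have := hGc.2 (mem_univ (x / L)) (mem_univ (y / L)) ha hb hab
    simp only [smul_eq_mul] at this ⊢
    rwa [add_div, mul_div_assoc, mul_div_assoc]
  set c := A + L ^ p * A with hc
  have hc0 : 0 ≤ c := by positivity
  have hbound : ∀ (F : ℝ → ℝ), (∀ y, F y ≤ c * (1 + conj Φ (y / L))) →
      ∀ n, ∫⁻ ω, ENNReal.ofReal (F (ξ n ω)) ∂P ≤ ENNReal.ofReal (c * 2) := fun F hF n => by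
    calc ∫⁻ ω, ENNReal.ofReal (F (ξ n ω)) ∂P
        ≤ ∫⁻ ω, ENNReal.ofReal c * (1 + ENNReal.ofReal (conj Φ (ξ n ω / L))) ∂P := by
          refine lintegral_mono fun ω => (ENNReal.ofReal_le_ofReal (hF _)).trans_eq ?_
          rw [ENNReal.ofReal_mul hc0, ENNReal.ofReal_add zero_le_one (hΦ.conj_nonneg _),
            ENNReal.ofReal_one]
      _ = ENNReal.ofReal c * (1 + ∫⁻ ω, ENNReal.ofReal (conj Φ (ξ n ω / L)) ∂P) := by
          rw [lintegral_const_mul' _ _ ENNReal.ofReal_ne_top,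
            lintegral_add_left measurable_const, lintegral_one, measure_univ]
      _ ≤ ENNReal.ofReal c * (1 + 1) := by gcongr; exact hmod n
      _ = ENNReal.ofReal (c * 2) := by
          rw [ENNReal.ofReal_mul hc0, ENNReal.ofReal_ofNat, one_add_one_eq_two]
  obtain ⟨ξb, hfwd, hξbm, ξ₀, hξ₀m, hlim, W, hWm, hW, hgW⟩ :=
    exists_fwdConvComb_dominated (P := P) hp hgc (fun y => hG0 _) (fun n => (hmem n).1)
      (B := c * 2) (by positivity)
      (hbound (fun y => |y| ^ p) fun y => by
        have h1 : |y| ^ p = L ^ p * |y / L| ^ p := by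
          rw [← abs_mul_rpow p hL0.le, mul_div_cancel₀ _ hL0.ne']
        have h2 := mul_le_mul_of_nonneg_left (hpow (y / L)) (by positivity : 0 ≤ L ^ p)
        have h3 : 0 ≤ A * (1 + conj Φ (y / L)) :=
          mul_nonneg hA (by linarith [hΦ.conj_nonneg (y / L)])
        rw [h1, hc]
        linarith)
      (hbound (fun y => G (y / L) ^ p) fun y => by
        have h1 : 0 ≤ L ^ p * A * (1 + conj Φ (y / L)) :=
          mul_nonneg (by positivity) (by linarith [hΦ.conj_nonneg (y / L)])
        rw [hc]
        linarith [hGle (y / L)])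
  have hV : ∀ᵐ ω ∂P, ENNReal.ofReal A + W ω < ⊤ := by
    filter_upwards [ae_lt_top' hWm hW.ne] with ω hω
    exact ENNReal.add_lt_top.2 ⟨ENNReal.ofReal_lt_top, hω⟩
  have hVint : ∫⁻ ω, (ENNReal.ofReal A + W ω) ∂P < ⊤ := by
    rw [lintegral_add_left measurable_const, lintegral_const, measure_univ, mul_one]
    exact ENNReal.add_lt_top.2 ⟨ENNReal.ofReal_lt_top, hW⟩
  have hdom : ∀ n ω, ENNReal.ofReal (conj Φ (ξb n ω / L / 2)) ≤ ENNReal.ofReal A + W ω :=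
    fun n ω => (ENNReal.ofReal_le_ofReal (hleG _)).trans (by
      rw [ENNReal.ofReal_add hA (Real.rpow_nonneg (hG0 _) _)]
      gcongr
      exact hgW n ω)
  have hbddω : ∀ᵐ ω ∂P, BddAbove (range fun n => |ξb n ω|) := by
    filter_upwards [hV] with ω hω
    refine ⟨L * (2 * (Φ 1 + (ENNReal.ofReal A + W ω).toReal)), ?_⟩
    rintro _ ⟨n, rfl⟩
    have h1 := hΦ.abs_le_conj (ξb n ω / L / 2)
    have h2 := (ENNReal.ofReal_le_iff_le_toReal hω.ne).1 (hdom n ω)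
    rw [abs_div, abs_div, abs_of_pos hL0, abs_two, div_le_iff₀' two_pos, div_le_iff₀' hL0] at h1
    refine h1.trans (mul_le_mul_of_nonneg_left ?_ hL0.le)
    linarith
  have hsupdom : ∀ᵐ ω ∂P, ∀ y, |y| ≤ ⨆ n, |ξb n ω| →
      ENNReal.ofReal (conj Φ ((4 * L)⁻¹ * y)) ≤ ENNReal.ofReal A + W ω := by
    filter_upwards [hbddω] with ω hω y hy
    obtain ⟨n, hn⟩ : ∃ n, (⨆ n, |ξb n ω|) / 2 ≤ |ξb n ω| := by
      obtain h0 | h0 := le_or_gt (⨆ n, |ξb n ω|) 0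
      · exact ⟨0, by linarith [abs_nonneg (ξb 0 ω)]⟩
      · exact (exists_lt_of_lt_ciSup (half_lt_self h0)).imp fun n h => h.le
    refine (ENNReal.ofReal_le_ofReal (hΦ.conj_mono ?_)).trans (hdom n ω)
    rw [abs_mul, abs_of_pos (by positivity : 0 < (4 * L)⁻¹), abs_div, abs_div, abs_of_pos hL0,
      abs_two, div_div, inv_mul_eq_div, div_le_div_iff₀ (by positivity) (by positivity)]
    nlinarith
  refine ⟨ξb, hfwd, ξ₀, ⟨hξ₀m, (4 * L)⁻¹, by positivity, ?_⟩,
    ⟨hbddω, Measurable.iSup fun n => (hξbm n).abs, (4 * L)⁻¹, by positivity, ?_⟩, hlim⟩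
  · refine (lintegral_mono_ae ?_).trans_lt hVint
    filter_upwards [hsupdom, hlim, hbddω] with ω h1 h2 h3
    exact h1 _ (le_of_tendsto' h2.abs fun n => le_ciSup h3 n)
  · refine (lintegral_mono_ae ?_).trans_lt hVint
    filter_upwards [hsupdom] with ω h1
    exact h1 _ (abs_of_nonneg (Real.iSup_nonneg fun n => abs_nonneg _)).le

end OrliczPaper
end
end
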